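/- If k convex planar bodies with pairwise disjoint interiors are all contained in a convex planar body C, then the sum of their perimeters is at most per(C) + 2(k-1)·diam(C). -/

import Mathlib

open MeasureTheory Set

noncomputable section

abbrev E2 := EuclideanSpace ℝ (Fin 2)

def IsConvexBody (C : Set E2) : Prop :=
  IsCompact C ∧ Convex ℝ C ∧ (interior C).Nonempty

/-- perimeter of a planar convex body: the length (1-dimensional Hausdorff measure)
of its boundary curve. -/
def per (C : Set E2) : ℝ := (μH[1] (frontier C)).toReal

namespace Forest
variable {X : Type*} [Fintype X] {E : Type*} [NormedAddCommGroup E] [NormedSpace ℝ E]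

/-- maximum principle for a kernel with absorbing set `B`. -/
def UP (B : Set X) (P : X → X → ℝ) : Prop :=
  ∀ u : X → ℝ, (∀ x, x ∉ B → u x ≤ ∑ y, P x y * u y) → (∀ b ∈ B, u b ≤ 0) → ∀ x, u x ≤ 0

def Sto (B : Set X) (P : X → X → ℝ) : Prop :=
  ∀ x, x ∉ B → (∀ y, 0 ≤ P x y) ∧ ∑ y, P x y = 1

theorem UP.mono {B B' : Set X} {P : X → X → ℝ} (h : UP B P) (hs : Sto B P) (hB : B ⊆ B') :
    UP B' P := by
  intro u hu hb x
  have := h (fun x => max (u x) 0) ?_ ?_ x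
  · exact (le_max_left _ _).trans this
  · intro x hx
    have h0 : 0 ≤ ∑ y, P x y * max (u y) 0 :=
      Finset.sum_nonneg fun y _ => mul_nonneg ((hs x hx).1 y) (le_max_right _ _)
    refine max_le ?_ h0
    by_cases hx' : x ∈ B'
    · exact (hb x hx').trans h0
    · exact (hu x hx').trans (Finset.sum_le_sum fun y _ =>
        mul_le_mul_of_nonneg_left (le_max_left _ _) ((hs x hx).1 y))
  · intro b hb'
    exact max_le (hb b (hB hb')) le_rfl

theorem UP.exists_harm {B : Set X} {P : X → X → ℝ} (h : UP B P) (b : X → ℝ) :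
    ∃ u : X → ℝ, (∀ x ∈ B, u x = b x) ∧ ∀ x, x ∉ B → u x = ∑ y, P x y * u y := by
  classical
  let T : (X → ℝ) →ₗ[ℝ] (X → ℝ) :=
    { toFun := fun u x => if x ∈ B then u x else u x - ∑ y, P x y * u y
      map_add' := by
        intro u v; ext x
        by_cases hx : x ∈ B <;> simp [hx, mul_add, Finset.sum_add_distrib]; ring
      map_smul' := by
        intro c u; ext x
        by_cases hx : x ∈ B <;> simp [hx, mul_sub, Finset.mul_sum]
        exact Finset.sum_congr rfl fun y _ => by ring }
  have hinj : Function.Injective T := by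
    rw [← LinearMap.ker_eq_bot, LinearMap.ker_eq_bot']
    intro u hu
    have h1 : ∀ x ∈ B, u x = 0 := fun x hx => by
      have := congrFun hu x; simpa [T, hx] using this
    have h2 : ∀ x, x ∉ B → u x = ∑ y, P x y * u y := fun x hx => by
      have := congrFun hu x
      simp only [T, LinearMap.coe_mk, AddHom.coe_mk, hx, if_false, Pi.zero_apply] at this
      linarith
    ext x
    apply le_antisymm
    · exact h u (fun x hx => (h2 x hx).le) (fun x hx => (h1 x hx).le) x
    · have := h (fun x => - u x) (fun x hx => by simp [h2 x hx])
        (fun x hx => by simp [h1 x hx]) x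
      simpa using this
  obtain ⟨u, hu⟩ := (LinearMap.injective_iff_surjective.1 hinj) (fun x => if x ∈ B then b x else 0)
  refine ⟨u, fun x hx => ?_, fun x hx => ?_⟩
  · have := congrFun hu x; simpa [T, hx] using this
  · have := congrFun hu x
    simp only [T, LinearMap.coe_mk, AddHom.coe_mk, hx, if_false] at this
    linarith

theorem step [DecidableEq X] {B : Set X} {P : X → X → ℝ} (h : UP B P) (hs : Sto B P)
    {f : (X → E) → ℝ} (hf : ConvexOn ℝ univ f) {φ : X → E}
    (hφ : ∀ x, x ∉ B → φ x = ∑ y, P x y • φ y) (v : X) (hv : v ∉ B) :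
    ∃ x : X, ∃ ψ : X → E, 0 < P v x ∧ (∀ b ∈ B, ψ b = φ b) ∧
      UP B (Function.update P v (Pi.single x 1)) ∧
      Sto B (Function.update P v (Pi.single x 1)) ∧
      (∀ y, y ∉ B → ψ y = ∑ z, (Function.update P v (Pi.single x 1)) y z • ψ z) ∧ f φ ≤ f ψ := by
  classical
  have hB' : B ⊆ insert v B := subset_insert _ _
  have h' := h.mono hs hB'
  obtain ⟨a, ha1, ha2⟩ := h'.exists_harm (fun x => if x = v then 1 else 0)
  have hav : a v = 1 := by simpa using ha1 v (mem_insert _ _)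
  have hab : ∀ b ∈ B, a b = 0 := fun b hb => by
    have := ha1 b (mem_insert_of_mem _ hb)
    rwa [if_neg (by rintro rfl; exact hv hb)] at this
  have hale : ∀ x, a x ≤ 1 := by
    intro x
    have := h' (fun x => a x - 1) ?_ ?_ x
    · simpa using this
    · intro x hx
      have hx' : x ∉ B := fun h => hx (hB' h)
      simp only [mul_sub, Finset.sum_sub_distrib, mul_one, (hs x hx').2, ha2 x hx]
      exact le_rfl
    · intro b hb
      rcases hb with rfl | hb
      · simp [hav]
      · simp [hab b hb]
  -- bad points
  have hbad : ∀ x, a x = 1 → φ x = φ v := by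
    let Z : Set X := {x | a x = 1}
    have hZB : B ⊆ insert v Zᶜ := by
      intro b hb; right; simp [Z, hab b hb]
    have hnb : ∀ x, x ∈ Z → x ≠ v → ∀ y, 0 < P x y → y ∈ Z := by
      intro x hx hxv y hy
      have hxB : x ∉ insert v B := by
        rintro (rfl | hb)
        · exact hxv rfl
        · have : a x = 1 := hx
          rw [hab x hb] at this; norm_num at this
      have hxB' : x ∉ B := fun h => hxB (hB' h)
      by_contra hyZ
      have hlt : a y < 1 := lt_of_le_of_ne (hale y) hyZ
      have : ∑ z, P x z * a z < ∑ z, P x z * 1 :=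
        Finset.sum_lt_sum (fun z _ => mul_le_mul_of_nonneg_left (hale z) ((hs x hxB').1 z))
          ⟨y, Finset.mem_univ _, mul_lt_mul_of_pos_left hlt hy⟩
      rw [← ha2 x hxB] at this
      simp only [mul_one, (hs x hxB').2] at this
      exact absurd hx this.ne
    have key := (h.mono hs hZB) (fun x => if x ∈ Z then ‖φ x - φ v‖ else 0) ?_ ?_
    · intro x hx
      have := key x
      rw [if_pos (show x ∈ Z from hx)] at this
      exact sub_eq_zero.1 (norm_le_zero_iff.1 this)
    · intro x hx
      have hxv : x ≠ v := fun h => hx (by simp [h])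
      have hxZ : x ∈ Z := by
        by_contra hh; exact hx (mem_insert_of_mem _ hh)
      have hxB : x ∉ B := fun h => hx (hZB h)
      rw [if_pos hxZ]
      have e1 : φ x - φ v = ∑ y, P x y • (φ y - φ v) := by
        simp only [smul_sub, Finset.sum_sub_distrib, ← Finset.sum_smul, (hs x hxB).2, one_smul]
        rw [← hφ x hxB]
      rw [e1]
      refine (norm_sum_le _ _).trans (Finset.sum_le_sum fun y _ => ?_)
      rw [norm_smul, Real.norm_of_nonneg ((hs x hxB).1 y)]
      rcases ((hs x hxB).1 y).eq_or_lt with h0 | h0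
      · simp [← h0]
      · rw [if_pos (hnb x hxZ hxv y h0)]
    · intro b hb
      rcases hb with rfl | hb
      · simp
      · have : b ∉ Z := hb
        simp [this]
  have hP := (hs v hv).1
  have hPs := (hs v hv).2
  let w : X → ℝ := fun x => P v x * (1 - a x)
  have hw : ∀ x, 0 ≤ w x := fun x => mul_nonneg (hP x) (by linarith [hale x])
  have hwpos : 0 < ∑ x, w x := by
    refine lt_of_le_of_ne (Finset.sum_nonneg fun x _ => hw x) fun h0 => ?_
    have h1 : ∑ x, P v x * a x = 1 := by
      have : ∑ x, w x = 1 - ∑ x, P v x * a x := by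
        simp [w, mul_sub, Finset.sum_sub_distrib, hPs]
      linarith
    have := h a ?_ (fun b hb => (hab b hb).le) v
    · rw [hav] at this; norm_num at this
    · intro x hx
      by_cases hxv : x = v
      · subst hxv; rw [h1, hav]
      · exact (ha2 x (by simp [hxv, hx])).le
  let ψ : X → X → E := fun x y => φ y + (a y / (1 - a x)) • (φ x - φ v)
  have hψ : ∀ x, w x • (ψ x - φ) = fun y => a y • (P v x • (φ x - φ v)) := by
    intro x; ext1 y
    by_cases hx : a x = 1
    · simp [w, ψ, hx, hbad x hx]
    · have : 1 - a x ≠ 0 := fun h => hx (by linarith)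
      simp only [Pi.smul_apply, Pi.sub_apply, ψ, w, add_sub_cancel_left, smul_smul]
      congr 1; field_simp
  have hsum : ∑ x, w x • (ψ x - φ) = 0 := by
    simp only [hψ]
    ext1 y
    rw [Finset.sum_apply, ← Finset.smul_sum]
    have : ∑ x, P v x • (φ x - φ v) = 0 := by
      simp only [smul_sub, Finset.sum_sub_distrib, ← Finset.sum_smul, hPs, one_smul]
      rw [← hφ v hv, sub_self]
    rw [this]; simp
  have hcm : Finset.univ.centerMass w ψ = φ := by
    rw [Finset.centerMass, inv_smul_eq_iff₀ hwpos.ne', Finset.sum_smul]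
    rw [← sub_eq_zero, ← Finset.sum_sub_distrib, ← hsum]
    simp [smul_sub]
  -- restrict to good points
  let t := Finset.univ.filter fun x => w x ≠ 0
  have hcm' : t.centerMass w ψ = φ := by
    rw [← hcm]; exact Finset.centerMass_filter_ne_zero (t := Finset.univ) (w := w) ψ
  have hwt : 0 < ∑ x ∈ t, w x := by
    rw [Finset.sum_filter_ne_zero]; exact hwpos
  obtain ⟨x, hxt, hx⟩ := hf.exists_ge_of_centerMass (t := t) (w := w) (p := ψ)
    (fun i _ => hw i) hwt (fun i _ => mem_univ _)
  rw [hcm'] at hx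
  have hwx : w x ≠ 0 := (Finset.mem_filter.1 hxt).2
  have hPx : 0 < P v x := lt_of_le_of_ne (hP x) fun h0 => hwx (by simp [w, ← h0])
  have hax : a x < 1 := lt_of_le_of_ne (hale x) fun h0 => hwx (by simp [w, h0])
  refine ⟨x, ψ x, hPx, ?_, ?_, ?_, ?_, hx⟩
  · intro b hb; simp [ψ, hab b hb]
  · intro u hu hb
    have huv : u v ≤ u x := by
      have := hu v hv
      simpa [Pi.single_apply] using this
    have hle : ∀ y, u y ≤ max (u v) 0 * a y := by
      intro y
      have := h' (fun y => u y - max (u v) 0 * a y) ?_ ?_ y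
      · linarith
      · intro y hy
        have hyv : y ≠ v := fun h => hy (by simp [h])
        have hyB : y ∉ B := fun h => hy (hB' h)
        have h1 := hu y hyB
        rw [Function.update_of_ne hyv] at h1
        have h2 : ∑ z, P y z * (u z - max (u v) 0 * a z)
            = ∑ z, P y z * u z - max (u v) 0 * ∑ z, P y z * a z := by
          rw [Finset.mul_sum, ← Finset.sum_sub_distrib]
          exact Finset.sum_congr rfl fun z _ => by ring
        rw [h2, ← ha2 y hy]; linarith
      · intro b hb'
        rcases hb' with rfl | hb'
        · simp [hav]
        · simp [hab b hb', hb b hb']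
    have huv0 : u v ≤ 0 := by
      by_contra hc
      push Not at hc
      have := hle x
      rw [max_eq_left hc.le] at this
      nlinarith
    intro y
    have := hle y
    rwa [max_eq_right huv0, zero_mul] at this
  · intro y hy
    by_cases hyv : y = v
    · subst hyv
      simp only [Function.update_self]
      refine ⟨fun z => ?_, by simp⟩
      by_cases hz : z = x
      · subst hz; simp
      · simp [hz]
    · rw [Function.update_of_ne hyv]; exact hs y hy
  · intro y hy
    by_cases hyv : y = v
    · subst hyv
      simp only [Function.update_self, Pi.single_apply, ite_smul, one_smul, zero_smul,
        Finset.sum_ite_eq', Finset.mem_univ, if_true]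
      have h1 : 1 - a x ≠ 0 := by linarith
      have h2 : φ x = φ y + (φ x - φ y) := by abel
      simp only [ψ, hav]
      have : φ x + (a x / (1 - a x)) • (φ x - φ y)
          = φ y + ((1:ℝ) • (φ x - φ y) + (a x / (1 - a x)) • (φ x - φ y)) := by
        rw [one_smul]; abel
      rw [this, ← add_smul]
      congr 2; field_simp; ring
    · rw [Function.update_of_ne hyv]
      simp only [ψ]
      have hy' : y ∉ insert v B := by simp [hyv, hy]
      conv_lhs => rw [hφ y hy, ha2 y hy']
      simp only [smul_add, Finset.sum_add_distrib, Finset.sum_div, Finset.sum_smul, smul_smul]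
      congr 1
      exact Finset.sum_congr rfl fun z _ => by rw [mul_div_assoc]

theorem exists_forest [DecidableEq X] {B : Set X} {P : X → X → ℝ} (h : UP B P) (hs : Sto B P)
    {f : (X → E) → ℝ} (hf : ConvexOn ℝ univ f) {φ : X → E}
    (hφ : ∀ x, x ∉ B → φ x = ∑ y, P x y • φ y) :
    ∃ (g : X → X) (ρ : X → ℕ) (ψ : X → E), (∀ x, x ∉ B → 0 < P x (g x)) ∧
      (∀ x, x ∉ B → ρ (g x) < ρ x) ∧ (∀ b ∈ B, ψ b = φ b) ∧ (∀ x, x ∉ B → ψ x = ψ (g x)) ∧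
      f φ ≤ f ψ := by
  classical
  have main : ∀ s : Finset X, ∃ (Q : X → X → ℝ) (ψ : X → E) (g : X → X), UP B Q ∧ Sto B Q ∧
      (∀ x, x ∉ B → ∀ y, 0 < Q x y → 0 < P x y) ∧ (∀ b ∈ B, ψ b = φ b) ∧
      (∀ x, x ∉ B → ψ x = ∑ y, Q x y • ψ y) ∧ f φ ≤ f ψ ∧
      (∀ x ∈ s, x ∉ B → Q x = Pi.single (g x) 1) := by
    intro s
    induction s using Finset.induction_on with
    | empty => exact ⟨P, φ, id, h, hs, fun _ _ _ h => h, fun _ _ => rfl, hφ, le_rfl, by simp⟩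
    | insert v s hvs ih =>
      obtain ⟨Q, ψ, g, h1, h2, h3, h4, h5, h6, h7⟩ := ih
      by_cases hv : v ∈ B
      · refine ⟨Q, ψ, g, h1, h2, h3, h4, h5, h6, ?_⟩
        intro x hx hxB
        rcases Finset.mem_insert.1 hx with rfl | hx
        · exact absurd hv hxB
        · exact h7 x hx hxB
      · obtain ⟨x, ψ', k1, k2, k3, k4, k5, k6⟩ := step h1 h2 hf h5 v hv
        refine ⟨_, ψ', Function.update g v x, k3, k4, ?_, fun b hb => (k2 b hb).trans (h4 b hb),
          k5, h6.trans k6, ?_⟩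
        · intro y hy z hz
          by_cases hyv : y = v
          · subst hyv
            rw [Function.update_self] at hz
            by_cases hzx : z = x
            · subst hzx; exact h3 _ hy _ k1
            · simp [hzx] at hz
          · rw [Function.update_of_ne hyv] at hz; exact h3 y hy z hz
        · intro y hy hyB
          by_cases hyv : y = v
          · subst hyv; simp
          · rw [Function.update_of_ne hyv, Function.update_of_ne hyv]
            exact h7 y (Finset.mem_of_mem_insert_of_ne hy hyv) hyB
  obtain ⟨Q, ψ, g, h1, h2, h3, h4, h5, h6, h7⟩ := main Finset.univ
  have h7' : ∀ x, x ∉ B → Q x = Pi.single (g x) 1 := fun x hx => h7 x (Finset.mem_univ _) hx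
  have hterm : ∀ x, ∃ n, g^[n] x ∈ B := by
    let u : X → ℝ := fun x => if ∃ n, g^[n] x ∈ B then 0 else 1
    have := h1 u ?_ ?_
    · intro x
      by_contra hx
      have := this x
      simp only [u, if_neg hx] at this
      norm_num at this
    · intro x hx
      rw [h7' x hx]
      simp only [Pi.single_apply, ite_mul, one_mul, zero_mul, Finset.sum_ite_eq',
        Finset.mem_univ, if_true]
      by_cases hgx : ∃ n, g^[n] (g x) ∈ B
      · have : ∃ n, g^[n] x ∈ B := by
          obtain ⟨n, hn⟩ := hgx; exact ⟨n + 1, hn⟩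
        simp [u, hgx, this]
      · simp only [u, if_neg hgx]; split_ifs <;> norm_num
    · intro b hb
      simp only [u]; rw [if_pos ⟨0, hb⟩]
  refine ⟨g, fun x => Nat.find (hterm x), ψ, ?_, ?_, h4, ?_, h6⟩
  · intro x hx
    exact h3 x hx _ (by rw [h7' x hx]; simp)
  · intro x hx
    have hn := Nat.find_spec (hterm x)
    have h0 : Nat.find (hterm x) ≠ 0 := by
      intro h0; rw [h0] at hn; exact hx hn
    obtain ⟨m, hm⟩ := Nat.exists_eq_succ_of_ne_zero h0
    rw [hm] at hn
    show Nat.find (hterm (g x)) < Nat.find (hterm x)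
    rw [hm]
    exact Nat.lt_succ_of_le (Nat.find_min' _ hn)
  · intro x hx
    rw [h5 x hx, h7' x hx]
    simp [Pi.single_apply]

end Forest

namespace Forest

theorem card_le_quot {N I : Type*} [Fintype N] [Fintype I] (a b : I → N) :
    ∃ (Q : Type) (_ : Fintype Q) (q : N → Q), Function.Surjective q ∧ (∀ i, q (a i) = q (b i)) ∧
      Fintype.card N ≤ Fintype.card Q + Fintype.card I := by
  classical
  let r : N → N → Prop := fun x y => ∃ i, a i = x ∧ b i = y
  let Q0 := Quot r
  have : Finite Q0 := Quot.finite r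
  have : Fintype Q0 := Fintype.ofFinite _
  let e := Fintype.equivFin Q0
  refine ⟨Fin (Fintype.card Q0), inferInstance, fun n => e (Quot.mk r n), ?_, ?_, ?_⟩
  · intro y
    obtain ⟨n, hn⟩ := Quot.exists_rep (e.symm y)
    exact ⟨n, by simp [hn]⟩
  · intro i; simp only [EmbeddingLike.apply_eq_iff_eq]; exact Quot.sound ⟨i, rfl, rfl⟩
  · simp only [Fintype.card_fin]
    let T : (N → ℝ) →ₗ[ℝ] (I → ℝ) :=
      { toFun := fun z i => z (a i) - z (b i)
        map_add' := by intro u v; ext i; simp; ring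
        map_smul' := by intro c u; ext i; simp; ring }
    let L : (Q0 → ℝ) →ₗ[ℝ] (N → ℝ) := LinearMap.funLeft ℝ ℝ (Quot.mk r)
    have hker : LinearMap.ker T ≤ LinearMap.range L := by
      intro z hz
      refine ⟨Quot.lift z ?_, ?_⟩
      · rintro x y ⟨i, rfl, rfl⟩
        have := congrFun (LinearMap.mem_ker.1 hz) i
        simp only [T, LinearMap.coe_mk, AddHom.coe_mk, Pi.zero_apply] at this
        linarith
      · ext n; simp [L, LinearMap.funLeft]
    have h1 := LinearMap.finrank_range_add_finrank_ker T
    have h2 : Module.finrank ℝ (LinearMap.range T) ≤ Fintype.card I := by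
      have := Submodule.finrank_le (LinearMap.range T); simpa using this
    have h3 : Module.finrank ℝ (LinearMap.ker T) ≤ Fintype.card Q0 :=
      (Submodule.finrank_mono hker).trans (by have := LinearMap.finrank_range_le L; simpa using this)
    simp only [Module.finrank_fintype_fun_eq_card] at h1
    omega

theorem UP_of_rank {V W : Type*} [Fintype V] [Fintype W] {P : V → V ⊕ W → ℝ}
    (hP0 : ∀ v x, 0 ≤ P v x) (hP1 : ∀ v, ∑ x, P v x = 1) {O : Type*} [LinearOrder O]
    (rk : V → O) (hrk : ∀ v, ∃ x, 0 < P v x ∧ ∀ v', x = Sum.inl v' → rk v' < rk v) :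
    UP (range (Sum.inr : W → V ⊕ W)) (Sum.elim P 0) := by
  classical
  intro u hu hb x
  by_contra hx
  push Not at hx
  obtain ⟨m, -, hm⟩ := Finset.exists_max_image Finset.univ u ⟨x, Finset.mem_univ _⟩
  have hm0 : 0 < u m := hx.trans_le (hm x (Finset.mem_univ _))
  have hmV : ∃ v, m = Sum.inl v := by
    rcases m with v | w
    · exact ⟨v, rfl⟩
    · exact absurd (hb _ ⟨w, rfl⟩) (not_le.2 hm0)
  obtain ⟨v0, hv0⟩ := hmV
  let A : Finset V := Finset.univ.filter fun v => u (Sum.inl v) = u m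
  obtain ⟨v, hvA, hvmin⟩ := Finset.exists_min_image A rk ⟨v0, by simp [A, hv0]⟩
  have hv : u (Sum.inl v) = u m := (Finset.mem_filter.1 hvA).2
  obtain ⟨y, hy, hy'⟩ := hrk v
  have hlt : u y < u m := by
    refine lt_of_le_of_ne (hm y (Finset.mem_univ _)) fun he => ?_
    rcases y with v' | w
    · exact absurd (hvmin v' (by simp [A, he])) (not_le.2 (hy' v' rfl))
    · exact absurd (hb _ ⟨w, rfl⟩) (by rw [he]; exact not_le.2 hm0)
  have h1 := hu (Sum.inl v) (by simp)
  simp only [Sum.elim_inl] at h1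
  have h2 : ∑ z, P v z * u z < ∑ z, P v z * u m :=
    Finset.sum_lt_sum (fun z _ => mul_le_mul_of_nonneg_left (hm z (Finset.mem_univ _)) (hP0 v z))
      ⟨y, Finset.mem_univ _, mul_lt_mul_of_pos_left hlt hy⟩
  rw [← Finset.sum_mul, hP1, one_mul] at h2
  linarith

theorem comb_bound {V W G H : Type*} [Fintype V] [Fintype W] [Fintype G] [Fintype H]
    [Nonempty W] (k : ℕ)
    (nxt : V → V) (hV : V → H) (nxW : W → W) (hW : W → H)
    (gs gt : G → V ⊕ W) (gl gr : G → H)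
    (ident : ∀ (z : H → ℝ) (ψ : V ⊕ W → ℝ),
      ∑ v, z (hV v) * (ψ (Sum.inl (nxt v)) - ψ (Sum.inl v))
      + ∑ w, z (hW w) * (ψ (Sum.inr (nxW w)) - ψ (Sum.inr w))
      + ∑ g, (z (gl g) - z (gr g)) * (ψ (gt g) - ψ (gs g)) = 0)
    (hcard : Fintype.card G + 1 = k + Fintype.card H)
    (hinj : Function.Injective nxW) (htrans : ∀ w w', ∃ n, nxW^[n] w = w')
    (hsurj : ∀ h, (∃ v, hV v = h) ∨ ∃ w, hW w = h)
    (φ : V ⊕ W → EuclideanSpace ℝ (Fin 2)) (D : ℝ)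
    (hD : ∀ w w' : W, ‖φ (Sum.inr w) - φ (Sum.inr w')‖ ≤ D)
    (hArc : 2 * D ≤ ∑ w, ‖φ (Sum.inr (nxW w)) - φ (Sum.inr w)‖)
    (P : V → V ⊕ W → ℝ) (hP0 : ∀ v x, 0 ≤ P v x) (hP1 : ∀ v, ∑ x, P v x = 1)
    (hharm : ∀ v, φ (Sum.inl v) = ∑ x, P v x • φ x)
    (hedge : ∀ v x, 0 < P v x → ∃ e : V ⊕ G,
      (Sum.elim Sum.inl gs e = Sum.inl v ∧ Sum.elim (Sum.inl ∘ nxt) gt e = x) ∨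
      (Sum.elim Sum.inl gs e = x ∧ Sum.elim (Sum.inl ∘ nxt) gt e = Sum.inl v))
    {O : Type*} [LinearOrder O] (rk : V → O)
    (hrk : ∀ v, ∃ x, 0 < P v x ∧ ∀ v', x = Sum.inl v' → rk v' < rk v) :
    ∑ v, ‖φ (Sum.inl (nxt v)) - φ (Sum.inl v)‖ ≤
      2 * ((k : ℝ) - 1) * D + ∑ w, ‖φ (Sum.inr (nxW w)) - φ (Sum.inr w)‖ := by
  classical
  have hUP := UP_of_rank hP0 hP1 rk hrk
  have hSto : Sto (range (Sum.inr : W → V ⊕ W)) (Sum.elim P 0) := by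
    intro x hx
    rcases x with v | w
    · exact ⟨hP0 v, hP1 v⟩
    · exact absurd ⟨w, rfl⟩ hx
  let f : (V ⊕ W → EuclideanSpace ℝ (Fin 2)) → ℝ :=
    fun φ => ∑ v, ‖φ (Sum.inl (nxt v)) - φ (Sum.inl v)‖
  have hf : ConvexOn ℝ univ f := by
    refine ⟨convex_univ, ?_⟩
    intro a _ b _ s t hs ht hst
    simp only [f, smul_eq_mul, Finset.mul_sum]
    rw [← Finset.sum_add_distrib]
    refine Finset.sum_le_sum fun v _ => ?_
    have : (s • a + t • b) (Sum.inl (nxt v)) - (s • a + t • b) (Sum.inl v)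
        = s • (a (Sum.inl (nxt v)) - a (Sum.inl v)) + t • (b (Sum.inl (nxt v)) - b (Sum.inl v)) := by
      simp only [Pi.add_apply, Pi.smul_apply, smul_sub]; abel
    rw [this]
    refine (norm_add_le _ _).trans ?_
    rw [norm_smul, norm_smul, Real.norm_of_nonneg hs, Real.norm_of_nonneg ht]
  obtain ⟨g, ρ, ψ, hg1, hg2, hg3, hg4, hg5⟩ := exists_forest hUP hSto hf (φ := φ) (by
    intro x hx
    rcases x with v | w
    · exact hharm v
    · exact absurd ⟨w, rfl⟩ hx)
  have hg1 : ∀ v, 0 < P v (g (Sum.inl v)) := fun v => hg1 (Sum.inl v) (by simp)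
  have hg2 : ∀ v, ρ (g (Sum.inl v)) < ρ (Sum.inl v) := fun v => hg2 (Sum.inl v) (by simp)
  have hg3 : ∀ w, ψ (Sum.inr w) = φ (Sum.inr w) := fun w => hg3 _ ⟨w, rfl⟩
  have hg4 : ∀ v, ψ (Sum.inl v) = ψ (g (Sum.inl v)) := fun v => hg4 (Sum.inl v) (by simp)
  have hval : ∀ n x, ρ x ≤ n → ∃ w, ψ x = φ (Sum.inr w) := by
    intro n
    induction n with
    | zero =>
      intro x hx
      rcases x with v | w
      · have := hg2 v; omega
      · exact ⟨w, hg3 w⟩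
    | succ n ih =>
      intro x hx
      rcases x with v | w
      · rw [hg4 v]; exact ih _ (by have := hg2 v; omega)
      · exact ⟨w, hg3 w⟩
  have hDψ : ∀ x y, ‖ψ x - ψ y‖ ≤ D := by
    intro x y
    obtain ⟨w, hw⟩ := hval _ x le_rfl
    obtain ⟨w', hw'⟩ := hval _ y le_rfl
    rw [hw, hw']; exact hD w w'
  have hD0 : 0 ≤ D := (norm_nonneg _).trans (hDψ (Sum.inr (Classical.arbitrary W)) (Sum.inr (Classical.arbitrary W)))
  refine (show _ ≤ _ from hg5).trans ?_
  -- forest edges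
  let s : V ⊕ G → V ⊕ W := Sum.elim Sum.inl gs
  let t : V ⊕ G → V ⊕ W := Sum.elim (Sum.inl ∘ nxt) gt
  choose ε hε using fun v => hedge v _ (hg1 v)
  have hε : ∀ v, (s (ε v) = Sum.inl v ∧ t (ε v) = g (Sum.inl v)) ∨
      (s (ε v) = g (Sum.inl v) ∧ t (ε v) = Sum.inl v) := hε
  have hεinj : Function.Injective ε := by
    intro v v' h
    by_contra hne
    have a1 := hε v; have a2 := hε v'
    rw [← h] at a2
    have b1 := hg2 v; have b2 := hg2 v'
    have hne' : (Sum.inl v : V ⊕ W) ≠ Sum.inl v' := fun h => hne (Sum.inl_injective h)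
    rcases a1 with a1 | a1 <;> rcases a2 with a2 | a2
    · exact hne' (a1.1.symm.trans a2.1)
    · rw [← a1.2, a2.2] at b1; rw [← a2.1, a1.1] at b2; omega
    · rw [← a1.1, a2.1] at b1; rw [← a2.2, a1.2] at b2; omega
    · exact hne' (a1.2.symm.trans a2.2)
  have hεψ : ∀ v, ψ (t (ε v)) - ψ (s (ε v)) = 0 := by
    intro v
    rcases hε v with ⟨a, b⟩ | ⟨a, b⟩ <;> rw [a, b, hg4 v, sub_self]
  let Δ : V → EuclideanSpace ℝ (Fin 2) := fun v => ψ (Sum.inl (nxt v)) - ψ (Sum.inl v)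
  -- node edges
  let I := {e : V ⊕ G // e ∉ range ε ∧ ∀ v, e = Sum.inl v → Δ v = 0}
  let na : I → Option H := fun e => Sum.elim (fun v => some (hV v)) (fun g => some (gl g)) e.1
  let nb : I → Option H := fun e => Sum.elim (fun v => none) (fun g => some (gr g)) e.1
  obtain ⟨Q, _, q, hq, hqe, hqc⟩ := card_le_quot na nb
  let Mp := (Finset.univ.filter fun v => Δ v ≠ 0).card
  have hI : Fintype.card I + Mp = Fintype.card G := by
    have h1 : Fintype.card I = (Finset.univ.filter fun e : V ⊕ G => e ∉ range ε ∧ ∀ v, e = Sum.inl v → Δ v = 0).card :=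
      Fintype.card_subtype _
    have h2 : (Finset.univ.image ε).card = Fintype.card V := Finset.card_image_of_injective _ hεinj
    have h3 : ((Finset.univ.filter fun v => Δ v ≠ 0).image (Sum.inl : V → V ⊕ G)).card = Mp :=
      Finset.card_image_of_injective _ Sum.inl_injective
    have hd1 : Disjoint (Finset.univ.image ε) ((Finset.univ.filter fun v => Δ v ≠ 0).image (Sum.inl : V → V ⊕ G)) := by
      rw [Finset.disjoint_left]
      intro e he1 he2
      obtain ⟨v, -, rfl⟩ := Finset.mem_image.1 he1
      obtain ⟨p, hp, hpv⟩ := Finset.mem_image.1 he2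
      have := hεψ v
      rw [← hpv] at this
      exact (Finset.mem_filter.1 hp).2 this
    have hcompl : (Finset.univ.filter fun e : V ⊕ G => e ∉ range ε ∧ ∀ v, e = Sum.inl v → Δ v = 0)
        = ((Finset.univ.image ε) ∪ ((Finset.univ.filter fun v => Δ v ≠ 0).image (Sum.inl : V → V ⊕ G)))ᶜ := by
      ext e
      simp only [Finset.mem_filter, Finset.mem_univ, true_and, Finset.mem_compl, Finset.mem_union,
        Finset.mem_image, not_or, mem_range]
      refine and_congr Iff.rfl ?_
      constructor
      · rintro h ⟨v, hv, rfl⟩; exact hv (h v rfl)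
      · rintro h v rfl; by_contra hv; exact h ⟨v, hv, rfl⟩
    have h4 := Finset.card_compl ((Finset.univ.image ε) ∪ ((Finset.univ.filter fun v => Δ v ≠ 0).image (Sum.inl : V → V ⊕ G)))
    have h5 := Finset.card_le_univ ((Finset.univ.image ε) ∪ ((Finset.univ.filter fun v => Δ v ≠ 0).image (Sum.inl : V → V ⊕ G)))
    rw [← hcompl, ← h1] at h4
    rw [Finset.card_union_of_disjoint hd1, h2, h3, Fintype.card_sum] at h4 h5
    omega
  have hcount : Mp + 2 ≤ Fintype.card Q + k := by
    rw [Fintype.card_option] at hqc; omega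
  -- components
  let A : Q → ℝ := fun c => ∑ w ∈ Finset.univ.filter (fun w => q (some (hW w)) = c), ‖φ (Sum.inr (nxW w)) - φ (Sum.inr w)‖
  let S : Q → ℝ := fun c => ∑ v ∈ Finset.univ.filter (fun v => q (some (hV v)) = c), ‖Δ v‖
  let R : Q → Finset V := fun c => Finset.univ.filter fun v => Δ v ≠ 0 ∧ q (some (hV v)) = c
  have hSR : ∀ c, S c = ∑ v ∈ R c, ‖Δ v‖ := by
    intro c
    symm
    apply Finset.sum_subset
    · intro v hv
      exact Finset.mem_filter.2 ⟨Finset.mem_univ _, (Finset.mem_filter.1 hv).2.2⟩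
    · intro v hv hv'
      have : Δ v = 0 := by
        by_contra h
        exact hv' (Finset.mem_filter.2 ⟨Finset.mem_univ _, h, (Finset.mem_filter.1 hv).2⟩)
      simp [this]
  have hSD : ∀ c, S c ≤ (R c).card * D := by
    intro c
    rw [hSR c, ← nsmul_eq_mul]
    exact Finset.sum_le_card_nsmul _ _ _ fun v _ => hDψ _ _
  have hA0 : ∀ c, 0 ≤ A c := fun c => Finset.sum_nonneg fun _ _ => norm_nonneg _
  have key : ∀ c, c ≠ q none → S c ≤ 2 * ((R c).card - 1 : ℝ) * D + A c := by
    intro c hc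
    let z : H → ℝ := fun h => if q (some h) = c then 1 else 0
    let β : V ⊕ G → ℝ := Sum.elim (fun v => z (hV v)) (fun g => z (gl g) - z (gr g))
    have hβI : ∀ e, e ∉ range ε → (∀ v, e = Sum.inl v → Δ v = 0) → β e = 0 := by
      intro e h1 h2
      have h3 := hqe ⟨e, h1, h2⟩
      rcases e with v | g
      · simp only [na, nb, Sum.elim_inl] at h3
        simp only [β, z, Sum.elim_inl]
        rw [if_neg]; rw [h3]; exact hc.symm
      · simp only [na, nb, Sum.elim_inr] at h3
        simp only [β, z, Sum.elim_inr]
        rw [h3, sub_self]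
    have idβ : ∀ u : V ⊕ W → ℝ, ∑ e, β e * (u (t e) - u (s e))
        + ∑ w, z (hW w) * (u (Sum.inr (nxW w)) - u (Sum.inr w)) = 0 := by
      intro u
      have := ident z u
      rw [Fintype.sum_sum_type]
      simp only [β, s, t, Sum.elim_inl, Sum.elim_inr, Function.comp]
      linarith
    have vec : ∑ v ∈ R c, Δ v + ∑ w ∈ Finset.univ.filter (fun w => q (some (hW w)) = c), (φ (Sum.inr (nxW w)) - φ (Sum.inr w)) = 0 := by
      ext i
      have h1 := ident z (fun x => ψ x i)
      have hgap : ∑ g, (z (gl g) - z (gr g)) * (ψ (gt g) i - ψ (gs g) i) = 0 := by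
        apply Finset.sum_eq_zero
        intro g _
        by_cases hgr : (Sum.inr g : V ⊕ G) ∈ range ε
        · obtain ⟨v, hv⟩ := hgr
          have := hεψ v
          rw [hv] at this
          have := congrArg (fun x : EuclideanSpace ℝ (Fin 2) => x i) this
          simp only [s, t, Sum.elim_inr, PiLp.sub_apply, PiLp.zero_apply] at this
          rw [this, mul_zero]
        · have := hβI (Sum.inr g) hgr (by simp)
          simp only [β, Sum.elim_inr] at this
          rw [this, zero_mul]
      rw [hgap, add_zero] at h1
      rw [PiLp.add_apply, PiLp.zero_apply, ← h1]
      simp only [z, ite_mul, one_mul, zero_mul, ← Finset.sum_filter]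
      congr 1
      · have : (∑ v ∈ R c, Δ v) = ∑ v ∈ Finset.univ.filter (fun v => q (some (hV v)) = c), Δ v := by
          apply Finset.sum_subset
          · intro v hv
            exact Finset.mem_filter.2 ⟨Finset.mem_univ _, (Finset.mem_filter.1 hv).2.2⟩
          · intro v hv hv'
            by_contra h
            exact hv' (Finset.mem_filter.2 ⟨Finset.mem_univ _, h, (Finset.mem_filter.1 hv).2⟩)
        rw [this]
        simp [Δ]
      · simp [hg3]
    have hr : (R c).card = 0 ∨ (R c).card = 1 ∨ 2 ≤ (R c).card := by omega
    rcases hr with hr | hr | hr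
    · -- no nonzero edge
      rw [hr]
      have hR : R c = ∅ := Finset.card_eq_zero.1 hr
      have hβ0 : ∀ e, e ∉ range ε → β e = 0 := by
        intro e he
        rcases e with v | g
        · by_cases hv : Δ v = 0
          · exact hβI _ he (by intro v' h; rw [← Sum.inl_injective h]; exact hv)
          · simp only [β, z, Sum.elim_inl]
            rw [if_neg]
            intro h
            have : v ∈ R c := Finset.mem_filter.2 ⟨Finset.mem_univ _, hv, h⟩
            rw [hR] at this; simp at this
        · exact hβI _ he (by simp)
      have hβ1 : ∀ v, β (ε v) = 0 := by
        by_contra hcon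
        push Not at hcon
        obtain ⟨v0, hv0⟩ := hcon
        obtain ⟨v, hvA, hvm⟩ := Finset.exists_max_image (Finset.univ.filter fun v => β (ε v) ≠ 0)
          (fun v => ρ (Sum.inl v)) ⟨v0, by simp [hv0]⟩
        have hv : β (ε v) ≠ 0 := (Finset.mem_filter.1 hvA).2
        have h1 := idβ (Pi.single (Sum.inl v) 1)
        have h2 : ∑ w, z (hW w) * ((Pi.single (Sum.inl v) 1 : V ⊕ W → ℝ) (Sum.inr (nxW w)) - (Pi.single (Sum.inl v) 1 : V ⊕ W → ℝ) (Sum.inr w)) = 0 := by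
          apply Finset.sum_eq_zero
          intro w _; simp
        rw [h2, add_zero, Finset.sum_eq_single (ε v)] at h1
        · have hgv : g (Sum.inl v) ≠ Sum.inl v := fun h => by
            have := hg2 v; rw [h] at this; omega
          rcases hε v with ⟨a, b⟩ | ⟨a, b⟩ <;> rw [a, b] at h1 <;> simp [hgv, hv] at h1
        · intro e _ hne
          by_cases hbe : β e = 0
          · rw [hbe, zero_mul]
          · have : e ∈ range ε := by by_contra h; exact hbe (hβ0 e h)
            obtain ⟨v', rfl⟩ := this
            have hvv : v' ≠ v := fun h => hne (by rw [h])
            have h3 := hvm v' (by simp [hbe])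
            have h4 : (Sum.inl v' : V ⊕ W) ≠ Sum.inl v := fun h => hvv (Sum.inl_injective h)
            have h5 : g (Sum.inl v') ≠ Sum.inl v := fun h => by
              have := hg2 v'; rw [h] at this; omega
            rcases hε v' with ⟨a, b⟩ | ⟨a, b⟩ <;> rw [a, b] <;> simp [h4, h5]
        · intro h; exact absurd (Finset.mem_univ _) h
      have hβ : ∀ e, β e = 0 := by
        intro e
        by_cases he : e ∈ range ε
        · obtain ⟨v, rfl⟩ := he; exact hβ1 v
        · exact hβ0 e he
      have hzW : ∀ w, z (hW (nxW w)) = z (hW w) := by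
        intro w
        have h1 := idβ (Pi.single (Sum.inr (nxW w)) 1)
        have h0 : ∀ e, β e * ((Pi.single (Sum.inr (nxW w)) 1 : V ⊕ W → ℝ) (t e)
            - (Pi.single (Sum.inr (nxW w)) 1 : V ⊕ W → ℝ) (s e)) = 0 := fun e => by
          rw [hβ, zero_mul]
        rw [Finset.sum_eq_zero fun e _ => h0 e] at h1
        simp only [zero_add, mul_sub, Finset.sum_sub_distrib,
          Pi.single_apply, Sum.inr.injEq, mul_ite, mul_one, mul_zero] at h1
        simp only [hinj.eq_iff, Finset.sum_ite_eq', Finset.mem_univ, if_true] at h1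
        linarith
      have hzW' : ∀ n w, z (hW (nxW^[n] w)) = z (hW w) := by
        intro n
        induction n with
        | zero => intro w; rfl
        | succ n ih => intro w; rw [Function.iterate_succ_apply, ih, hzW]
      have hzc : ∀ w w', z (hW w') = z (hW w) := by
        intro w w'
        obtain ⟨n, hn⟩ := htrans w w'
        rw [← hn, hzW']
      obtain ⟨o, ho⟩ := hq c
      rcases o with _ | h
      · exact absurd ho.symm hc
      have hz1 : z h = 1 := if_pos ho
      have hzall : ∀ w, q (some (hW w)) = c := by
        intro w
        rcases hsurj h with ⟨v, hv⟩ | ⟨w', hw'⟩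
        · have := hβ (Sum.inl v)
          simp only [β, Sum.elim_inl, hv, hz1] at this
          norm_num at this
        · have := hzc w w'
          rw [hw', hz1] at this
          by_contra hcon
          simp only [z, if_neg hcon] at this
          norm_num at this
      have hAc : A c = ∑ w, ‖φ (Sum.inr (nxW w)) - φ (Sum.inr w)‖ := by
        simp only [A]
        rw [Finset.filter_true_of_mem fun w _ => hzall w]
      rw [hSR, hR, hAc]
      simp only [Finset.sum_empty, Nat.cast_zero]
      linarith
    · obtain ⟨p, hp⟩ := Finset.card_eq_one.1 hr
      rw [hr, hSR, hp, Finset.sum_singleton]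
      rw [hp, Finset.sum_singleton] at vec
      rw [eq_neg_of_add_eq_zero_left vec, norm_neg]
      simp only [Nat.cast_one, sub_self, mul_zero, zero_mul, zero_add]
      exact norm_sum_le _ _
    · have h1 := hSD c
      have h2 : (2 : ℝ) ≤ (R c).card := by exact_mod_cast hr
      nlinarith [hA0 c]
  have key' : ∀ c, S c ≤ 2 * (R c).card * D + A c - (if c = q none then 0 else 2 * D) := by
    intro c
    split_ifs with h
    · have := hSD c
      have h2 : (0 : ℝ) ≤ (R c).card := Nat.cast_nonneg _
      nlinarith [hA0 c]
    · have := key c h; linarith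
  have hSs : ∑ c, S c = f ψ := by
    simp only [S, f]
    exact Finset.sum_fiberwise _ _ _
  have hAs : ∑ c, A c = ∑ w, ‖φ (Sum.inr (nxW w)) - φ (Sum.inr w)‖ := by
    simp only [A]
    exact Finset.sum_fiberwise _ _ _
  have hRs : ∑ c, (R c).card = Mp := by
    have := Finset.card_eq_sum_card_fiberwise (s := Finset.univ.filter fun v => Δ v ≠ 0)
      (t := Finset.univ) (f := fun v => q (some (hV v))) (fun _ _ => Finset.mem_coe.2 (Finset.mem_univ _))
    simp only [Mp]
    rw [this]
    refine Finset.sum_congr rfl fun c _ => ?_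
    simp only [R]
    rw [Finset.filter_filter]
  have hfin := Finset.sum_le_sum fun (c : Q) (_ : c ∈ Finset.univ) => key' c
  rw [hSs, Finset.sum_sub_distrib, Finset.sum_add_distrib, hAs, ← Finset.sum_mul, ← Finset.mul_sum,
    ← Nat.cast_sum, hRs] at hfin
  have hite : ∑ c : Q, (if c = q none then 0 else 2 * D) = (Fintype.card Q - 1 : ℝ) * (2 * D) := by
    have : ∀ c : Q, (if c = q none then 0 else 2 * D) = 2 * D - (if c = q none then 2 * D else 0) := by
      intro c; split_ifs <;> ring
    simp only [this, Finset.sum_sub_distrib, Finset.sum_ite_eq', Finset.mem_univ, if_true,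
      Finset.sum_const, Finset.card_univ, nsmul_eq_mul]
    ring
  rw [hite] at hfin
  have hc' : (Mp : ℝ) + 2 ≤ Fintype.card Q + k := by exact_mod_cast hcount
  nlinarith

end Forest

namespace Forest

structure Cols (k M : ℕ) where
  l : Option (Fin k) → ℕ
  r : Option (Fin k) → ℕ
  x : ℕ → ℝ
  t : Option (Fin k) → ℕ → ℝ
  b : Option (Fin k) → ℕ → ℝ
  M1 : 1 ≤ M
  l0 : l none = 0
  r0 : r none = M
  hl : ∀ i, 1 ≤ l (some i)
  hlr : ∀ i, l (some i) ≤ r (some i)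
  hr : ∀ i, r (some i) < M
  hx : ∀ j, j < M → x j < x (j + 1)
  C1 : ∀ i c, l (some i) ≤ c → c ≤ r (some i) → b (some i) c < t (some i) c
  C2 : ∀ i i' c, i ≠ i' → l (some i) ≤ c → c ≤ r (some i) → l (some i') ≤ c → c ≤ r (some i') →
    t (some i) c < b (some i') c ∨ t (some i') c < b (some i) c
  C3 : ∀ i c, l (some i) ≤ c → c ≤ r (some i) → t none c < b (some i) c
  C4 : ∀ i c, l (some i) ≤ c → c ≤ r (some i) → t (some i) c < b none c
  C5 : ∀ c, c ≤ M → t none c ≤ b none c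
  C6 : ∀ c, 0 < c → c < M → t none c < b none c
  OC : ∀ i i' c, i ≠ i' → l (some i) ≤ c → c + 1 ≤ r (some i) → l (some i') ≤ c →
    c + 1 ≤ r (some i') →
    (t (some i) c < b (some i') c ↔ t (some i) (c + 1) < b (some i') (c + 1))
  conc : ∀ i c, l (some i) < c → c < r (some i) →
    (x (c + 1) - x c) * t (some i) (c - 1) + (x c - x (c - 1)) * t (some i) (c + 1)
      ≤ (x (c + 1) - x (c - 1)) * t (some i) c
  conv : ∀ i c, l (some i) < c → c < r (some i) →
    (x (c + 1) - x (c - 1)) * b (some i) c ≤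
    (x (c + 1) - x c) * b (some i) (c - 1) + (x c - x (c - 1)) * b (some i) (c + 1)

namespace Cols
variable {k M : ℕ} (K : Cols k M)

def pres (j : ℕ) (o : Option (Fin k)) : Prop := K.l o ≤ j ∧ j ≤ K.r o
def span (j : ℕ) (o : Option (Fin k)) : Prop := K.l o ≤ j ∧ j + 1 ≤ K.r o

theorem r_le (o : Option (Fin k)) : K.r o ≤ M := by
  rcases o with _ | i
  · exact K.r0.le
  · exact (K.hr i).le

theorem l_le_r (o : Option (Fin k)) : K.l o ≤ K.r o := by
  rcases o with _ | i
  · rw [K.l0]; exact Nat.zero_le _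
  · exact K.hlr i

theorem pres_none {j : ℕ} (hj : j ≤ M) : K.pres j none := ⟨by simp [K.l0], by simp [K.r0, hj]⟩
theorem span_none {j : ℕ} (hj : j < M) : K.span j none := ⟨by simp [K.l0], by simp [K.r0]; omega⟩

theorem span_pres {j : ℕ} {o} (h : K.span j o) : K.pres j o := ⟨h.1, by have := h.2; omega⟩
theorem span_pres' {j : ℕ} {o} (h : K.span j o) : K.pres (j + 1) o :=
  ⟨by have := h.1; omega, h.2⟩

theorem D1 {c o} (h : K.pres c o) (ho : o ≠ none) : K.b o c < K.t o c := by
  rcases o with _ | i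
  · exact absurd rfl ho
  · exact K.C1 i c h.1 h.2

theorem D3 {c o} (h : K.pres c o) : K.t none c ≤ K.b o c := by
  rcases o with _ | i
  · exact K.C5 c (h.2.trans (K.r_le _))
  · exact (K.C3 i c h.1 h.2).le

theorem D2 {c u u'} (h : K.pres c u) (h' : K.pres c u') (hne : u ≠ u') :
    (u ≠ none ∧ K.t u c < K.b u' c) ∨ (u' ≠ none ∧ K.t u' c < K.b u c) := by
  rcases u with _ | i <;> rcases u' with _ | i'
  · exact absurd rfl hne
  · right; exact ⟨by simp, K.C4 i' c h'.1 h'.2⟩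
  · left; exact ⟨by simp, K.C4 i c h.1 h.2⟩
  · rcases K.C2 i i' c (fun h => hne (by rw [h])) h.1 h.2 h'.1 h'.2 with h1 | h1
    · left; exact ⟨by simp, h1⟩
    · right; exact ⟨by simp, h1⟩

theorem t_inj {c u u'} (h : K.pres c u) (h' : K.pres c u') (he : K.t u c = K.t u' c) : u = u' := by
  by_contra hne
  have key : ∀ u u', K.pres c u → K.pres c u' → u ≠ none → K.t u c < K.b u' c →
      K.t u c ≠ K.t u' c := by
    intro u u' h h' hu hlt
    by_cases hu' : u' = none
    · have h1 := K.D1 h hu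
      have h2 := K.D3 h
      rw [hu']; exact (h2.trans_lt h1).ne'
    · exact (hlt.trans (K.D1 h' hu')).ne
  rcases K.D2 h h' hne with ⟨a, b⟩ | ⟨a, b⟩
  · exact key u u' h h' a b he
  · exact key u' u h' h a b he.symm

/-- highest item of `S` whose top at column `c` is at height at most `y`. -/
def hi (S : Option (Fin k) → Prop) (c : ℕ) (y : ℝ) : Option (Fin k) :=
  open Classical in
  if h : ∃ o, S o ∧ K.t o c ≤ y ∧ ∀ o', S o' → K.t o' c ≤ y → K.t o' c ≤ K.t o c then h.choose
  else none

theorem hi_exists {S : Option (Fin k) → Prop} {c : ℕ} {y : ℝ} (h : ∃ o, S o ∧ K.t o c ≤ y) :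
    ∃ o, S o ∧ K.t o c ≤ y ∧ ∀ o', S o' → K.t o' c ≤ y → K.t o' c ≤ K.t o c := by
  classical
  obtain ⟨o0, h0, h0'⟩ := h
  obtain ⟨o, ho, hm⟩ := Finset.exists_max_image
    (Finset.univ.filter fun o => S o ∧ K.t o c ≤ y) (fun o => K.t o c) ⟨o0, by simp [h0, h0']⟩
  simp only [Finset.mem_filter, Finset.mem_univ, true_and] at ho hm
  exact ⟨o, ho.1, ho.2, fun o' h1 h2 => hm o' ⟨h1, h2⟩⟩

theorem hi_spec {S : Option (Fin k) → Prop} {c : ℕ} {y : ℝ} (h : ∃ o, S o ∧ K.t o c ≤ y) :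
    S (K.hi S c y) ∧ K.t (K.hi S c y) c ≤ y ∧
      ∀ o', S o' → K.t o' c ≤ y → K.t o' c ≤ K.t (K.hi S c y) c := by
  have h' := K.hi_exists h
  unfold hi
  rw [dif_pos h']
  exact h'.choose_spec

theorem hi_mem {S : Option (Fin k) → Prop} (hS : S none) (c : ℕ) (y : ℝ) : S (K.hi S c y) := by
  by_cases h : ∃ o, S o ∧ K.t o c ≤ y
  · exact (K.hi_spec h).1
  · unfold hi
    rw [dif_neg]
    · exact hS
    · rintro ⟨o, h1, h2, -⟩; exact h ⟨o, h1, h2⟩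

theorem hi_unique {S : Option (Fin k) → Prop} {c : ℕ} {y : ℝ} (hS : ∀ o, S o → K.pres c o)
    {o : Option (Fin k)} (h1 : S o) (h2 : K.t o c ≤ y)
    (h3 : ∀ o', S o' → K.t o' c ≤ y → K.t o' c ≤ K.t o c) : K.hi S c y = o := by
  obtain ⟨a1, a2, a3⟩ := K.hi_spec ⟨o, h1, h2⟩
  exact K.t_inj (hS _ a1) (hS _ h1) (le_antisymm (h3 _ a1 a2) (a3 _ h1 h2))

theorem hi_congr {S : Option (Fin k) → Prop} {c : ℕ} {y y' : ℝ} (hS : ∀ o, S o → K.pres c o)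
    (h0 : S none) (hy : K.t none c ≤ y)
    (h : ∀ o, S o → (K.t o c ≤ y ↔ K.t o c ≤ y')) : K.hi S c y = K.hi S c y' := by
  have h0' := (h none h0).1 hy
  obtain ⟨a1, a2, a3⟩ := K.hi_spec ⟨none, h0, h0'⟩
  exact K.hi_unique hS a1 ((h _ a1).2 a2) fun o' b1 b2 => a3 o' b1 ((h _ b1).1 b2)

/-- the item directly below the bottom of `u` in column `c`. -/
def dn (c : ℕ) (u : Option (Fin k)) : Option (Fin k) := K.hi (K.pres c) c (K.b u c)

theorem dn_spec {c u} (hc : c ≤ M) (h : K.pres c u) : K.pres c (K.dn c u) ∧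
    K.t (K.dn c u) c ≤ K.b u c ∧
      ∀ o', K.pres c o' → K.t o' c ≤ K.b u c → K.t o' c ≤ K.t (K.dn c u) c :=
  K.hi_spec ⟨none, K.pres_none hc, K.D3 h⟩

theorem dn_inj {c u u'} (hc : c ≤ M) (h : K.pres c u) (h' : K.pres c u')
    (he : K.dn c u = K.dn c u') : u = u' := by
  by_contra hne
  have key : ∀ u u', K.pres c u → K.pres c u' → u ≠ none → K.t u c < K.b u' c →
      K.dn c u ≠ K.dn c u' := by
    intro u u' h h' hu hlt he
    have h1 := (K.dn_spec hc h').2.2 u h hlt.le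
    have h2 := (K.dn_spec hc h).2.1
    rw [he] at h2
    have h3 := K.D1 h hu
    linarith
  rcases K.D2 h h' hne with ⟨a, b⟩ | ⟨a, b⟩
  · exact key u u' h h' a b he
  · exact key u' u h' h a b he.symm

theorem F1 {S : Option (Fin k) → Prop} {c : ℕ} {u} (hc : c ≤ M) (hS : ∀ o, S o → K.pres c o)
    (h0 : S none) (hu : K.pres c u) :
    K.hi S c (K.b u c) = K.hi S c (K.t (K.dn c u) c) := by
  refine K.hi_congr hS h0 (K.D3 hu) fun o ho => ⟨fun h => ?_, fun h => ?_⟩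
  · exact (K.dn_spec hc hu).2.2 o (hS o ho) h
  · exact h.trans (K.dn_spec hc hu).2.1

theorem F2 {S : Option (Fin k) → Prop} {c : ℕ} {o} (hS : ∀ o, S o → K.pres c o) (ho : S o) :
    K.hi S c (K.t o c) = o :=
  K.hi_unique hS ho le_rfl fun _ _ h => h

theorem F3 {S : Option (Fin k) → Prop} {c : ℕ} {i} (hS : ∀ o, S o → K.pres c o)
    (h0 : S none) (hi : K.pres c i) (hiS : ¬ S i) :
    K.hi S c (K.b i c) = K.hi S c (K.t i c) := by
  have hi0 : i ≠ none := by rintro rfl; exact hiS h0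
  refine K.hi_congr hS h0 (K.D3 hi) fun o ho => ⟨fun h => h.trans (K.D1 hi hi0).le, fun h => ?_⟩
  by_cases ho0 : o = none
  · rw [ho0]; exact K.D3 hi
  · rcases K.D2 (hS o ho) hi (by rintro rfl; exact hiS ho) with ⟨-, h1⟩ | ⟨-, h1⟩
    · exact h1.le
    · have := K.D1 (hS o ho) ho0
      linarith

open Classical in
/-- column lemma -/
theorem column {S : Option (Fin k) → Prop} {c : ℕ} (hc : c ≤ M) (hS : ∀ o, S o → K.pres c o)
    (h0 : S none) (z B T : Option (Fin k) → ℝ) :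
    ∑ u with K.pres c u, z (K.hi S c (K.b u c)) * (B u - T (K.dn c u))
    + ∑ i with K.pres c i ∧ ¬ S i, z (K.hi S c (K.b i c)) * (T i - B i)
    = ∑ u with S u, z (K.hi S c (K.b u c)) * B u - ∑ o with S o, z o * T o := by
  have e1 : ∑ u with K.pres c u, z (K.hi S c (K.b u c)) * T (K.dn c u)
      = ∑ u with K.pres c u, z (K.hi S c (K.t u c)) * T u := by
    have hinj : Set.InjOn (K.dn c) ((Finset.univ.filter fun u => K.pres c u : Finset (Option (Fin k))) : Set (Option (Fin k))) := by
      intro u hu u' hu' he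
      simp only [Finset.coe_filter, Finset.mem_univ, true_and, mem_ofPred_eq] at hu hu'
      exact K.dn_inj hc hu hu' he
    have himg : (Finset.univ.filter fun u => K.pres c u).image (K.dn c) = Finset.univ.filter fun u => K.pres c u := by
      apply Finset.eq_of_subset_of_card_le
      · intro u hu
        obtain ⟨v, hv, rfl⟩ := Finset.mem_image.1 hu
        simp only [Finset.mem_filter, Finset.mem_univ, true_and] at hv ⊢
        exact (K.dn_spec hc hv).1
      · rw [Finset.card_image_of_injOn hinj]
    conv_rhs => rw [← himg]
    rw [Finset.sum_image hinj]
    refine Finset.sum_congr rfl fun u hu => ?_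
    simp only [Finset.mem_filter, Finset.mem_univ, true_and] at hu
    rw [K.F1 hc hS h0 hu]
  have split : ∀ F : Option (Fin k) → ℝ, ∑ u with K.pres c u, F u
      = ∑ u with S u, F u + ∑ u with K.pres c u ∧ ¬ S u, F u := by
    intro F
    rw [← Finset.sum_filter_add_sum_filter_not (Finset.univ.filter fun u => K.pres c u) S]
    congr 1
    · rw [Finset.filter_filter]
      congr 1
      ext u; simp only [Finset.mem_filter, Finset.mem_univ, true_and]
      exact ⟨fun h => h.2, fun h => ⟨hS u h, h⟩⟩
    · rw [Finset.filter_filter]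
  simp only [mul_sub, Finset.sum_sub_distrib]
  rw [e1, split (fun u => z (K.hi S c (K.b u c)) * B u),
    split (fun u => z (K.hi S c (K.t u c)) * T u)]
  have e2 : ∑ u with S u, z (K.hi S c (K.t u c)) * T u = ∑ o with S o, z o * T o := by
    refine Finset.sum_congr rfl fun u hu => ?_
    simp only [Finset.mem_filter, Finset.mem_univ, true_and] at hu
    rw [K.F2 hS hu]
  have e3 : ∑ u with K.pres c u ∧ ¬ S u, z (K.hi S c (K.t u c)) * T u
      = ∑ u with K.pres c u ∧ ¬ S u, z (K.hi S c (K.b u c)) * T u := by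
    refine Finset.sum_congr rfl fun u hu => ?_
    simp only [Finset.mem_filter, Finset.mem_univ, true_and] at hu
    rw [K.F3 hS h0 hu.1 hu.2]
  rw [e2, e3]; ring

theorem le_iff_b {s o u} (ho : K.span s o) (hu : K.span s u) :
    K.t o s ≤ K.b u s ↔ K.t o (s + 1) ≤ K.b u (s + 1) := by
  by_cases ho0 : o = none
  · subst ho0
    exact ⟨fun _ => K.D3 (K.span_pres' hu), fun _ => K.D3 (K.span_pres hu)⟩
  by_cases hou : o = u
  · subst hou
    have h1 := K.D1 (K.span_pres ho) ho0
    have h2 := K.D1 (K.span_pres' ho) ho0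
    exact ⟨fun h => by linarith, fun h => by linarith⟩
  have aux : ∀ c, K.pres c o → K.pres c u → (K.t o c ≤ K.b u c ↔ K.t o c < K.b u c) := by
    intro c h1 h2
    refine ⟨fun h => ?_, le_of_lt⟩
    rcases K.D2 h1 h2 hou with ⟨-, h3⟩ | ⟨h4, h3⟩
    · exact h3
    · have := K.D1 h1 ho0
      have := K.D1 h2 h4
      linarith
  rw [aux s (K.span_pres ho) (K.span_pres hu), aux (s + 1) (K.span_pres' ho) (K.span_pres' hu)]
  rcases o with _ | i
  · exact absurd rfl ho0
  rcases u with _ | i'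
  · exact ⟨fun _ => K.C4 i (s + 1) (K.span_pres' ho).1 (K.span_pres' ho).2,
      fun _ => K.C4 i s (K.span_pres ho).1 (K.span_pres ho).2⟩
  · exact K.OC i i' s (fun h => hou (by rw [h])) ho.1 ho.2 hu.1 hu.2

theorem le_iff_t {s o u} (ho : K.span s o) (hu : K.span s u) :
    K.t o s ≤ K.t u s ↔ K.t o (s + 1) ≤ K.t u (s + 1) := by
  by_cases hou : o = u
  · subst hou; simp
  by_cases hu0 : u = none
  · subst hu0
    have h1 := K.D1 (K.span_pres ho) hou
    have h2 := K.D1 (K.span_pres' ho) hou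
    have h3 := K.D3 (K.span_pres ho)
    have h4 := K.D3 (K.span_pres' ho)
    exact ⟨fun h => by linarith, fun h => by linarith⟩
  have aux : ∀ c, K.pres c o → K.pres c u → (K.t o c ≤ K.t u c ↔ K.t o c ≤ K.b u c) := by
    intro c h1 h2
    refine ⟨fun h => ?_, fun h => h.trans (K.D1 h2 hu0).le⟩
    by_cases ho0 : o = none
    · subst ho0; exact K.D3 h2
    rcases K.D2 h1 h2 hou with ⟨-, h3⟩ | ⟨h4, h3⟩
    · exact h3.le
    · have := K.D1 h1 ho0
      linarith
  rw [aux s (K.span_pres ho) (K.span_pres hu), aux (s + 1) (K.span_pres' ho) (K.span_pres' hu)]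
  exact K.le_iff_b ho hu

theorem hi_step {s u} (hs : s < M) (hu : K.span s u) :
    K.hi (K.span s) (s + 1) (K.b u (s + 1)) = K.hi (K.span s) s (K.b u s) := by
  obtain ⟨a1, a2, a3⟩ := K.hi_spec (S := K.span s) (c := s) (y := K.b u s)
    ⟨none, K.span_none hs, K.D3 (K.span_pres hu)⟩
  refine K.hi_unique (fun o h => K.span_pres' h) a1 ((K.le_iff_b a1 hu).1 a2) fun o' h1 h2 => ?_
  exact (K.le_iff_t h1 a1).1 (a3 o' h1 ((K.le_iff_b h1 hu).2 h2))

/-- successor of a vertex -/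
def nx (p : Option (Fin k) × ℕ × Bool) : Option (Fin k) × ℕ × Bool :=
  match p with
  | (o, j, true) => if j < K.r o then (o, j + 1, true) else (o, j, false)
  | (o, j, false) => if K.l o < j then (o, j - 1, false) else (o, j, true)

/-- hole to the left of the edge leaving a vertex -/
def hh (p : Option (Fin k) × ℕ × Bool) : ℕ × Option (Fin k) :=
  match p with
  | (o, j, true) => if j < K.r o then (j, o) else
      (min j (M - 1), K.hi (K.span (min j (M - 1))) j (K.b o j))
  | (o, j, false) => (j - 1, K.hi (K.span (j - 1)) j (K.b o j))

theorem span_zero {o} (h : K.span 0 o) : o = none := by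
  rcases o with _ | i
  · rfl
  · have := h.1; have := K.hl i; omega

theorem span_last {o} (h : K.span (M - 1) o) : o = none := by
  rcases o with _ | i
  · rfl
  · have := h.2; have := K.hr i; have := K.M1; omega

theorem hi_none {S : Option (Fin k) → Prop} (h0 : S none) (hS : ∀ o, S o → o = none) (c y) :
    K.hi S c y = none := hS _ (K.hi_mem h0 c y)

theorem sum_none {p : Option (Fin k) → Prop} [DecidablePred p] (h : ∀ o, p o ↔ o = none)
    (F : Option (Fin k) → ℝ) : ∑ o with p o, F o = F none := by
  have : (Finset.univ.filter p) = {none} := by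
    ext o; simp [h]
  rw [this, Finset.sum_singleton]

open Classical in
theorem identity (z : ℕ × Option (Fin k) → ℝ) (Ψ : Option (Fin k) × ℕ × Bool → ℝ) :
    ∑ j ∈ Finset.range (M + 1), ∑ o with K.pres j o,
      (z (K.hh (o, j, true)) * (Ψ (K.nx (o, j, true)) - Ψ (o, j, true))
      + z (K.hh (o, j, false)) * (Ψ (K.nx (o, j, false)) - Ψ (o, j, false)))
    + ∑ j ∈ Finset.Ico 1 M, ∑ u with K.pres j u,
      (z (j - 1, K.hi (K.span (j - 1)) j (K.b u j)) - z (j, K.hi (K.span j) j (K.b u j)))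
        * (Ψ (u, j, false) - Ψ (K.dn j u, j, true)) = 0 := by
  have hM := K.M1
  -- R s c
  let R : ℕ → ℕ → ℝ := fun s c => ∑ u with K.span s u, z (s, K.hi (K.span s) c (K.b u c)) * Ψ (u, c, false)
    - ∑ o with K.span s o, z (s, o) * Ψ (o, c, true)
  let α : ℕ → ℝ := fun s => ∑ o with K.span s o, z (s, o) * (Ψ (o, s + 1, true) - Ψ (o, s, true))
  let β : ℕ → ℝ := fun s => ∑ o with K.span s o,
    z (s, K.hi (K.span s) (s + 1) (K.b o (s + 1))) * (Ψ (o, s, false) - Ψ (o, s + 1, false))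
  let ri : ℕ → ℝ := fun c => ∑ i with K.pres c i ∧ ¬ K.span c i,
    z (min c (M - 1), K.hi (K.span (min c (M - 1))) c (K.b i c)) * (Ψ (i, c, false) - Ψ (i, c, true))
  let le : ℕ → ℝ := fun c => ∑ i with K.pres c i ∧ K.l i = c,
    z (c - 1, K.hi (K.span (c - 1)) c (K.b i c)) * (Ψ (i, c, true) - Ψ (i, c, false))
  let ga : ℕ → ℕ → ℝ := fun s c => ∑ u with K.pres c u, z (s, K.hi (K.span s) c (K.b u c))
    * (Ψ (u, c, false) - Ψ (K.dn c u, c, true))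
  have hR : ∀ s, s < M → α s + β s + (R s (s + 1) - R s s) = 0 := by
    intro s hs
    simp only [α, β, R]
    have : ∑ u with K.span s u, z (s, K.hi (K.span s) s (K.b u s)) * Ψ (u, s, false)
        = ∑ u with K.span s u, z (s, K.hi (K.span s) (s + 1) (K.b u (s + 1))) * Ψ (u, s, false) := by
      refine Finset.sum_congr rfl fun u hu => ?_
      simp only [Finset.mem_filter, Finset.mem_univ, true_and] at hu
      rw [K.hi_step hs hu]
    rw [this]
    simp only [mul_sub, Finset.sum_sub_distrib]
    ring
  have hri : ∀ c, 1 ≤ c → c < M → ri c - ga c c = - R c c := by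
    intro c h1 h2
    have hm : min c (M - 1) = c := by omega
    have := K.column (c := c) (S := K.span c) h2.le (fun o h => K.span_pres h) (K.span_none h2)
      (fun o => z (c, o)) (fun o => Ψ (o, c, false)) (fun o => Ψ (o, c, true))
    simp only [R]
    rw [← this]
    simp only [ri, ga, hm]
    rw [neg_add, sub_eq_add_neg, add_comm, ← Finset.sum_neg_distrib (f := fun i => z (c, K.hi (K.span c) c (K.b i c)) * (Ψ (i, c, true) - Ψ (i, c, false)))]
    congr 1
    refine Finset.sum_congr rfl fun u _ => by ring
  have hle : ∀ c, 1 ≤ c → c < M → le c + ga (c - 1) c = R (c - 1) c := by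
    intro c h1 h2
    have hsp : ∀ o, K.span (c - 1) o → K.pres c o := by
      intro o h
      have := K.span_pres' h
      rwa [Nat.sub_add_cancel h1] at this
    have := K.column (c := c) (S := K.span (c - 1)) h2.le hsp (K.span_none (by omega))
      (fun o => z (c - 1, o)) (fun o => Ψ (o, c, false)) (fun o => Ψ (o, c, true))
    simp only [R]
    rw [← this]
    simp only [le, ga]
    rw [add_comm]
    congr 1
    refine Finset.sum_congr ?_ fun u _ => rfl
    ext i
    simp only [Finset.mem_filter, Finset.mem_univ, true_and]
    refine and_congr_right fun hp => ?_
    simp only [span, pres] at hp ⊢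
    omega
  have hp0 : ∀ o, K.pres 0 o ↔ o = none := by
    intro o
    constructor
    · intro h
      rcases o with _ | i
      · rfl
      · have := h.1; have := K.hl i; omega
    · rintro rfl; exact K.pres_none (Nat.zero_le _)
  have hpM : ∀ o, K.pres M o ↔ o = none := by
    intro o
    constructor
    · intro h
      rcases o with _ | i
      · rfl
      · have := h.2; have := K.hr i; omega
    · rintro rfl; exact K.pres_none le_rfl
  have hs0 : ∀ o, K.span 0 o ↔ o = none :=
    fun o => ⟨K.span_zero, by rintro rfl; exact K.span_none (by omega)⟩
  have hsM : ∀ o, K.span (M - 1) o ↔ o = none :=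
    fun o => ⟨K.span_last, by rintro rfl; exact K.span_none (by omega)⟩
  have hle0 : le 0 = - R 0 0 := by
    have e1 : ∀ o, (K.pres 0 o ∧ K.l o = 0) ↔ o = none := by
      intro o; rw [hp0]
      exact ⟨fun h => h.1, by rintro rfl; exact ⟨rfl, K.l0⟩⟩
    simp only [le, R]
    rw [sum_none e1, sum_none hs0, sum_none hs0]
    have := K.hi_none (K.span_none (j := 0) (by omega)) (fun o => K.span_zero) 0 (K.b none 0)
    simp only [Nat.zero_sub, this]; ring
  have hriM : ri M = R (M - 1) M := by
    have e1 : ∀ o, (K.pres M o ∧ ¬ K.span M o) ↔ o = none := by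
      intro o; rw [hpM]
      exact ⟨fun h => h.1, by rintro rfl; exact ⟨rfl, fun h => by have := h.2; rw [K.r0] at this; omega⟩⟩
    have hm : min M (M - 1) = M - 1 := by omega
    simp only [ri, R]
    rw [sum_none e1, sum_none hsM, sum_none hsM, hm]
    have := K.hi_none (K.span_none (j := M - 1) (by omega)) (fun o => K.span_last) M (K.b none M)
    simp only [this]; ring
  have hri0 : ri 0 = 0 := by
    have : ∀ o, ¬ (K.pres 0 o ∧ ¬ K.span 0 o) := by
      intro o; rw [hp0, hs0]; tauto
    simp only [ri, this, Finset.filter_false, Finset.sum_empty]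
  have hleM : le M = 0 := by
    have : ∀ o, ¬ (K.pres M o ∧ K.l o = M) := by
      intro o; rw [hpM]; rintro ⟨rfl, h⟩; rw [K.l0] at h; omega
    simp only [le, this, Finset.filter_false, Finset.sum_empty]
  -- column sums
  have htop : ∀ j, ∑ o with K.pres j o, z (K.hh (o, j, true)) * (Ψ (K.nx (o, j, true)) - Ψ (o, j, true))
      = α j + ri j := by
    intro j
    rw [← Finset.sum_filter_add_sum_filter_not (Finset.univ.filter fun u => K.pres j u) (K.span j)]
    congr 1
    · rw [Finset.filter_filter]
      have : (Finset.univ.filter fun a => K.pres j a ∧ K.span j a) = Finset.univ.filter fun a => K.span j a := by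
        ext u; simp only [Finset.mem_filter, Finset.mem_univ, true_and]
        exact ⟨fun h => h.2, fun h => ⟨K.span_pres h, h⟩⟩
      rw [this]
      refine Finset.sum_congr rfl fun u hu => ?_
      simp only [Finset.mem_filter, Finset.mem_univ, true_and] at hu
      have h2 : j < K.r u := hu.2
      simp only [hh, nx, if_pos h2]
    · rw [Finset.filter_filter]
      refine Finset.sum_congr rfl fun u hu => ?_
      simp only [Finset.mem_filter, Finset.mem_univ, true_and] at hu
      have h2 : ¬ j < K.r u := fun h => hu.2 ⟨hu.1.1, h⟩
      simp only [hh, nx, if_neg h2]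
  have hbot : ∀ j, ∑ o with K.pres j o, z (K.hh (o, j, false)) * (Ψ (K.nx (o, j, false)) - Ψ (o, j, false))
      = (if j = 0 then 0 else β (j - 1)) + le j := by
    intro j
    rw [← Finset.sum_filter_add_sum_filter_not (Finset.univ.filter fun u => K.pres j u) (fun o => K.l o < j)]
    congr 1
    · rw [Finset.filter_filter]
      split_ifs with hj
      · subst hj
        apply Finset.sum_eq_zero
        intro u hu
        simp at hu
      · have : (Finset.univ.filter fun a => K.pres j a ∧ K.l a < j) = Finset.univ.filter fun a => K.span (j - 1) a := by
          ext u; simp only [Finset.mem_filter, Finset.mem_univ, true_and]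
          simp only [pres, span]
          omega
        rw [this]
        refine Finset.sum_congr rfl fun u hu => ?_
        simp only [Finset.mem_filter, Finset.mem_univ, true_and] at hu
        have h2 : K.l u < j := by have := hu.1; omega
        simp only [hh, nx, if_pos h2]
        rw [Nat.sub_add_cancel (by omega)]
    · rw [Finset.filter_filter]
      have : (Finset.univ.filter fun a => K.pres j a ∧ ¬ K.l a < j) = Finset.univ.filter fun a => K.pres j a ∧ K.l a = j := by
          ext u; simp only [Finset.mem_filter, Finset.mem_univ, true_and]
          simp only [pres]
          omega
      rw [this]
      refine Finset.sum_congr rfl fun u hu => ?_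
      simp only [Finset.mem_filter, Finset.mem_univ, true_and] at hu
      have h2 : ¬ K.l u < j := by omega
      simp only [hh, nx, if_neg h2]
  have hgap : ∀ j, ∑ u with K.pres j u,
      (z (j - 1, K.hi (K.span (j - 1)) j (K.b u j)) - z (j, K.hi (K.span j) j (K.b u j)))
        * (Ψ (u, j, false) - Ψ (K.dn j u, j, true)) = ga (j - 1) j - ga j j := by
    intro j
    simp only [ga, sub_mul, Finset.sum_sub_distrib]
  have hαM : α M = 0 := by
    have : ∀ o, ¬ K.span M o := by
      intro o h; have := h.2; have := K.r_le o; omega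
    simp only [α, this, Finset.filter_false, Finset.sum_empty]
  simp only [Finset.sum_add_distrib, htop, hbot, hgap]
  -- reduce to sums over ranges
  obtain ⟨m, rfl⟩ : ∃ m, M = m + 1 := ⟨M - 1, by omega⟩
  have s1 : ∑ j ∈ Finset.range (m + 1 + 1), α j = ∑ s ∈ Finset.range (m + 1), α s := by
    rw [Finset.sum_range_succ, hαM, add_zero]
  have s2 : ∑ j ∈ Finset.range (m + 1 + 1), (if j = 0 then 0 else β (j - 1)) = ∑ s ∈ Finset.range (m + 1), β s := by
    rw [Finset.sum_range_succ']; simp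
  have s3 : ∑ j ∈ Finset.range (m + 1 + 1), ri j = ∑ s ∈ Finset.range m, ri (s + 1) + ri (m + 1) := by
    rw [Finset.sum_range_succ, Finset.sum_range_succ', hri0, add_zero]
  have s4 : ∑ j ∈ Finset.range (m + 1 + 1), le j = ∑ s ∈ Finset.range m, le (s + 1) + le 0 := by
    rw [Finset.sum_range_succ, Finset.sum_range_succ', hleM, add_zero]
  have s5 : ∀ F : ℕ → ℝ, ∑ j ∈ Finset.Ico 1 (m + 1), F j = ∑ s ∈ Finset.range m, F (s + 1) := by
    intro F
    rw [Finset.sum_Ico_eq_sum_range]; simp [add_comm]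
  have s6 : ∑ s ∈ Finset.range (m + 1), (α s + β s + (R s (s + 1) - R s s)) = 0 :=
    Finset.sum_eq_zero fun s hs => hR s (Finset.mem_range.1 hs)
  simp only [Finset.sum_add_distrib, Finset.sum_sub_distrib] at s6
  have s7 : ∑ s ∈ Finset.range (m + 1), R s (s + 1) = ∑ s ∈ Finset.range m, (le (s + 1) + ga s (s + 1)) + ri (m + 1) := by
    rw [Finset.sum_range_succ, hriM]
    congr 1
    refine Finset.sum_congr rfl fun s hs => ?_
    exact (hle (s + 1) (by omega) (by have := Finset.mem_range.1 hs; omega)).symm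
  have s8 : ∑ s ∈ Finset.range (m + 1), R s s = ∑ s ∈ Finset.range m, - (ri (s + 1) - ga (s + 1) (s + 1)) - le 0 := by
    rw [Finset.sum_range_succ', hle0, sub_neg_eq_add]
    congr 1
    refine Finset.sum_congr rfl fun s hs => ?_
    rw [hri (s + 1) (by omega) (by have := Finset.mem_range.1 hs; omega), neg_neg]
  rw [s1, s2, s3, s4, s5]
  simp only [Finset.sum_add_distrib, Finset.sum_sub_distrib, Finset.sum_neg_distrib] at s7 s8 ⊢
  simp only [Nat.add_sub_cancel] at *
  linarith

end Cols
end Forest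

namespace Forest
namespace Cols
variable {k M : ℕ} (K : Cols k M)

open Classical in
def Pf : Finset (Option (Fin k) × ℕ × Bool) :=
  (Finset.univ ×ˢ (Finset.range (M + 1) ×ˢ Finset.univ)).filter fun p => K.pres p.2.1 p.1

def Vf : Finset (Option (Fin k) × ℕ × Bool) := K.Pf.filter fun p => p.1 ≠ none
def Wf : Finset (Option (Fin k) × ℕ × Bool) := K.Pf.filter fun p => p.1 = none

open Classical in
def Hf : Finset (ℕ × Option (Fin k)) :=
  (Finset.range M ×ˢ Finset.univ).filter fun p => K.span p.1 p.2

open Classical in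
def Gf : Finset (ℕ × Option (Fin k)) :=
  (Finset.Ico 1 M ×ˢ Finset.univ).filter fun p => K.pres p.1 p.2

theorem mem_Pf {p} : p ∈ K.Pf ↔ K.pres p.2.1 p.1 := by
  simp only [Pf, Finset.mem_filter, Finset.mem_product, Finset.mem_univ, Finset.mem_range, true_and,
    and_true, and_iff_right_iff_imp]
  intro h
  have := h.2.trans (K.r_le _)
  omega

theorem mem_Vf {p} : p ∈ K.Vf ↔ K.pres p.2.1 p.1 ∧ p.1 ≠ none := by
  rw [Vf, Finset.mem_filter, mem_Pf]
theorem mem_Wf {p} : p ∈ K.Wf ↔ K.pres p.2.1 p.1 ∧ p.1 = none := by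
  rw [Wf, Finset.mem_filter, mem_Pf]
theorem mem_Hf {p} : p ∈ K.Hf ↔ K.span p.1 p.2 := by
  simp only [Hf, Finset.mem_filter, Finset.mem_product, Finset.mem_univ, Finset.mem_range, true_and,
    and_true, and_iff_right_iff_imp]
  intro h
  have := h.2.trans (K.r_le _)
  omega
theorem mem_Gf {p} : p ∈ K.Gf ↔ (1 ≤ p.1 ∧ p.1 < M) ∧ K.pres p.1 p.2 := by
  simp only [Gf, Finset.mem_filter, Finset.mem_product, Finset.mem_univ, Finset.mem_Ico,
    and_true]

open Classical in
theorem sum_Pf (F : Option (Fin k) × ℕ × Bool → ℝ) : ∑ p ∈ K.Pf, F p =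
    ∑ j ∈ Finset.range (M + 1), ∑ o with K.pres j o, (F (o, j, true) + F (o, j, false)) := by
  rw [Pf, Finset.sum_filter, Finset.sum_product, Finset.sum_comm' (t' := Finset.range (M + 1) ×ˢ Finset.univ) (s' := fun _ => Finset.univ) (by simp),
    Finset.sum_product]
  refine Finset.sum_congr rfl fun j _ => ?_
  simp only [Fintype.sum_bool, Finset.sum_filter]
  rw [← Finset.sum_add_distrib]
  refine Finset.sum_congr rfl fun o _ => ?_
  split_ifs <;> simp

theorem sum_Pf' (F : Option (Fin k) × ℕ × Bool → ℝ) : ∑ p ∈ K.Pf, F p =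
    ∑ o, ∑ j ∈ Finset.Icc (K.l o) (K.r o), (F (o, j, true) + F (o, j, false)) := by
  classical
  rw [Pf, Finset.sum_filter, Finset.sum_product]
  refine Finset.sum_congr rfl fun o _ => ?_
  rw [Finset.sum_product]
  have : Finset.Icc (K.l o) (K.r o) = (Finset.range (M + 1)).filter fun j => K.pres j o := by
    ext j
    simp only [Finset.mem_Icc, Finset.mem_filter, Finset.mem_range]; simp only [pres]
    have := K.r_le o
    omega
  rw [this, Finset.sum_filter]
  refine Finset.sum_congr rfl fun j _ => ?_
  simp only [Fintype.sum_bool]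
  split_ifs <;> simp

theorem sum_Vf (F : Option (Fin k) × ℕ × Bool → ℝ) : ∑ p ∈ K.Vf, F p =
    ∑ i, ∑ j ∈ Finset.Icc (K.l (some i)) (K.r (some i)), (F (some i, j, true) + F (some i, j, false)) := by
  rw [Vf, Finset.sum_filter, sum_Pf', Fintype.sum_option]
  simp

theorem sum_Wf (F : Option (Fin k) × ℕ × Bool → ℝ) : ∑ p ∈ K.Wf, F p =
    ∑ j ∈ Finset.Icc (K.l none) (K.r none), (F (none, j, true) + F (none, j, false)) := by
  rw [Wf, Finset.sum_filter, sum_Pf', Fintype.sum_option]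
  simp

theorem sum_VW (F : Option (Fin k) × ℕ × Bool → ℝ) :
    ∑ p ∈ K.Vf, F p + ∑ p ∈ K.Wf, F p = ∑ p ∈ K.Pf, F p := by
  rw [sum_Vf, sum_Wf, sum_Pf', Fintype.sum_option, add_comm]

open Classical in
theorem sum_Gf (F : ℕ × Option (Fin k) → ℝ) : ∑ p ∈ K.Gf, F p =
    ∑ j ∈ Finset.Ico 1 M, ∑ u with K.pres j u, F (j, u) := by
  rw [Gf, Finset.sum_filter, Finset.sum_product]
  simp only [Finset.sum_filter]

theorem card_GH : K.Gf.card + 1 = k + K.Hf.card := by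
  classical
  have h1 : K.Gf.card = ∑ o, ((Finset.Ico 1 M).filter fun j => K.pres j o).card := by
    rw [Gf, Finset.card_filter, Finset.sum_product_right]
    simp only [Finset.card_filter]
  have h2 : K.Hf.card = ∑ o, ((Finset.range M).filter fun j => K.span j o).card := by
    rw [Hf, Finset.card_filter, Finset.sum_product_right]
    simp only [Finset.card_filter]
  rw [h1, h2, Fintype.sum_option, Fintype.sum_option]
  have a1 : ((Finset.Ico 1 M).filter fun j => K.pres j none) = Finset.Ico 1 M := by
    apply Finset.filter_true_of_mem
    intro j hj
    exact K.pres_none (Finset.mem_Ico.1 hj).2.le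
  have a2 : ((Finset.range M).filter fun j => K.span j none) = Finset.range M := by
    apply Finset.filter_true_of_mem
    intro j hj
    exact K.span_none (Finset.mem_range.1 hj)
  have a3 : ∀ i : Fin k, ((Finset.Ico 1 M).filter fun j => K.pres j (some i)).card
      = 1 + ((Finset.range M).filter fun j => K.span j (some i)).card := by
    intro i
    have b1 : ((Finset.Ico 1 M).filter fun j => K.pres j (some i)) = Finset.Icc (K.l (some i)) (K.r (some i)) := by
      ext j
      simp only [Finset.mem_filter, Finset.mem_Ico, Finset.mem_Icc]; simp only [pres]
      have := K.hl i; have := K.hr i; omega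
    have b2 : ((Finset.range M).filter fun j => K.span j (some i)) = Finset.Ico (K.l (some i)) (K.r (some i)) := by
      ext j
      simp only [Finset.mem_filter, Finset.mem_range, Finset.mem_Ico]; simp only [span]
      have := K.hl i; have := K.hr i; omega
    rw [b1, b2, Nat.card_Icc, Nat.card_Ico]
    have := K.hlr i
    omega
  simp only [a1, a2, a3, Finset.sum_add_distrib, Nat.card_Ico, Finset.card_range,
    Finset.sum_const, Finset.card_univ, Fintype.card_fin, smul_eq_mul, mul_one]
  have := K.M1
  omega

theorem nx_fst (p) : (K.nx p).1 = p.1 := by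
  obtain ⟨o, j, s⟩ := p
  cases s <;> simp only [nx] <;> split_ifs <;> rfl

theorem nx_pres {p} (h : K.pres p.2.1 p.1) : K.pres (K.nx p).2.1 (K.nx p).1 := by
  obtain ⟨o, j, s⟩ := p
  simp only [pres] at h ⊢
  cases s <;> simp only [nx] <;> split_ifs <;> simp <;> omega

theorem nx_Vf {p} (h : p ∈ K.Vf) : K.nx p ∈ K.Vf := by
  rw [mem_Vf] at h ⊢
  exact ⟨K.nx_pres h.1, by rw [nx_fst]; exact h.2⟩
theorem nx_Wf {p} (h : p ∈ K.Wf) : K.nx p ∈ K.Wf := by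
  rw [mem_Wf] at h ⊢
  exact ⟨K.nx_pres h.1, by rw [nx_fst]; exact h.2⟩

theorem hh_mem {p} (h : K.pres p.2.1 p.1) : K.hh p ∈ K.Hf := by
  obtain ⟨o, j, s⟩ := p
  rw [mem_Hf]
  have hM := K.M1
  have hj : j ≤ M := h.2.trans (K.r_le _)
  cases s
  · show K.span (j - 1) _
    exact K.hi_mem (K.span_none (by omega)) _ _
  · simp only [hh]
    split_ifs with h1
    · exact ⟨h.1, h1⟩
    · exact K.hi_mem (K.span_none (by omega)) _ _

def vx (p : Option (Fin k) × ℕ × Bool) (h : p ∈ K.Pf) : K.Vf ⊕ K.Wf :=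
  if hn : p.1 = none then Sum.inr ⟨p, by rw [mem_Wf]; exact ⟨K.mem_Pf.1 h, hn⟩⟩
  else Sum.inl ⟨p, by rw [mem_Vf]; exact ⟨K.mem_Pf.1 h, hn⟩⟩

theorem dn_mem {p : ℕ × Option (Fin k)} (h : p ∈ K.Gf) : (K.dn p.1 p.2, p.1, true) ∈ K.Pf := by
  rw [mem_Gf] at h; rw [mem_Pf]
  exact (K.dn_spec h.1.2.le h.2).1

theorem up_mem {p : ℕ × Option (Fin k)} (h : p ∈ K.Gf) : (p.2, p.1, false) ∈ K.Pf := by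
  rw [mem_Gf] at h; rw [mem_Pf]
  exact h.2

def pt (p : Option (Fin k) × ℕ × Bool) : EuclideanSpace ℝ (Fin 2) :=
  !₂[K.x p.2.1, if p.2.2 then K.t p.1 p.2.1 else K.b p.1 p.2.1]

def phi : K.Vf ⊕ K.Wf → EuclideanSpace ℝ (Fin 2) := Sum.elim (fun p => K.pt p.1) (fun p => K.pt p.1)

theorem phi_vx (p) (h : p ∈ K.Pf) : K.phi (K.vx p h) = K.pt p := by
  unfold vx; split_ifs <;> rfl

theorem nx_iter (n : ℕ) (hn : n ≤ M) : K.nx^[n] (none, 0, true) = (none, n, true) := by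
  induction n with
  | zero => rfl
  | succ n ih =>
    rw [Function.iterate_succ_apply', ih (by omega)]
    simp only [nx]
    rw [if_pos (by rw [K.r0]; omega)]

theorem nx_iter' (n : ℕ) (hn : n ≤ M) : K.nx^[n + (M + 1)] (none, 0, true) = (none, M - n, false) := by
  induction n with
  | zero =>
    rw [Nat.zero_add, Function.iterate_succ_apply', K.nx_iter M le_rfl]
    simp only [nx]
    rw [if_neg (by rw [K.r0]; omega)]; rfl
  | succ n ih =>
    rw [Nat.add_right_comm, Function.iterate_succ_apply', ih (by omega)]
    simp only [nx]
    rw [if_pos (by rw [K.l0]; omega)]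
    congr 2

theorem nx_cycle : K.nx^[2 * M + 2] (none, 0, true) = (none, 0, true) := by
  have := K.nx_iter' M le_rfl
  rw [show 2 * M + 2 = (M + (M + 1)) + 1 by ring, Function.iterate_succ_apply', this]
  simp only [nx]
  rw [if_neg (by rw [K.l0]; omega)]
  simp

theorem nx_reach {p} (h : p ∈ K.Wf) : ∃ n, n ≤ 2 * M + 2 ∧ K.nx^[n] (none, 0, true) = p := by
  obtain ⟨o, j, s⟩ := p
  rw [mem_Wf] at h
  obtain ⟨h, ho⟩ := h
  simp only at ho
  subst ho
  have hj : j ≤ M := h.2.trans (K.r_le _)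
  cases s
  · refine ⟨(M - j) + (M + 1), by omega, ?_⟩
    rw [K.nx_iter' _ (by omega)]
    congr 2; omega
  · exact ⟨j, by omega, K.nx_iter j hj⟩

theorem nx_trans {p p'} (h : p ∈ K.Wf) (h' : p' ∈ K.Wf) : ∃ n, K.nx^[n] p = p' := by
  obtain ⟨a, ha, rfl⟩ := K.nx_reach h
  obtain ⟨a', ha', rfl⟩ := K.nx_reach h'
  refine ⟨a' + (2 * M + 2 - a), ?_⟩
  rw [← Function.iterate_add_apply, show a' + (2 * M + 2 - a) + a = a' + (2 * M + 2) by omega,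
    Function.iterate_add_apply, nx_cycle]

theorem mk3 {X E : Type*} [Fintype X] [AddCommGroup E] [Module ℝ E] (φ : X → E)
    (N : X → Prop) (y : E) (a : Fin 3 → X) (w : Fin 3 → ℝ) (hw : ∀ i, 0 ≤ w i)
    (hs : w 0 + w 1 + w 2 = 1) (hy : y = w 0 • φ (a 0) + w 1 • φ (a 1) + w 2 • φ (a 2))
    (hN : ∀ i, N (a i)) :
    ∃ p : X → ℝ, (∀ x, 0 ≤ p x) ∧ ∑ x, p x = 1 ∧ y = ∑ x, p x • φ x ∧
      (∀ x, 0 < p x → N x) ∧ ∀ i, 0 < w i → 0 < p (a i) := by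
  classical
  refine ⟨fun x => ∑ i, if a i = x then w i else 0, ?_, ?_, ?_, ?_, ?_⟩
  · intro x
    exact Finset.sum_nonneg fun i _ => by split_ifs <;> simp [hw i]
  · rw [Finset.sum_comm]
    simp [Fin.sum_univ_three, hs]
  · simp only [Finset.sum_smul]
    rw [Finset.sum_comm, hy]
    simp [Fin.sum_univ_three, ite_smul]
  · intro x hx
    by_contra h
    have : ∀ i, a i ≠ x := fun i h' => h (h' ▸ hN i)
    simp [this] at hx
  · intro i hi
    refine lt_of_lt_of_le hi ?_
    have := Finset.single_le_sum (f := fun i' => if a i' = a i then w i' else 0)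
      (fun i' _ => by split_ifs <;> simp [hw i']) (Finset.mem_univ i)
    simpa using this

end Cols
end Forest

namespace Forest
namespace Cols
variable {k M : ℕ} (K : Cols k M)

theorem dn_surj {c o} (hc : c ≤ M) (ho : K.pres c o) : ∃ u, K.pres c u ∧ K.dn c u = o := by
  classical
  have hinj : Set.InjOn (K.dn c) ((Finset.univ.filter fun u => K.pres c u : Finset (Option (Fin k))) : Set (Option (Fin k))) := by
    intro u hu u' hu' he
    simp only [Finset.coe_filter, Finset.mem_univ, true_and, mem_ofPred_eq] at hu hu'
    exact K.dn_inj hc hu hu' he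
  have himg : (Finset.univ.filter fun u => K.pres c u).image (K.dn c) = Finset.univ.filter fun u => K.pres c u := by
    apply Finset.eq_of_subset_of_card_le
    · intro u hu
      obtain ⟨v, hv, rfl⟩ := Finset.mem_image.1 hu
      simp only [Finset.mem_filter, Finset.mem_univ, true_and] at hv ⊢
      exact (K.dn_spec hc hv).1
    · rw [Finset.card_image_of_injOn hinj]
  have : o ∈ (Finset.univ.filter fun u => K.pres c u).image (K.dn c) := by
    rw [himg]; simp [ho]
  obtain ⟨u, hu, hd⟩ := Finset.mem_image.1 this
  exact ⟨u, by simpa using hu, hd⟩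

theorem dn_lt {c u} (h1 : 1 ≤ c) (hc : c < M) (hu : K.pres c u) : K.t (K.dn c u) c < K.b u c := by
  obtain ⟨a1, a2, -⟩ := K.dn_spec hc.le hu
  by_cases hd : K.dn c u = none
  · rw [hd]
    rcases u with _ | i
    · exact K.C6 c h1 hc
    · exact K.C3 i c hu.1 hu.2
  · have h3 := K.D1 a1 hd
    by_cases hdu : K.dn c u = u
    · rw [hdu] at a2 h3; linarith
    · rcases K.D2 a1 hu hdu with ⟨-, h⟩ | ⟨h, h'⟩
      · exact h
      · have := K.D1 hu h
        linarith

def nV (v : K.Vf) : K.Vf := ⟨K.nx v.1, K.nx_Vf v.2⟩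
def nW (v : K.Wf) : K.Wf := ⟨K.nx v.1, K.nx_Wf v.2⟩
def hoV (v : K.Vf) : K.Hf := ⟨K.hh v.1, K.hh_mem (K.mem_Vf.1 v.2).1⟩
def hoW (v : K.Wf) : K.Hf := ⟨K.hh v.1, K.hh_mem (K.mem_Wf.1 v.2).1⟩
def gS (g : K.Gf) : K.Vf ⊕ K.Wf := K.vx (K.dn g.1.1 g.1.2, g.1.1, true) (K.dn_mem g.2)
def gT (g : K.Gf) : K.Vf ⊕ K.Wf := K.vx (g.1.2, g.1.1, false) (K.up_mem g.2)
def gl (g : K.Gf) : K.Hf := ⟨(g.1.1 - 1, K.hi (K.span (g.1.1 - 1)) g.1.1 (K.b g.1.2 g.1.1)), by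
  have := (K.mem_Gf.1 g.2).1
  rw [mem_Hf]; exact K.hi_mem (K.span_none (by omega)) _ _⟩
def gr (g : K.Gf) : K.Hf := ⟨(g.1.1, K.hi (K.span g.1.1) g.1.1 (K.b g.1.2 g.1.1)), by
  have := (K.mem_Gf.1 g.2).1
  rw [mem_Hf]; exact K.hi_mem (K.span_none (by omega)) _ _⟩

def Adj (v : K.Vf) (x : K.Vf ⊕ K.Wf) : Prop := ∃ e : K.Vf ⊕ K.Gf,
      (Sum.elim Sum.inl K.gS e = Sum.inl v ∧ Sum.elim (Sum.inl ∘ K.nV) K.gT e = x) ∨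
      (Sum.elim Sum.inl K.gS e = x ∧ Sum.elim (Sum.inl ∘ K.nV) K.gT e = Sum.inl v)

theorem vx_inl (v : K.Vf) (h : v.1 ∈ K.Pf) : K.vx v.1 h = Sum.inl v := by
  unfold vx; rw [dif_neg (K.mem_Vf.1 v.2).2]

theorem vx_inl' {p} (hp : p ∈ K.Vf) (h : p ∈ K.Pf) : K.vx p h = Sum.inl ⟨p, hp⟩ := by
  unfold vx; rw [dif_neg (K.mem_Vf.1 hp).2]

theorem vx_eq_inl {p} (h : p ∈ K.Pf) {v : K.Vf} (hv : K.vx p h = Sum.inl v) : p = v.1 := by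
  unfold vx at hv; split_ifs at hv
  exact congrArg Subtype.val (Sum.inl_injective hv)

theorem adj_next (v : K.Vf) {p} (hp : p ∈ K.Pf) (h : K.nx v.1 = p) : K.Adj v (K.vx p hp) := by
  subst h
  refine ⟨Sum.inl v, Or.inl ⟨rfl, ?_⟩⟩
  rw [K.vx_inl' (K.nx_Vf v.2)]; rfl

theorem adj_prev (v : K.Vf) {p} (hp : p ∈ K.Pf) (h : K.nx p = v.1) : K.Adj v (K.vx p hp) := by
  have hpV : p ∈ K.Vf := by
    rw [mem_Vf]
    refine ⟨K.mem_Pf.1 hp, ?_⟩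
    rw [← K.nx_fst p, h]; exact (K.mem_Vf.1 v.2).2
  refine ⟨Sum.inl ⟨p, hpV⟩, Or.inr ⟨?_, ?_⟩⟩
  · rw [K.vx_inl' hpV]; rfl
  · simp only [Sum.elim_inl, Function.comp]
    congr 1
    exact Subtype.ext h

theorem adj_up {i j u} (hv : (some i, j, true) ∈ K.Vf) (hp : (u, j, false) ∈ K.Pf) (h : K.dn j u = some i) :
    K.Adj ⟨(some i, j, true), hv⟩ (K.vx (u, j, false) hp) := by
  have hj := (K.mem_Vf.1 hv).1
  have hG : (j, u) ∈ K.Gf := by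
    rw [mem_Gf]
    have := K.hl i; have := K.hr i; have := hj.1; have := hj.2
    simp only at *
    exact ⟨⟨by omega, by omega⟩, K.mem_Pf.1 hp⟩
  refine ⟨Sum.inr ⟨(j, u), hG⟩, Or.inl ⟨?_, ?_⟩⟩
  · simp only [Sum.elim_inr, gS]
    have : K.vx (K.dn j u, j, true) (K.dn_mem hG) = K.vx (some i, j, true) (K.mem_Pf.2 hj) := by
      congr 1; rw [h]
    rw [this, K.vx_inl' hv]
  · rfl

theorem adj_dn {i j} (hv : (some i, j, false) ∈ K.Vf) (hp : (K.dn j (some i), j, true) ∈ K.Pf) :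
    K.Adj ⟨(some i, j, false), hv⟩ (K.vx (K.dn j (some i), j, true) hp) := by
  have hj := (K.mem_Vf.1 hv).1
  have hG : (j, some i) ∈ K.Gf := by
    rw [mem_Gf]
    have := K.hl i; have := K.hr i; have := hj.1; have := hj.2
    simp only at *
    exact ⟨⟨by omega, by omega⟩, hj⟩
  refine ⟨Sum.inr ⟨(j, some i), hG⟩, Or.inr ⟨?_, ?_⟩⟩
  · rfl
  · simp only [Sum.elim_inr, gT]
    rw [K.vx_inl' hv]

theorem w_int {xl xj xr tl tj tr bu : ℝ} (h1 : xl < xj) (h2 : xj < xr)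
    (hc : (xr - xj) * tl + (xj - xl) * tr ≤ (xr - xl) * tj) (h3 : tj < bu) :
    ∃ w : Fin 3 → ℝ, (∀ i, 0 ≤ w i) ∧ w 0 + w 1 + w 2 = 1 ∧ 0 < w 0 ∧
      xj = w 0 * xl + w 1 * xr + w 2 * xj ∧ tj = w 0 * tl + w 1 * tr + w 2 * bu := by
  have hd : 0 < xr - xl := by linarith
  obtain ⟨α, hα⟩ : ∃ α, α = (xr - xj) / (xr - xl) := ⟨_, rfl⟩
  have hα0 : 0 < α := by rw [hα]; exact div_pos (by linarith) hd
  have hα1 : α < 1 := by rw [hα, div_lt_one hd]; linarith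
  have hαx : α * (xr - xl) = xr - xj := by rw [hα]; field_simp
  obtain ⟨m, hm⟩ : ∃ m, m = α * tl + (1 - α) * tr := ⟨_, rfl⟩
  have hmt : m ≤ tj := by
    have : (xr - xl) * m ≤ (xr - xl) * tj := by
      refine le_trans (le_of_eq ?_) hc
      rw [hm]
      linear_combination (tl - tr) * hαx
    exact le_of_mul_le_mul_left this hd
  have hbm : 0 < bu - m := by linarith
  obtain ⟨c, hc'⟩ : ∃ c, c = (tj - m) / (bu - m) := ⟨_, rfl⟩
  have hc0 : 0 ≤ c := by rw [hc']; exact div_nonneg (by linarith) hbm.le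
  have hc1 : c < 1 := by rw [hc', div_lt_one hbm]; linarith
  have hcx : c * (bu - m) = tj - m := by rw [hc']; field_simp
  refine ⟨![(1 - c) * α, (1 - c) * (1 - α), c], ?_, ?_, ?_, ?_, ?_⟩
  · intro i
    fin_cases i
    · exact mul_nonneg (by linarith) hα0.le
    · exact mul_nonneg (by linarith) (by linarith)
    · exact hc0
  · simp; ring
  · exact mul_pos (by linarith) hα0
  · simp; linear_combination (1 - c) * hαx
  · simp; linear_combination (1 - c) * hm - hcx

theorem w_end {p q r : ℝ} (h1 : p < q) (h2 : q < r) : ∃ w : Fin 3 → ℝ, (∀ i, 0 ≤ w i) ∧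
    w 0 + w 1 + w 2 = 1 ∧ 0 < w 0 ∧ q = w 0 * r + w 1 * p + w 2 * p := by
  have hd : 0 < r - p := by linarith
  refine ⟨![(q - p) / (r - p), (r - q) / (r - p), 0], ?_, ?_, ?_, ?_⟩
  · intro i
    fin_cases i
    · exact div_nonneg (by linarith) hd.le
    · exact div_nonneg (by linarith) hd.le
    · exact le_rfl
  · simp; field_simp; ring
  · exact div_pos (by linarith) hd
  · simp; field_simp; ring

def rk (v : K.Vf) : ℕ ×ₗ ℝ :=
  toLex (v.1.2.1, - (if v.1.2.2 then K.t v.1.1 v.1.2.1 else K.b v.1.1 v.1.2.1))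

theorem pt_comb {p p0 p1 p2 : Option (Fin k) × ℕ × Bool} {w : Fin 3 → ℝ}
    (h0 : K.x p.2.1 = w 0 * K.x p0.2.1 + w 1 * K.x p1.2.1 + w 2 * K.x p2.2.1)
    (h1 : (if p.2.2 then K.t p.1 p.2.1 else K.b p.1 p.2.1) =
      w 0 * (if p0.2.2 then K.t p0.1 p0.2.1 else K.b p0.1 p0.2.1)
      + w 1 * (if p1.2.2 then K.t p1.1 p1.2.1 else K.b p1.1 p1.2.1)
      + w 2 * (if p2.2.2 then K.t p2.1 p2.2.1 else K.b p2.1 p2.2.1)) :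
    K.pt p = w 0 • K.pt p0 + w 1 • K.pt p1 + w 2 • K.pt p2 := by
  ext i
  fin_cases i
  · simpa [pt] using h0
  · simpa [pt] using h1

theorem kernel_aux (v : K.Vf) (p : Fin 3 → Option (Fin k) × ℕ × Bool) (hp : ∀ i, p i ∈ K.Pf)
    (w : Fin 3 → ℝ) (hw : ∀ i, 0 ≤ w i) (hs : w 0 + w 1 + w 2 = 1) (hw0 : 0 < w 0)
    (hpt : K.pt v.1 = w 0 • K.pt (p 0) + w 1 • K.pt (p 1) + w 2 • K.pt (p 2))
    (hadj : ∀ i, K.Adj v (K.vx (p i) (hp i)))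
    (hrk : ∀ v' : K.Vf, p 0 = v'.1 → K.rk v' < K.rk v) :
    ∃ P : K.Vf ⊕ K.Wf → ℝ, (∀ x, 0 ≤ P x) ∧ ∑ x, P x = 1 ∧
      K.phi (Sum.inl v) = ∑ x, P x • K.phi x ∧ (∀ x, 0 < P x → K.Adj v x) ∧
      ∃ x, 0 < P x ∧ ∀ v', x = Sum.inl v' → K.rk v' < K.rk v := by
  obtain ⟨P, h1, h2, h3, h4, h5⟩ := mk3 K.phi (K.Adj v) (K.pt v.1) (fun i => K.vx (p i) (hp i)) w hw hs
    (by simp only [phi_vx]; exact hpt) hadj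
  exact ⟨P, h1, h2, h3, h4, _, h5 0 hw0, fun v' hv' => hrk v' (K.vx_eq_inl _ hv')⟩

theorem kernel (v : K.Vf) : ∃ P : K.Vf ⊕ K.Wf → ℝ, (∀ x, 0 ≤ P x) ∧ ∑ x, P x = 1 ∧
      K.phi (Sum.inl v) = ∑ x, P x • K.phi x ∧ (∀ x, 0 < P x → K.Adj v x) ∧
      ∃ x, 0 < P x ∧ ∀ v', x = Sum.inl v' → K.rk v' < K.rk v := by
  obtain ⟨⟨o, j, s⟩, hv⟩ := v
  obtain ⟨hj, ho⟩ := K.mem_Vf.1 hv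
  simp only at hj ho
  obtain ⟨i, rfl⟩ := Option.ne_none_iff_exists'.1 ho
  have hl := K.hl i
  have hr := K.hr i
  have hj1 := hj.1
  have hj2 := hj.2
  have j1 : 1 ≤ j := by omega
  have jM : j < M := by omega
  have hb := K.C1 i j hj1 hj2
  have hx1 : K.x (j - 1) < K.x j := by
    have := K.hx (j - 1) (by omega)
    rwa [Nat.sub_add_cancel j1] at this
  have hx2 := K.hx j jM
  by_cases hIn : K.l (some i) < j ∧ j < K.r (some i)
  · have hL : ∀ s, (some i, j - 1, s) ∈ K.Pf := by
      intro s; rw [mem_Pf]; exact ⟨by simp only; omega, by simp only; omega⟩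
    have hR : ∀ s, (some i, j + 1, s) ∈ K.Pf := by
      intro s; rw [mem_Pf]; exact ⟨by simp only; omega, by simp only; omega⟩
    have hrkL : ∀ (s') (v' : K.Vf), (some i, j - 1, s') = v'.1 → K.rk v' < K.rk ⟨(some i, j, s), hv⟩ := by
      rintro s' ⟨v', hv'⟩ rfl
      simp only [rk, Prod.Lex.toLex_lt_toLex]
      left; omega
    cases s
    · -- bottom
      have hdm : (K.dn j (some i), j, true) ∈ K.Pf := by
        rw [mem_Pf]; exact (K.dn_spec jM.le hj).1
      have hlt := K.dn_lt j1 jM hj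
      obtain ⟨w, w1, w2, w3, w4, w5⟩ := w_int (tl := - K.b (some i) (j - 1)) (tj := - K.b (some i) j)
        (tr := - K.b (some i) (j + 1)) (bu := - K.t (K.dn j (some i)) j) hx1 hx2
        (by have := K.conv i j hIn.1 hIn.2; linarith) (by linarith)
      refine K.kernel_aux _ ![(some i, j - 1, false), (some i, j + 1, false), (K.dn j (some i), j, true)]
        ?_ w w1 w2 w3 (K.pt_comb w4 ?_) ?_ (hrkL false)
      · intro i'; fin_cases i'
        · exact hL _
        · exact hR _
        · exact hdm
      · simp; linarith
      · intro i'; fin_cases i'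
        · refine K.adj_next _ (hL _) ?_
          simp [nx, hIn.1]
        · refine K.adj_prev _ (hR _) ?_
          simp only [nx]; rw [if_pos (by omega)]; rfl
        · exact K.adj_dn hv hdm
    · obtain ⟨u, hu, hdu⟩ := K.dn_surj jM.le hj
      have hdm : (u, j, false) ∈ K.Pf := K.mem_Pf.2 hu
      have hlt := K.dn_lt j1 jM hu
      rw [hdu] at hlt
      obtain ⟨w, w1, w2, w3, w4, w5⟩ := w_int hx1 hx2 (K.conc i j hIn.1 hIn.2) hlt
      refine K.kernel_aux _ ![(some i, j - 1, true), (some i, j + 1, true), (u, j, false)]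
        ?_ w w1 w2 w3 (K.pt_comb w4 ?_) ?_ (hrkL true)
      · intro i'; fin_cases i'
        · exact hL _
        · exact hR _
        · exact hdm
      · simpa using w5
      · intro i'; fin_cases i'
        · refine K.adj_prev _ (hL _) ?_
          simp only [nx]; rw [if_pos (by omega), Nat.sub_add_cancel j1]
        · refine K.adj_next _ (hR _) ?_
          simp [nx, hIn.2]
        · exact K.adj_up hv hdm hdu
  · have hend : K.l (some i) = j ∨ K.r (some i) = j := by omega
    have hO : ∀ s, (some i, j, s) ∈ K.Pf := fun s => K.mem_Pf.2 hj
    cases s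
    · have hdm : (K.dn j (some i), j, true) ∈ K.Pf := by
        rw [mem_Pf]; exact (K.dn_spec jM.le hj).1
      have hlt := K.dn_lt j1 jM hj
      obtain ⟨w, w1, w2, w3, w4⟩ := w_end hlt hb
      refine K.kernel_aux _ ![(some i, j, true), (K.dn j (some i), j, true), (K.dn j (some i), j, true)]
        ?_ w w1 w2 w3 (K.pt_comb ?_ ?_) ?_ ?_
      · intro i'; fin_cases i'
        · exact hO _
        · exact hdm
        · exact hdm
      · simp; linear_combination (-K.x j) * w2
      · simpa using w4
      · intro i'; fin_cases i'
        · rcases hend with h | h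
          · refine K.adj_next _ (hO _) ?_
            simp [nx, h]
          · refine K.adj_prev _ (hO _) ?_
            simp [nx, h]
        · exact K.adj_dn hv hdm
        · exact K.adj_dn hv hdm
      · rintro ⟨v', hv'⟩ h
        simp only [Matrix.cons_val_zero] at h
        subst h
        simp only [rk, Prod.Lex.toLex_lt_toLex]
        right
        simpa using hb
    · obtain ⟨u, hu, hdu⟩ := K.dn_surj jM.le hj
      have hdm : (u, j, false) ∈ K.Pf := K.mem_Pf.2 hu
      have hlt := K.dn_lt j1 jM hu
      rw [hdu] at hlt
      obtain ⟨w, w1, w2, w3, w4⟩ := w_end hb hlt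
      refine K.kernel_aux _ ![(u, j, false), (some i, j, false), (some i, j, false)]
        ?_ w w1 w2 w3 (K.pt_comb ?_ ?_) ?_ ?_
      · intro i'; fin_cases i'
        · exact hdm
        · exact hO _
        · exact hO _
      · simp; linear_combination (-K.x j) * w2
      · simpa using w4
      · have hown : K.Adj ⟨(some i, j, true), hv⟩ (K.vx (some i, j, false) (hO _)) := by
          rcases hend with h | h
          · refine K.adj_prev _ (hO _) ?_
            simp [nx, h]
          · refine K.adj_next _ (hO _) ?_
            simp [nx, h]
        intro i'; fin_cases i'
        · exact K.adj_up hv hdm hdu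
        · exact hown
        · exact hown
      · rintro ⟨v', hv'⟩ h
        simp only [Matrix.cons_val_zero] at h
        subst h
        simp only [rk, Prod.Lex.toLex_lt_toLex]
        right
        simpa using hlt

/-- length of the closed chain of item `o` -/
def len (o : Option (Fin k)) : ℝ := ∑ j ∈ Finset.Icc (K.l o) (K.r o),
  (‖K.pt (K.nx (o, j, true)) - K.pt (o, j, true)‖ + ‖K.pt (K.nx (o, j, false)) - K.pt (o, j, false)‖)

theorem bound (D : ℝ) (hD : ∀ j j' s s', j ≤ M → j' ≤ M →
      ‖K.pt (none, j, s) - K.pt (none, j', s')‖ ≤ D) (hArc : 2 * D ≤ K.len none) :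
    ∑ i, K.len (some i) ≤ 2 * ((k : ℝ) - 1) * D + K.len none := by
  classical
  choose P hP0 hP1 hP2 hP3 hP4 using K.kernel
  have : Nonempty K.Wf := ⟨⟨(none, 0, true), K.mem_Wf.2 ⟨K.pres_none (Nat.zero_le _), rfl⟩⟩⟩
  have hlenV : ∑ v : K.Vf, ‖K.phi (Sum.inl (K.nV v)) - K.phi (Sum.inl v)‖ = ∑ i, K.len (some i) := by
    have := Finset.sum_coe_sort K.Vf (fun p => ‖K.pt (K.nx p) - K.pt p‖)
    rw [K.sum_Vf] at this
    exact this
  have hlenW : ∑ v : K.Wf, ‖K.phi (Sum.inr (K.nW v)) - K.phi (Sum.inr v)‖ = K.len none := by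
    have := Finset.sum_coe_sort K.Wf (fun p => ‖K.pt (K.nx p) - K.pt p‖)
    rw [K.sum_Wf] at this
    exact this
  have htrans : ∀ w w', ∃ n, K.nW^[n] w = w' := by
    intro w w'
    obtain ⟨n, hn⟩ := K.nx_trans w.2 w'.2
    have : ∀ n (w : K.Wf), ((K.nW^[n] w).1) = K.nx^[n] w.1 := by
      intro n
      induction n with
      | zero => intro w; rfl
      | succ n ih => intro w; rw [Function.iterate_succ_apply, Function.iterate_succ_apply, ih]; rfl
    exact ⟨n, Subtype.ext (by rw [this, hn])⟩
  have hinj : Function.Injective K.nW := by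
    rw [Finite.injective_iff_surjective]
    intro w
    obtain ⟨n, hn⟩ := htrans (K.nW w) w
    exact ⟨K.nW^[n] w, by rw [← Function.iterate_succ_apply' K.nW n w, Function.iterate_succ_apply, hn]⟩
  have main := comb_bound (V := K.Vf) (W := K.Wf) (G := K.Gf) (H := K.Hf) k K.nV K.hoV K.nW K.hoW
    K.gS K.gT K.gl K.gr ?_ (by simpa using K.card_GH) hinj htrans ?_ K.phi D ?_ (by rw [hlenW]; exact hArc)
    P hP0 hP1 hP2 hP3 K.rk hP4
  · rw [hlenV, hlenW] at main; exact main
  · -- identity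
    intro z ψ
    let z' : ℕ × Option (Fin k) → ℝ := fun p => if h : p ∈ K.Hf then z ⟨p, h⟩ else 0
    let Ψ : Option (Fin k) × ℕ × Bool → ℝ := fun p => if h : p ∈ K.Pf then ψ (K.vx p h) else 0
    have hz : ∀ h : K.Hf, z h = z' h.1 := fun h => by simp [z']
    have hΨ : ∀ p h, ψ (K.vx p h) = Ψ p := fun p h => by simp [Ψ, h]
    have hVP : ∀ v : K.Vf, v.1 ∈ K.Pf := fun v => K.mem_Pf.2 (K.mem_Vf.1 v.2).1
    have hWP : ∀ v : K.Wf, v.1 ∈ K.Pf := fun v => K.mem_Pf.2 (K.mem_Wf.1 v.2).1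
    have hΨV : ∀ v : K.Vf, ψ (Sum.inl v) = Ψ v.1 := fun v => by
      rw [← hΨ v.1 (hVP v), K.vx_inl]
    have hΨW : ∀ v : K.Wf, ψ (Sum.inr v) = Ψ v.1 := fun v => by
      rw [← hΨ v.1 (hWP v)]
      unfold vx; rw [dif_pos (K.mem_Wf.1 v.2).2]
    have hid := K.identity z' Ψ
    rw [← K.sum_Pf (fun p => z' (K.hh p) * (Ψ (K.nx p) - Ψ p)), ← K.sum_VW,
      ← K.sum_Gf (fun p => (z' (p.1 - 1, K.hi (K.span (p.1 - 1)) p.1 (K.b p.2 p.1)) - z' (p.1, K.hi (K.span p.1) p.1 (K.b p.2 p.1)))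
        * (Ψ (p.2, p.1, false) - Ψ (K.dn p.1 p.2, p.1, true))), ← Finset.sum_coe_sort K.Vf,
        ← Finset.sum_coe_sort K.Wf, ← Finset.sum_coe_sort K.Gf] at hid
    rw [← hid]
    congr 1
    · congr 1
      · refine Finset.sum_congr rfl fun v _ => ?_
        rw [hΨV, hΨV, hz]; rfl
      · refine Finset.sum_congr rfl fun v _ => ?_
        rw [hΨW, hΨW, hz]; rfl
    · refine Finset.sum_congr rfl fun v _ => ?_
      rw [hz, hz, gT, gS, hΨ, hΨ]; rfl
  · rintro ⟨⟨j, o⟩, h⟩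
    have hs := K.mem_Hf.1 h
    have hp := K.span_pres hs
    have he : K.hh (o, j, true) = (j, o) := by
      simp only [hh]; exact if_pos hs.2
    by_cases ho : o = none
    · right
      exact ⟨⟨(o, j, true), K.mem_Wf.2 ⟨hp, ho⟩⟩, Subtype.ext he⟩
    · left
      exact ⟨⟨(o, j, true), K.mem_Vf.2 ⟨hp, ho⟩⟩, Subtype.ext he⟩
  · rintro ⟨⟨o, j, s⟩, h⟩ ⟨⟨o', j', s'⟩, h'⟩
    obtain ⟨h1, h2⟩ := K.mem_Wf.1 h
    obtain ⟨h1', h2'⟩ := K.mem_Wf.1 h'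
    simp only at h2 h2'
    subst h2; subst h2'
    exact hD j j' s s' (h1.2.trans (K.r_le _)) (h1'.2.trans (K.r_le _))

end Cols
end Forest

namespace Forest

theorem exists_proj {B : Set (EuclideanSpace ℝ (Fin 2))} (hc : IsClosed B) (hv : Convex ℝ B) (hn : B.Nonempty) :
    ∃ f : EuclideanSpace ℝ (Fin 2) → EuclideanSpace ℝ (Fin 2), LipschitzWith 1 f ∧ (∀ x, f x ∈ B) ∧
      (∀ x v, v ∈ B → (∀ w ∈ B, inner ℝ (x - v) (w - v) ≤ 0) → f x = v) ∧
      ∀ x, ∀ w ∈ B, inner ℝ (x - f x) (w - f x) ≤ 0 := by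
  have h : ∀ u, ∃ v ∈ B, ∀ w ∈ B, inner ℝ (u - v) (w - v) ≤ 0 := by
    intro u
    obtain ⟨v, hvB, hv2⟩ := exists_norm_eq_iInf_of_complete_convex hn hc.isComplete hv u
    exact ⟨v, hvB, (norm_eq_iInf_iff_real_inner_le_zero hv hvB).1 hv2⟩
  choose f hf1 hf2 using h
  have key : ∀ x y v w : EuclideanSpace ℝ (Fin 2), inner ℝ (x - v) (w - v) ≤ 0 → inner ℝ (y - w) (v - w) ≤ 0 →
      ‖v - w‖ * ‖v - w‖ ≤ inner ℝ (x - y) (v - w) := by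
    intro x y v w h1 h2
    rw [← real_inner_self_eq_norm_mul_norm]
    simp only [inner_sub_left, inner_sub_right] at *
    rw [real_inner_comm v w] at *
    linarith
  refine ⟨f, ?_, hf1, ?_, hf2⟩
  · refine LipschitzWith.of_dist_le_mul fun x y => ?_
    rw [dist_eq_norm, dist_eq_norm]
    have h1 := key x y (f x) (f y) (hf2 x _ (hf1 y)) (hf2 y _ (hf1 x))
    have h2 := real_inner_le_norm (x - y) (f x - f y)
    by_contra hlt
    push Not at hlt
    simp only [NNReal.coe_one, one_mul] at hlt
    nlinarith [norm_nonneg (x - y), norm_nonneg (f x - f y)]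
  · intro x v hvB hw
    have h1 := key x x (f x) v (hf2 x _ hvB) (hw _ (hf1 x))
    rw [sub_self, inner_zero_left] at h1
    have : ‖f x - v‖ = 0 := by nlinarith [norm_nonneg (f x - v)]
    exact sub_eq_zero.1 (norm_eq_zero.1 this)

theorem preconn_frontier {X : Type*} [TopologicalSpace X] {s P : Set X} (hs : IsPreconnected s)
    (h1 : (s ∩ P).Nonempty) (h2 : (s ∩ Pᶜ).Nonempty) : (s ∩ frontier P).Nonempty := by
  by_contra hne
  rw [not_nonempty_iff_eq_empty] at hne
  have hcov : ∀ z ∈ s, z ∈ interior P ∨ z ∈ (closure P)ᶜ := by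
    intro z hz
    by_contra hcon
    push Not at hcon
    have : z ∈ s ∩ frontier P := ⟨hz, not_not.1 hcon.2, hcon.1⟩
    rw [hne] at this
    exact this
  obtain ⟨a, ha, haP⟩ := h1
  obtain ⟨b, hb, hbP⟩ := h2
  obtain ⟨z, hz, hz1, hz2⟩ := hs (interior P) (closure P)ᶜ isOpen_interior isClosed_closure.isOpen_compl hcov
    ⟨a, ha, (hcov a ha).resolve_right fun h => h (subset_closure haP)⟩
    ⟨b, hb, (hcov b hb).resolve_left fun h => hbP (interior_subset h)⟩
  exact hz2 (subset_closure (interior_subset hz1))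

theorem perim_mono {B P : Set (EuclideanSpace ℝ (Fin 2))} (hc : IsClosed B) (hv : Convex ℝ B) (hn : B.Nonempty)
    (hP : Bornology.IsBounded P) (hBP : B ⊆ P) : μH[1] (frontier B) ≤ μH[1] (frontier P) := by
  obtain ⟨f, hfL, hfB, hfu, hfi⟩ := exists_proj hc hv hn
  have hcomp : IsCompact (frontier P) :=
    Metric.isCompact_of_isClosed_isBounded isClosed_frontier (hP.closure.subset frontier_subset_closure)
  have hsub : ∀ y ∉ B, f y ∈ f '' frontier P := by
    intro y hy
    set v := f y with hvdef
    have hu : y - v ≠ 0 := fun h => hy (by rw [sub_eq_zero.1 h]; exact hfB y)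
    obtain ⟨R, hR⟩ := hP.exists_norm_le
    let g : ℝ → EuclideanSpace ℝ (Fin 2) := fun s => v + s • (y - v)
    have hg : Continuous g := by fun_prop
    have hpre : IsPreconnected (g '' Ici 0) := isPreconnected_Ici.image g hg.continuousOn
    have hne : (g '' Ici 0 ∩ frontier P).Nonempty := by
      refine preconn_frontier hpre ⟨v, ⟨0, by simp, by simp [g]⟩, hBP (hfB y)⟩ ?_
      have hpos : 0 < ‖y - v‖ := norm_pos_iff.2 hu
      refine ⟨g ((|R| + ‖v‖ + 1) / ‖y - v‖), ⟨_, by simp only [mem_Ici]; positivity, rfl⟩, fun hmem => ?_⟩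
      have h1 := hR _ hmem
      have h2 : ‖g ((|R| + ‖v‖ + 1) / ‖y - v‖) - v‖ = |R| + ‖v‖ + 1 := by
        simp only [g, add_sub_cancel_left, norm_smul]
        rw [Real.norm_of_nonneg (by positivity)]
        field_simp
      have h3 := norm_sub_le (g ((|R| + ‖v‖ + 1) / ‖y - v‖)) v
      have := le_abs_self R
      linarith
    obtain ⟨_, ⟨s, hs, rfl⟩, hfr⟩ := hne
    refine ⟨g s, hfr, hfu _ _ (hfB y) fun w hw => ?_⟩
    simp only [g, add_sub_cancel_left, inner_smul_left]
    exact mul_nonpos_of_nonneg_of_nonpos hs (hfi y w hw)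
  have hcl : IsClosed (f '' frontier P) := (hcomp.image hfL.continuous).isClosed
  have hmain : frontier B ⊆ f '' frontier P := by
    intro b hb
    rw [frontier_eq_closure_inter_closure] at hb
    have hbB : b ∈ B := hc.closure_eq ▸ hb.1
    have hfb : f b = b := hfu b b hbB (by simp)
    have h1 : closure Bᶜ ⊆ f ⁻¹' (f '' frontier P) :=
      closure_minimal (fun y hy => hsub y hy) (hcl.preimage hfL.continuous)
    have := h1 hb.2
    rwa [mem_preimage, hfb] at this
  calc μH[1] (frontier B) ≤ μH[1] (f '' frontier P) := measure_mono hmain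
    _ ≤ μH[1] (frontier P) := by
      have := hfL.hausdorffMeasure_image_le (d := 1) zero_le_one (frontier P)
      simpa using this

theorem shrink {A : Set (EuclideanSpace ℝ (Fin 2))} (hA : IsCompact A) (hv : Convex ℝ A) (hi : (interior A).Nonempty)
    {a : ℝ} (ha : 0 < a) (ha1 : a < 1) : ∃ A' : Set (EuclideanSpace ℝ (Fin 2)), IsCompact A' ∧ Convex ℝ A' ∧
      (interior A').Nonempty ∧ A' ⊆ interior A ∧
      μH[1] (frontier A') = ENNReal.ofReal a * μH[1] (frontier A) := by
  obtain ⟨c, hc⟩ := hi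
  have hcc : Continuous (AffineMap.homothety c a : EuclideanSpace ℝ (Fin 2) → EuclideanSpace ℝ (Fin 2)) :=
    AffineMap.homothety_continuous c a
  let e : EuclideanSpace ℝ (Fin 2) ≃ₜ EuclideanSpace ℝ (Fin 2) :=
    { toFun := AffineMap.homothety c a
      invFun := AffineMap.homothety c a⁻¹
      left_inv := fun x => by
        rw [← AffineMap.comp_apply, ← AffineMap.homothety_mul, inv_mul_cancel₀ ha.ne']; simp
      right_inv := fun x => by
        rw [← AffineMap.comp_apply, ← AffineMap.homothety_mul, mul_inv_cancel₀ ha.ne']; simp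
      continuous_toFun := hcc
      continuous_invFun := AffineMap.homothety_continuous c a⁻¹ }
  have he : ∀ s : Set (EuclideanSpace ℝ (Fin 2)), e '' s = AffineMap.homothety c a '' s := fun s => rfl
  refine ⟨AffineMap.homothety c a '' A, hA.image hcc, hv.affine_image _, ?_, ?_, ?_⟩
  · rw [← he, ← e.image_interior]; exact ⟨_, mem_image_of_mem _ hc⟩
  · have h1 := hv.closure_subset_image_homothety_interior_of_one_lt hc a⁻¹ ((one_lt_inv₀ ha).2 ha1)
    rw [hA.isClosed.closure_eq] at h1
    rintro _ ⟨y, hy, rfl⟩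
    obtain ⟨z, hz, rfl⟩ := h1 hy
    rw [← AffineMap.comp_apply, ← AffineMap.homothety_mul, mul_inv_cancel₀ ha.ne']; simpa using hz
  · rw [← he, ← e.image_frontier, he, hausdorffMeasure_homothety_image zero_le_one c ha.ne']
    rw [ENNReal.smul_def, smul_eq_mul]
    congr 1
    rw [NNReal.rpow_one, ← ENNReal.ofReal_coe_nnreal]
    congr 1
    simp [abs_of_pos ha]
end Forest

namespace Forest


def GG (x f : ℕ → ℝ) (j : ℕ) (z : E2) : ℝ :=
  (x (j+1) - z 0) * f j + (z 0 - x j) * f (j+1) - (x (j+1) - x j) * z 1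

theorem GG_cont (x f : ℕ → ℝ) (j : ℕ) : Continuous (GG x f j) := by
  unfold GG; fun_prop

def Poly (x t b : ℕ → ℝ) (l r : ℕ) : Set E2 :=
  {z | x l ≤ z 0 ∧ z 0 ≤ x r ∧ ∀ j, l ≤ j → j < r → 0 ≤ GG x t j z ∧ GG x b j z ≤ 0}

structure PolyHyp (x t b : ℕ → ℝ) (l r : ℕ) : Prop where
  lr : l < r
  xs : ∀ j, l ≤ j → j < r → x j < x (j+1)
  bt : ∀ j, l ≤ j → j ≤ r → b j ≤ t j
  ht : ∀ j m, l ≤ j → j < r → l ≤ m → m ≤ r →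
    (x (j+1) - x j) * t m ≤ (x (j+1) - x m) * t j + (x m - x j) * t (j+1)
  hb : ∀ j m, l ≤ j → j < r → l ≤ m → m ≤ r →
    (x (j+1) - x m) * b j + (x m - x j) * b (j+1) ≤ (x (j+1) - x j) * b m

theorem exists_piece {x : ℕ → ℝ} {l r : ℕ} (hlr : l < r) {u : ℝ} (h1 : x l ≤ u) (h2 : u ≤ x r) :
    ∃ m, l ≤ m ∧ m < r ∧ x m ≤ u ∧ u ≤ x (m+1) := by
  induction r, hlr using Nat.le_induction with
  | base => exact ⟨l, le_rfl, Nat.lt_succ_self _, h1, h2⟩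
  | succ n hn ih =>
    rcases le_total u (x n) with h | h
    · obtain ⟨m, a, b, c⟩ := ih h
      exact ⟨m, a, by omega, c⟩
    · exact ⟨n, by omega, by omega, h, h2⟩

theorem mem_seg {x f : ℕ → ℝ} {j : ℕ} {z : E2} (hx : x j < x (j+1)) (h1 : x j ≤ z 0) (h2 : z 0 ≤ x (j+1))
    (h : GG x f j z = 0) : z ∈ segment ℝ (!₂[x j, f j] : E2) !₂[x (j+1), f (j+1)] := by
  have hd : 0 < x (j+1) - x j := sub_pos.2 hx
  refine ⟨(x (j+1) - z 0) / (x (j+1) - x j), (z 0 - x j) / (x (j+1) - x j),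
    div_nonneg (by linarith) hd.le, div_nonneg (by linarith) hd.le, by field_simp; ring, ?_⟩
  unfold GG at h
  ext i
  fin_cases i
  · simp; field_simp; ring
  · simp; field_simp; linarith

theorem mem_vseg {u a b : ℝ} {z : E2} (h0 : z 0 = u) (h1 : a ≤ z 1) (h2 : z 1 ≤ b) :
    z ∈ segment ℝ (!₂[u, a] : E2) !₂[u, b] := by
  have h : z 1 ∈ segment ℝ a b := by rw [segment_eq_Icc (h1.trans h2)]; exact ⟨h1, h2⟩
  obtain ⟨p, q, hp, hq, hpq, he⟩ := h
  refine ⟨p, q, hp, hq, hpq, ?_⟩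
  ext i
  fin_cases i
  · simp; rw [h0, ← add_mul, hpq, one_mul]
  · simpa using he

theorem GG_id (x f : ℕ → ℝ) (j m : ℕ) (z : E2) :
    (x (m+1) - x m) * GG x f j z =
      (x (m+1) - z 0) * ((x (j+1) - x m) * f j + (x m - x j) * f (j+1) - (x (j+1) - x j) * f m)
      + (z 0 - x m) * ((x (j+1) - x (m+1)) * f j + (x (m+1) - x j) * f (j+1) - (x (j+1) - x j) * f (m+1))
      + (x (j+1) - x j) * GG x f m z := by
  unfold GG; ring

section
variable {x t b : ℕ → ℝ} {l r : ℕ} (H : PolyHyp x t b l r)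
include H

theorem GG_top_le {j m : ℕ} {z : E2} (hj : l ≤ j) (hj' : j < r) (hm : l ≤ m) (hm' : m < r)
    (h1 : x m ≤ z 0) (h2 : z 0 ≤ x (m+1)) :
    (x (j+1) - x j) * GG x t m z ≤ (x (m+1) - x m) * GG x t j z := by
  rw [GG_id x t j m z]
  have a1 := mul_nonneg (sub_nonneg.2 h2) (sub_nonneg.2 (H.ht j m hj hj' hm hm'.le))
  have a2 := mul_nonneg (sub_nonneg.2 h1) (sub_nonneg.2 (H.ht j (m+1) hj hj' (by omega) hm'))
  linarith

theorem GG_bot_le {j m : ℕ} {z : E2} (hj : l ≤ j) (hj' : j < r) (hm : l ≤ m) (hm' : m < r)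
    (h1 : x m ≤ z 0) (h2 : z 0 ≤ x (m+1)) :
    (x (m+1) - x m) * GG x b j z ≤ (x (j+1) - x j) * GG x b m z := by
  rw [GG_id x b j m z]
  have a1 := mul_nonneg (sub_nonneg.2 h2) (sub_nonneg.2 (H.hb j m hj hj' hm hm'.le))
  have a2 := mul_nonneg (sub_nonneg.2 h1) (sub_nonneg.2 (H.hb j (m+1) hj hj' (by omega) hm'))
  linarith

theorem Poly_closed : IsClosed (Poly x t b l r) := by
  have : Poly x t b l r = {z : E2 | x l ≤ z 0} ∩ ({z : E2 | z 0 ≤ x r} ∩ ⋂ j, ⋂ (_ : l ≤ j), ⋂ (_ : j < r),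
      ({z : E2 | 0 ≤ GG x t j z} ∩ {z : E2 | GG x b j z ≤ 0})) := by
    ext z; simp [Poly]
  rw [this]
  refine (isClosed_le (by fun_prop) (by fun_prop)).inter ((isClosed_le (by fun_prop) (by fun_prop)).inter ?_)
  refine isClosed_iInter fun j => isClosed_iInter fun _ => isClosed_iInter fun _ => ?_
  exact (isClosed_le continuous_const (GG_cont _ _ _)).inter (isClosed_le (GG_cont _ _ _) continuous_const)

theorem Poly_convex : Convex ℝ (Poly x t b l r) := by
  have e : ∀ (f : ℕ → ℝ) (j : ℕ) (z w : E2) (p q : ℝ), p + q = 1 →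
      GG x f j (p • z + q • w) = p * GG x f j z + q * GG x f j w := by
    intro f j z w p q h
    obtain rfl : q = 1 - p := by linarith
    simp [GG]; ring
  intro z hz w hw p q hp hq hpq
  have e0 : (p • z + q • w) 0 = p * z 0 + q * w 0 := by simp
  refine ⟨?_, ?_, fun j h1 h2 => ?_⟩
  · rw [e0]
    have h1 := mul_le_mul_of_nonneg_left hz.1 hp
    have h2 := mul_le_mul_of_nonneg_left hw.1 hq
    have h3 : x l = p * x l + q * x l := by rw [← add_mul, hpq, one_mul]
    linarith
  · rw [e0]
    have h1 := mul_le_mul_of_nonneg_left hz.2.1 hp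
    have h2 := mul_le_mul_of_nonneg_left hw.2.1 hq
    have h3 : x r = p * x r + q * x r := by rw [← add_mul, hpq, one_mul]
    linarith
  · rw [e _ _ _ _ _ _ hpq, e _ _ _ _ _ _ hpq]
    have a := hz.2.2 j h1 h2
    have c := hw.2.2 j h1 h2
    constructor
    · nlinarith [mul_nonneg hp a.1, mul_nonneg hq c.1]
    · nlinarith [mul_nonneg hp (neg_nonneg.2 a.2), mul_nonneg hq (neg_nonneg.2 c.2)]

theorem Poly_frontier : frontier (Poly x t b l r) ⊆
    ((⋃ j ∈ Finset.Ico l r, segment ℝ (!₂[x j, t j] : E2) !₂[x (j+1), t (j+1)]) ∪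
     (⋃ j ∈ Finset.Ico l r, segment ℝ (!₂[x j, b j] : E2) !₂[x (j+1), b (j+1)])) ∪
    (segment ℝ (!₂[x l, b l] : E2) !₂[x l, t l] ∪ segment ℝ (!₂[x r, b r] : E2) !₂[x r, t r]) := by
  intro z hz
  rw [(Poly_closed H).frontier_eq] at hz
  obtain ⟨hzP, hzi⟩ := hz
  by_contra hcon
  simp only [mem_union, mem_iUnion, Finset.mem_Ico, not_or, not_exists] at hcon
  obtain ⟨⟨c1, c2⟩, c3, c4⟩ := hcon
  apply hzi
  have hU : IsOpen ({z : E2 | x l < z 0} ∩ ({z : E2 | z 0 < x r} ∩ ⋂ j ∈ Finset.Ico l r,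
      ({z : E2 | 0 < GG x t j z} ∩ {z : E2 | GG x b j z < 0}))) := by
    refine (isOpen_lt (by fun_prop) (by fun_prop)).inter ((isOpen_lt (by fun_prop) (by fun_prop)).inter ?_)
    refine isOpen_biInter_finset fun j _ => ?_
    exact (isOpen_lt continuous_const (GG_cont _ _ _)).inter (isOpen_lt (GG_cont _ _ _) continuous_const)
  refine mem_interior.2 ⟨_, ?_, hU, ?_⟩
  · rintro w ⟨h1, h2, h3⟩
    simp only [mem_iInter, Finset.mem_Ico, mem_inter_iff] at h3
    exact ⟨le_of_lt h1, le_of_lt h2, fun j a b => ⟨le_of_lt (h3 j ⟨a, b⟩).1, le_of_lt (h3 j ⟨a, b⟩).2⟩⟩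
  have xl := H.xs l le_rfl H.lr
  obtain ⟨r', rfl⟩ : ∃ r', r = r' + 1 := ⟨r - 1, by have := H.lr; omega⟩
  have hlr' : l ≤ r' := Nat.lt_succ_iff.1 H.lr
  have xr := H.xs r' hlr' (Nat.lt_succ_self _)
  refine ⟨?_, ?_, ?_⟩
  · refine lt_of_le_of_ne hzP.1 fun h => c3 (mem_vseg h.symm ?_ ?_)
    · have := (hzP.2.2 l le_rfl H.lr).2
      unfold GG at this
      rw [← h] at this
      nlinarith
    · have := (hzP.2.2 l le_rfl H.lr).1
      unfold GG at this
      rw [← h] at this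
      nlinarith
  · refine lt_of_le_of_ne hzP.2.1 fun h => c4 (mem_vseg h ?_ ?_)
    · have := (hzP.2.2 r' hlr' (Nat.lt_succ_self _)).2
      unfold GG at this
      rw [h] at this
      nlinarith
    · have := (hzP.2.2 r' hlr' (Nat.lt_succ_self _)).1
      unfold GG at this
      rw [h] at this
      nlinarith
  · obtain ⟨m, hm, hm', h1, h2⟩ := exists_piece H.lr hzP.1 hzP.2.1
    have xm := sub_pos.2 (H.xs m hm hm')
    simp only [mem_iInter, Finset.mem_Ico, mem_inter_iff]
    rintro j ⟨hj, hj'⟩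
    have xj := sub_pos.2 (H.xs j hj hj')
    obtain ⟨p1, p2⟩ := hzP.2.2 m hm hm'
    obtain ⟨q1, q2⟩ := hzP.2.2 j hj hj'
    constructor
    · refine lt_of_le_of_ne q1 fun h => c1 m ⟨hm, hm'⟩ (mem_seg (H.xs m hm hm') h1 h2 ?_)
      have := GG_top_le H hj hj' hm hm' h1 h2
      rw [← h] at this
      nlinarith
    · refine lt_of_le_of_ne q2 fun h => c2 m ⟨hm, hm'⟩ (mem_seg (H.xs m hm hm') h1 h2 ?_)
      have := GG_bot_le H hj hj' hm hm' h1 h2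
      rw [h] at this
      nlinarith

theorem Poly_perim_le : μH[1] (frontier (Poly x t b l r)) ≤
    ENNReal.ofReal ((∑ j ∈ Finset.Ico l r, (dist (!₂[x j, t j] : E2) !₂[x (j+1), t (j+1)]
      + dist (!₂[x j, b j] : E2) !₂[x (j+1), b (j+1)])) +
    (dist (!₂[x l, b l] : E2) !₂[x l, t l] + dist (!₂[x r, b r] : E2) !₂[x r, t r])) := by
  refine (measure_mono (Poly_frontier H)).trans ?_
  refine (measure_union_le _ _).trans ?_
  rw [Finset.sum_add_distrib, ENNReal.ofReal_add (by positivity) (by positivity),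
    ENNReal.ofReal_add (by positivity) (by positivity), ENNReal.ofReal_add (by positivity) (by positivity)]
  refine add_le_add ((measure_union_le _ _).trans (add_le_add ?_ ?_))
    ((measure_union_le _ _).trans (add_le_add ?_ ?_))
  · rw [ENNReal.ofReal_sum_of_nonneg (fun _ _ => dist_nonneg)]
    refine (measure_biUnion_finset_le _ _).trans (Finset.sum_le_sum fun j _ => ?_)
    rw [hausdorffMeasure_segment, edist_dist]
  · rw [ENNReal.ofReal_sum_of_nonneg (fun _ _ => dist_nonneg)]
    refine (measure_biUnion_finset_le _ _).trans (Finset.sum_le_sum fun j _ => ?_)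
    rw [hausdorffMeasure_segment, edist_dist]
  · rw [hausdorffMeasure_segment, edist_dist]
  · rw [hausdorffMeasure_segment, edist_dist]

theorem Poly_sub_hull : Poly x t b l r ⊆ convexHull ℝ ((fun j => (!₂[x j, t j] : E2)) '' Icc l r ∪ (fun j => (!₂[x j, b j] : E2)) '' Icc l r) := by
    intro z hz
    obtain ⟨m, hm, hm', h1, h2⟩ := exists_piece H.lr hz.1 hz.2.1
    have xm := sub_pos.2 (H.xs m hm hm')
    obtain ⟨p1, p2⟩ := hz.2.2 m hm hm'
    set S := (fun j => (!₂[x j, t j] : E2)) '' Icc l r ∪ (fun j => (!₂[x j, b j] : E2)) '' Icc l r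
    have hS : Convex ℝ (convexHull ℝ S) := convex_convexHull ℝ S
    have key : ∀ f : ℕ → ℝ, (∀ j ∈ Icc l r, (!₂[x j, f j] : E2) ∈ S) →
        (!₂[z 0, z 1 + GG x f m z / (x (m+1) - x m)] : E2) ∈ convexHull ℝ S := by
      intro f hf
      refine hS.segment_subset (subset_convexHull ℝ S (hf m ⟨hm, hm'.le⟩))
        (subset_convexHull ℝ S (hf (m+1) ⟨by omega, hm'⟩)) (mem_seg (H.xs m hm hm') (by simpa) (by simpa) ?_)
      simp [GG]; field_simp; ring
    have k1 := key t fun j hj => Or.inl ⟨j, hj, rfl⟩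
    have k2 := key b fun j hj => Or.inr ⟨j, hj, rfl⟩
    refine hS.segment_subset k2 k1 (mem_vseg rfl ?_ ?_)
    · have := div_nonpos_of_nonpos_of_nonneg p2 xm.le
      linarith
    · have := div_nonneg p1 xm.le
      linarith

theorem Poly_bounded : Bornology.IsBounded (Poly x t b l r) := by
  refine Bornology.IsBounded.subset ?_ (Poly_sub_hull H)
  rw [isBounded_convexHull]
  exact (((finite_Icc l r).image _).union ((finite_Icc l r).image _)).isBounded
end
end Forest

namespace Forest


def Ed (x f : ℕ → ℝ) (j : ℕ) : Set E2 := {z | x j < z 0 ∧ z 0 < x (j+1) ∧ GG x f j z = 0}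

theorem Ed_meas (x f : ℕ → ℝ) (j : ℕ) : MeasurableSet (Ed x f j) := by
  have : Ed x f j = {z : E2 | x j < z 0} ∩ ({z : E2 | z 0 < x (j+1)} ∩ {z | GG x f j z = 0}) := by
    ext z; simp [Ed]
  rw [this]
  exact (isOpen_lt (by fun_prop) (by fun_prop)).measurableSet.inter
    ((isOpen_lt (by fun_prop) (by fun_prop)).measurableSet.inter
      (isClosed_eq (GG_cont _ _ _) continuous_const).measurableSet)

theorem Ed_len (x f : ℕ → ℝ) (j : ℕ) (h : x j < x (j+1)) :
    ENNReal.ofReal (dist (!₂[x j, f j] : E2) !₂[x (j+1), f (j+1)]) ≤ μH[1] (Ed x f j) := by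
  have hs : segment ℝ (!₂[x j, f j] : E2) !₂[x (j+1), f (j+1)] ⊆
      Ed x f j ∪ ({(!₂[x j, f j] : E2)} ∪ {(!₂[x (j+1), f (j+1)] : E2)}) := by
    rintro _ ⟨p, q, hp, hq, hpq, rfl⟩
    rcases hp.eq_or_lt with rfl | hp
    · right; right
      obtain rfl : q = 1 := by linarith
      simp
    rcases hq.eq_or_lt with rfl | hq
    · right; left
      obtain rfl : p = 1 := by linarith
      simp
    left
    obtain rfl : q = 1 - p := by linarith
    refine ⟨?_, ?_, ?_⟩
    · simp; nlinarith
    · simp; nlinarith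
    · simp [GG]; ring
  haveI : NoAtoms (μH[1] : Measure E2) := Measure.noAtoms_hausdorff E2 one_pos
  rw [← edist_dist, ← hausdorffMeasure_segment]
  refine (measure_mono hs).trans ((measure_union_le _ _).trans ?_)
  have h0 : μH[1] ({(!₂[x j, f j] : E2)} ∪ {(!₂[x (j+1), f (j+1)] : E2)}) ≤ 0 := by
    refine (measure_union_le _ _).trans ?_
    rw [this.measure_singleton, this.measure_singleton, add_zero]
  calc _ ≤ μH[1] (Ed x f j) + 0 := by gcongr
    _ = _ := add_zero _

theorem Poly_perim_ge {x t b : ℕ → ℝ} {l r : ℕ} (H : PolyHyp x t b l r)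
    (hst : ∀ j, l ≤ j → j < r → b j < t j ∨ b (j+1) < t (j+1)) :
    ENNReal.ofReal (∑ j ∈ Finset.Ico l r, (dist (!₂[x j, t j] : E2) !₂[x (j+1), t (j+1)]
      + dist (!₂[x j, b j] : E2) !₂[x (j+1), b (j+1)])) ≤ μH[1] (frontier (Poly x t b l r)) := by
  have hmono : ∀ i j, l ≤ i → i ≤ j → j ≤ r → x i ≤ x j := by
    intro i j hi hij hj
    induction j, hij using Nat.le_induction with
    | base => exact le_rfl
    | succ n hn ih => exact (ih (by omega)).trans (H.xs n (by omega) (by omega)).le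
  let F : ℕ × Bool → Set E2 := fun p => Ed x (if p.2 then t else b) p.1
  -- relative position
  have hin : ∀ j, l ≤ j → j < r → ∀ z : E2, x j ≤ z 0 → z 0 ≤ x (j+1) → 0 ≤ GG x t j z → GG x b j z ≤ 0 →
      z ∈ Poly x t b l r := by
    intro j hj hj' z h1 h2 h3 h4
    refine ⟨(hmono l j le_rfl hj hj'.le).trans h1, h2.trans (hmono (j+1) r (by omega) hj' le_rfl), fun m hm hm' => ?_⟩
    have xm := sub_pos.2 (H.xs m hm hm')
    have xj := sub_pos.2 (H.xs j hj hj')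
    have a1 := GG_top_le H hm hm' hj hj' h1 h2
    have a2 := GG_bot_le H hm hm' hj hj' h1 h2
    constructor
    · by_contra hc
      push Not at hc
      nlinarith [mul_nonneg xm.le h3]
    · by_contra hc
      push Not at hc
      nlinarith [mul_nonneg xm.le (neg_nonneg.2 h4)]
  have hdiff : ∀ j, l ≤ j → j < r → ∀ z : E2, x j < z 0 → z 0 < x (j+1) → GG x b j z < GG x t j z := by
    intro j hj hj' z h1 h2
    have e : GG x t j z - GG x b j z = (x (j+1) - z 0) * (t j - b j) + (z 0 - x j) * (t (j+1) - b (j+1)) := by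
      unfold GG; ring
    have b1 := H.bt j hj hj'.le
    have b2 := H.bt (j+1) (by omega) hj'
    rcases hst j hj hj' with h | h
    · have := mul_pos (sub_pos.2 h2) (sub_pos.2 h)
      have := mul_nonneg (sub_nonneg.2 h1.le) (sub_nonneg.2 b2)
      linarith
    · have := mul_nonneg (sub_nonneg.2 h2.le) (sub_nonneg.2 b1)
      have := mul_pos (sub_pos.2 h1) (sub_pos.2 h)
      linarith
  have hcl := Poly_closed H
  have hsub : ∀ p ∈ Finset.Ico l r ×ˢ (Finset.univ : Finset Bool), F p ⊆ frontier (Poly x t b l r) := by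
    rintro ⟨j, s⟩ hp z hz
    simp only [Finset.mem_product, Finset.mem_Ico, Finset.mem_univ, and_true] at hp
    obtain ⟨hj, hj'⟩ := hp
    obtain ⟨h1, h2, h3⟩ := hz
    have hd := hdiff j hj hj' z h1 h2
    have xj := sub_pos.2 (H.xs j hj hj')
    have hzP : z ∈ Poly x t b l r := by
      apply hin j hj hj' z h1.le h2.le
      · cases s <;> simp at h3 <;> linarith
      · cases s <;> simp at h3 <;> linarith
    rw [hcl.frontier_eq]
    refine ⟨hzP, fun hi => ?_⟩
    have hshift : ∀ v : ℝ, Filter.Tendsto (fun ε : ℝ => (!₂[z 0, z 1 + ε * v] : E2)) (nhdsWithin 0 (Ioi 0)) (nhds z) := by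
      intro v
      have hc : Continuous (fun ε : ℝ => (!₂[z 0, z 1 + ε * v] : E2)) := by fun_prop
      have := hc.tendsto 0
      simp only [zero_mul, add_zero] at this
      have hz' : (!₂[z 0, z 1] : E2) = z := by ext i; fin_cases i <;> rfl
      rw [hz'] at this
      exact this.mono_left nhdsWithin_le_nhds
    have hnb := mem_interior_iff_mem_nhds.1 hi
    cases s
    · obtain ⟨ε, hε, hε0⟩ := (((hshift (-1)).eventually hnb).and self_mem_nhdsWithin).exists
      have h5 := (hε.2.2 j hj hj').2
      simp [GG] at h3 h5 hε0
      nlinarith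
    · obtain ⟨ε, hε, hε0⟩ := (((hshift 1).eventually hnb).and self_mem_nhdsWithin).exists
      have h5 := (hε.2.2 j hj hj').1
      simp [GG] at h3 h5 hε0
      nlinarith
  have hdis : (↑(Finset.Ico l r ×ˢ (Finset.univ : Finset Bool)) : Set (ℕ × Bool)).PairwiseDisjoint F := by
    rintro ⟨i, s⟩ hp ⟨j, s'⟩ hq hne
    simp only [Finset.coe_product, mem_prod, Finset.coe_Ico, mem_Ico, Finset.coe_univ, mem_univ, and_true] at hp hq
    refine Set.disjoint_left.2 fun z hz hz' => ?_
    obtain ⟨h1, h2, h3⟩ := hz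
    obtain ⟨h1', h2', h3'⟩ := hz'
    simp only at *
    rcases lt_trichotomy i j with h | h | h
    · have := hmono (i+1) j (by omega) h (by omega)
      linarith
    · subst h
      have hd := hdiff i hp.1 hp.2 z h1 h2
      cases s <;> cases s' <;> simp at h3 h3' hne <;> linarith
    · have := hmono (j+1) i (by omega) h (by omega)
      linarith
  calc _ = ∑ p ∈ Finset.Ico l r ×ˢ (Finset.univ : Finset Bool),
        ENNReal.ofReal (dist (!₂[x p.1, (if p.2 then t else b) p.1] : E2) !₂[x (p.1+1), (if p.2 then t else b) (p.1+1)]) := by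
        rw [Finset.sum_product, ENNReal.ofReal_sum_of_nonneg (fun _ _ => by positivity)]
        refine Finset.sum_congr rfl fun j _ => ?_
        rw [Fintype.sum_bool, ENNReal.ofReal_add dist_nonneg dist_nonneg]
        simp
    _ ≤ ∑ p ∈ Finset.Ico l r ×ˢ (Finset.univ : Finset Bool), μH[1] (F p) := by
        refine Finset.sum_le_sum fun p hp => ?_
        simp only [Finset.mem_product, Finset.mem_Ico, Finset.mem_univ, and_true] at hp
        exact Ed_len _ _ _ (H.xs _ hp.1 hp.2)
    _ = μH[1] (⋃ p ∈ Finset.Ico l r ×ˢ (Finset.univ : Finset Bool), F p) :=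
        (measure_biUnion_finset hdis fun p _ => Ed_meas _ _ _).symm
    _ ≤ _ := measure_mono (iUnion₂_subset hsub)
end Forest

namespace Forest


def sl (A : Set E2) (u : ℝ) : Set ℝ := {y | (!₂[u, y] : E2) ∈ A}
def top (A : Set E2) (u : ℝ) : ℝ := sSup (sl A u)
def bot (A : Set E2) (u : ℝ) : ℝ := sInf (sl A u)

theorem pair_eta (z : E2) : (!₂[z 0, z 1] : E2) = z := by ext i; fin_cases i <;> rfl

theorem mem_sl {A : Set E2} {z : E2} (h : z ∈ A) : z 1 ∈ sl A (z 0) := by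
  show (!₂[z 0, z 1] : E2) ∈ A
  rwa [pair_eta]

section
variable {A : Set E2} (hA : IsCompact A)
include hA

theorem sl_compact (u : ℝ) : IsCompact (sl A u) := by
  have hc : Continuous fun y : ℝ => (!₂[u, y] : E2) := by fun_prop
  have h0 : Continuous fun z : E2 => z 1 := by fun_prop
  refine (hA.image h0).of_isClosed_subset (hA.isClosed.preimage hc) ?_
  intro y hy
  exact ⟨_, hy, by simp⟩

theorem top_mem {u : ℝ} (h : (sl A u).Nonempty) : (!₂[u, top A u] : E2) ∈ A := (sl_compact hA u).sSup_mem h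
theorem bot_mem {u : ℝ} (h : (sl A u).Nonempty) : (!₂[u, bot A u] : E2) ∈ A := (sl_compact hA u).sInf_mem h
theorem le_top {u y : ℝ} (h : (!₂[u, y] : E2) ∈ A) : y ≤ top A u := le_csSup (sl_compact hA u).bddAbove h
theorem bot_le {u y : ℝ} (h : (!₂[u, y] : E2) ∈ A) : bot A u ≤ y := csInf_le (sl_compact hA u).bddBelow h
theorem bot_le_top {u : ℝ} (h : (sl A u).Nonempty) : bot A u ≤ top A u := bot_le hA (top_mem hA h)

theorem lt_top {u y : ℝ} (h : (!₂[u, y] : E2) ∈ interior A) : y < top A u := by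
  have hc : Continuous fun y : ℝ => (!₂[u, y] : E2) := by fun_prop
  have := (hc.tendsto y).mono_left (nhdsWithin_le_nhds (s := Ioi y))
  obtain ⟨y', h1, h2⟩ := ((this.eventually (mem_interior_iff_mem_nhds.1 h)).and self_mem_nhdsWithin).exists
  exact lt_of_lt_of_le h2 (le_top hA h1)

theorem bot_lt {u y : ℝ} (h : (!₂[u, y] : E2) ∈ interior A) : bot A u < y := by
  have hc : Continuous fun y : ℝ => (!₂[u, y] : E2) := by fun_prop
  have := (hc.tendsto y).mono_left (nhdsWithin_le_nhds (s := Iio y))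
  obtain ⟨y', h1, h2⟩ := ((this.eventually (mem_interior_iff_mem_nhds.1 h)).and self_mem_nhdsWithin).exists
  exact lt_of_le_of_lt (bot_le hA h1) h2
end

section
variable {A : Set E2} (hA : IsCompact A) (hv : Convex ℝ A)
include hv

theorem comb_mem {u v w a b : ℝ} (h1 : u ≤ v) (h2 : v ≤ w) (hlt : u < w) (ha : (!₂[u, a] : E2) ∈ A)
    (hb : (!₂[w, b] : E2) ∈ A) : (!₂[v, ((w - v) * a + (v - u) * b) / (w - u)] : E2) ∈ A := by
  have hd : 0 < w - u := sub_pos.2 hlt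
  have := hv ha hb (a := (w - v) / (w - u)) (b := (v - u) / (w - u)) (div_nonneg (by linarith) hd.le)
    (div_nonneg (by linarith) hd.le) (by field_simp; ring)
  convert this using 1
  ext i
  fin_cases i
  · simp; field_simp; ring
  · simp; field_simp

theorem sl_between {u v w : ℝ} (h1 : u ≤ v) (h2 : v ≤ w) (hu : (sl A u).Nonempty) (hw : (sl A w).Nonempty) :
    (sl A v).Nonempty := by
  rcases (h1.trans h2).eq_or_lt with h | h
  · obtain rfl : u = v := le_antisymm h1 (by linarith)
    exact hu
  · obtain ⟨a, ha⟩ := hu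
    obtain ⟨b, hb⟩ := hw
    exact ⟨_, comb_mem hv h1 h2 h ha hb⟩

theorem sl_mem {u y a b : ℝ} (ha : (!₂[u, a] : E2) ∈ A) (hb : (!₂[u, b] : E2) ∈ A) (h1 : a ≤ y) (h2 : y ≤ b) :
    (!₂[u, y] : E2) ∈ A :=
  hv.segment_subset ha hb (mem_vseg (by simp) (by simpa) (by simpa))

include hA
theorem top3 {u v w : ℝ} (h1 : u ≤ v) (h2 : v ≤ w) (hu : (sl A u).Nonempty) (hw : (sl A w).Nonempty) :
    (w - v) * top A u + (v - u) * top A w ≤ (w - u) * top A v := by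
  rcases (h1.trans h2).eq_or_lt with h | h
  · obtain rfl : u = v := le_antisymm h1 (by linarith)
    subst h; simp
  · have := le_top hA (comb_mem hv h1 h2 h (top_mem hA hu) (top_mem hA hw))
    rwa [div_le_iff₀' (sub_pos.2 h)] at this

theorem bot3 {u v w : ℝ} (h1 : u ≤ v) (h2 : v ≤ w) (hu : (sl A u).Nonempty) (hw : (sl A w).Nonempty) :
    (w - u) * bot A v ≤ (w - v) * bot A u + (v - u) * bot A w := by
  rcases (h1.trans h2).eq_or_lt with h | h
  · obtain rfl : u = v := le_antisymm h1 (by linarith)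
    subst h; simp
  · have := bot_le hA (comb_mem hv h1 h2 h (bot_mem hA hu) (bot_mem hA hw))
    rwa [le_div_iff₀' (sub_pos.2 h)] at this

variable {x : ℕ → ℝ} {l r : ℕ} (hlr : l < r) (hx : ∀ j, l ≤ j → j < r → x j < x (j+1))
  (hs : ∀ j, l ≤ j → j ≤ r → (sl A (x j)).Nonempty)
include hlr hx hs

theorem polyHyp : PolyHyp x (fun j => top A (x j)) (fun j => bot A (x j)) l r := by
  have hmono : ∀ i j, l ≤ i → i ≤ j → j ≤ r → x i ≤ x j := by
    intro i j hi hij hj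
    induction j, hij using Nat.le_induction with
    | base => exact le_rfl
    | succ n hn ih => exact (ih (by omega)).trans (hx n (by omega) (by omega)).le
  refine ⟨hlr, hx, fun j h1 h2 => bot_le_top hA (hs j h1 h2), fun j m hj hj' hm hm' => ?_, fun j m hj hj' hm hm' => ?_⟩
  · rcases le_or_gt m j with h | h
    · have := top3 hA hv (hmono m j hm h hj'.le) (hx j hj hj').le (hs m hm hm') (hs (j+1) (by omega) hj')
      linarith
    · have := top3 hA hv (hx j hj hj').le (hmono (j+1) m (by omega) h hm') (hs j hj hj'.le) (hs m hm hm')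
      linarith
  · rcases le_or_gt m j with h | h
    · have := bot3 hA hv (hmono m j hm h hj'.le) (hx j hj hj').le (hs m hm hm') (hs (j+1) (by omega) hj')
      linarith
    · have := bot3 hA hv (hx j hj hj').le (hmono (j+1) m (by omega) h hm') (hs j hj hj'.le) (hs m hm hm')
      linarith

theorem poly_sub : Poly x (fun j => top A (x j)) (fun j => bot A (x j)) l r ⊆ A := by
  refine (Poly_sub_hull (polyHyp hA hv hlr hx hs)).trans (convexHull_min ?_ hv)
  rintro _ (⟨j, hj, rfl⟩ | ⟨j, hj, rfl⟩)
  · exact top_mem hA (hs j hj.1 hj.2)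
  · exact bot_mem hA (hs j hj.1 hj.2)

theorem hull_sub {S : Set E2} (hSA : S ⊆ A) (hS : ∀ s ∈ S, ∃ c, l ≤ c ∧ c ≤ r ∧ s 0 = x c) :
    convexHull ℝ S ⊆ Poly x (fun j => top A (x j)) (fun j => bot A (x j)) l r := by
  have H := polyHyp hA hv hlr hx hs
  have hmono : ∀ i j, l ≤ i → i ≤ j → j ≤ r → x i ≤ x j := by
    intro i j hi hij hj
    induction j, hij using Nat.le_induction with
    | base => exact le_rfl
    | succ n hn ih => exact (ih (by omega)).trans (hx n (by omega) (by omega)).le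
  refine convexHull_min (fun s hs' => ?_) (Poly_convex H)
  obtain ⟨c, h1, h2, h3⟩ := hS s hs'
  have hm : (!₂[x c, s 1] : E2) ∈ A := by rw [← h3, pair_eta]; exact hSA hs'
  refine ⟨by rw [h3]; exact hmono _ _ le_rfl h1 h2, by rw [h3]; exact hmono _ _ h1 h2 le_rfl, fun j hj hj' => ?_⟩
  have e1 := H.ht j c hj hj' h1 h2
  have e2 := H.hb j c hj hj' h1 h2
  have xj := sub_pos.2 (hx j hj hj')
  have f1 := mul_le_mul_of_nonneg_left (le_top hA hm) xj.le
  have f2 := mul_le_mul_of_nonneg_left (bot_le hA hm) xj.le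
  unfold GG
  rw [h3]
  constructor <;> linarith
end
end Forest

namespace Forest


theorem Cols.len_eq {k M : ℕ} (K : Cols k M) (o : Option (Fin k)) (h : K.l o ≤ K.r o) :
    K.len o = (∑ j ∈ Finset.Ico (K.l o) (K.r o), (dist (!₂[K.x j, K.t o j] : E2) !₂[K.x (j+1), K.t o (j+1)]
      + dist (!₂[K.x j, K.b o j] : E2) !₂[K.x (j+1), K.b o (j+1)])) +
    (dist (!₂[K.x (K.l o), K.b o (K.l o)] : E2) !₂[K.x (K.l o), K.t o (K.l o)] +
      dist (!₂[K.x (K.r o), K.b o (K.r o)] : E2) !₂[K.x (K.r o), K.t o (K.r o)]) := by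
  have hI : Finset.Icc (K.l o) (K.r o) = Finset.Ico (K.l o) (K.r o + 1) := by
    ext j; simp [Nat.lt_succ_iff]
  unfold Cols.len
  rw [Finset.sum_add_distrib, hI, Finset.sum_Ico_succ_top h, Finset.sum_eq_sum_Ico_succ_bot (by omega : K.l o < K.r o + 1),
    ← Finset.sum_Ico_add' _ (K.l o) (K.r o) 1, Finset.sum_add_distrib]
  have e1 : ∑ j ∈ Finset.Ico (K.l o) (K.r o), ‖K.pt (K.nx (o, j, true)) - K.pt (o, j, true)‖ =
      ∑ j ∈ Finset.Ico (K.l o) (K.r o), dist (!₂[K.x j, K.t o j] : E2) !₂[K.x (j+1), K.t o (j+1)] := by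
    refine Finset.sum_congr rfl fun j hj => ?_
    rw [dist_comm, dist_eq_norm]
    simp [Cols.nx, (Finset.mem_Ico.1 hj).2, Cols.pt]
  have e2 : ∑ j ∈ Finset.Ico (K.l o) (K.r o), ‖K.pt (K.nx (o, j + 1, false)) - K.pt (o, j + 1, false)‖ =
      ∑ j ∈ Finset.Ico (K.l o) (K.r o), dist (!₂[K.x j, K.b o j] : E2) !₂[K.x (j+1), K.b o (j+1)] := by
    refine Finset.sum_congr rfl fun j hj => ?_
    rw [dist_eq_norm]
    have := (Finset.mem_Ico.1 hj).1
    simp [Cols.nx, Nat.lt_succ_iff.2 this, Cols.pt]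
  have e3 : ‖K.pt (K.nx (o, K.r o, true)) - K.pt (o, K.r o, true)‖ =
      dist (!₂[K.x (K.r o), K.b o (K.r o)] : E2) !₂[K.x (K.r o), K.t o (K.r o)] := by
    rw [dist_eq_norm]; simp [Cols.nx, Cols.pt]
  have e4 : ‖K.pt (K.nx (o, K.l o, false)) - K.pt (o, K.l o, false)‖ =
      dist (!₂[K.x (K.l o), K.b o (K.l o)] : E2) !₂[K.x (K.l o), K.t o (K.l o)] := by
    rw [dist_comm, dist_eq_norm]; simp [Cols.nx, Cols.pt]
  rw [e1, e2, e3, e4]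
  ring

theorem enum_real (X : Finset ℝ) (hX : X.Nonempty) : ∃ (M : ℕ) (x : ℕ → ℝ), (∀ j, j < M → x j < x (j+1)) ∧
    (∀ j, j ≤ M → x j ∈ X) ∧ ∀ u ∈ X, ∃ j, j ≤ M ∧ x j = u := by
  have hc := hX.card_pos
  refine ⟨X.card - 1, fun j => if h : j < X.card then X.orderEmbOfFin rfl ⟨j, h⟩ else 0, fun j hj => ?_, fun j hj => ?_, fun u hu => ?_⟩
  · simp only
    rw [dif_pos (by omega : j < X.card), dif_pos (by omega : j + 1 < X.card)]
    exact (X.orderEmbOfFin rfl).strictMono (by simp [Fin.lt_def])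
  · simp only
    rw [dif_pos (by omega : j < X.card)]
    exact X.orderEmbOfFin_mem rfl _
  · have : u ∈ Set.range (X.orderEmbOfFin rfl) := by rw [Finset.range_orderEmbOfFin]; exact hu
    obtain ⟨⟨j, hj⟩, rfl⟩ := this
    exact ⟨j, by omega, by simp [hj]⟩

theorem int_shift {A : Set E2} {z : E2} (hz : z ∈ interior A) : ∃ ε > 0, (!₂[z 0 + ε, z 1] : E2) ∈ A ∧ (!₂[z 0 - ε, z 1] : E2) ∈ A := by
  have h1 : Filter.Tendsto (fun ε : ℝ => (!₂[z 0 + ε, z 1] : E2)) (nhdsWithin 0 (Ioi 0)) (nhds z) := by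
    have hc : Continuous (fun ε : ℝ => (!₂[z 0 + ε, z 1] : E2)) := by fun_prop
    have := hc.tendsto 0
    simp only [add_zero] at this
    rw [pair_eta] at this
    exact this.mono_left nhdsWithin_le_nhds
  have h2 : Filter.Tendsto (fun ε : ℝ => (!₂[z 0 - ε, z 1] : E2)) (nhdsWithin 0 (Ioi 0)) (nhds z) := by
    have hc : Continuous (fun ε : ℝ => (!₂[z 0 - ε, z 1] : E2)) := by fun_prop
    have := hc.tendsto 0
    simp only [sub_zero] at this
    rw [pair_eta] at this
    exact this.mono_left nhdsWithin_le_nhds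
  have hn := mem_interior_iff_mem_nhds.1 hz
  obtain ⟨ε, h3, h4, h5⟩ := ((h1.eventually hn).and ((h2.eventually hn).and self_mem_nhdsWithin)).exists
  exact ⟨ε, h5, h3, h4⟩

theorem dist_sq (z w : E2) : dist z w ^ 2 = (z 0 - w 0) ^ 2 + (z 1 - w 1) ^ 2 := by
  rw [EuclideanSpace.dist_eq, Real.sq_sqrt (by positivity)]
  simp [Fin.sum_univ_two, Real.dist_eq, sq_abs]

theorem dx_le_dist (z w : E2) : w 0 - z 0 ≤ dist z w := by
  have := dist_sq z w
  have h0 : 0 ≤ dist z w := dist_nonneg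
  nlinarith [sq_nonneg (z 1 - w 1)]

theorem order_const {A A' : Set E2} (hv : Convex ℝ A) (hv' : Convex ℝ A')
    (hd : Disjoint A A') {u w a1 a2 b1 b2 : ℝ}
    (hcu : (!₂[u, a1] : E2) ∈ A) (hcw : (!₂[w, a2] : E2) ∈ A)
    (hcu' : (!₂[u, b1] : E2) ∈ A') (hcw' : (!₂[w, b2] : E2) ∈ A') (g1 : a1 < b1) (g2 : b2 < a2) : False := by
  -- the two chords cross
  have hpos : 0 < (b1 - a1) + (a2 - b2) := by linarith
  set s := (b1 - a1) / ((b1 - a1) + (a2 - b2)) with hs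
  have s0 : 0 ≤ s := div_nonneg (by linarith) hpos.le
  have s1 : 0 ≤ 1 - s := by
    rw [hs, sub_nonneg, div_le_one hpos]; linarith
  have m1 := hv hcu hcw s1 s0 (by ring)
  have m2 := hv' hcu' hcw' s1 s0 (by ring)
  refine Set.disjoint_left.1 hd m1 ?_
  convert m2 using 1
  ext i
  fin_cases i
  · simp
  · simp
    rw [hs]; field_simp; ring
end Forest

namespace Forest


theorem core (k : ℕ) (C : Set E2) (A K : Fin k → Set E2) (hCc : IsCompact C) (hCv : Convex ℝ C)
    (hCi : (interior C).Nonempty) (hfin : μH[1] (frontier C) ≠ ⊤) (p q : E2) (hp : p ∈ C) (hq : q ∈ C)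
    (hpq : p 1 = q 1) (hD : q 0 - p 0 = Metric.diam C)
    (hAc : ∀ i, IsCompact (A i)) (hAv : ∀ i, Convex ℝ (A i)) (hAC : ∀ i, A i ⊆ interior C)
    (hAd : ∀ i j, i ≠ j → Disjoint (A i) (A j))
    (hKc : ∀ i, IsCompact (K i)) (hKv : ∀ i, Convex ℝ (K i)) (hKi : ∀ i, (interior (K i)).Nonempty)
    (hKA : ∀ i, K i ⊆ interior (A i)) :
    ∑ i, (μH[1] (frontier (K i))).toReal ≤ (μH[1] (frontier C)).toReal + 2 * ((k : ℝ) - 1) * Metric.diam C := by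
  classical
  set D := Metric.diam C with hDdef
  have hdle : ∀ z ∈ C, ∀ w ∈ C, dist z w ≤ D := fun z hz w hw => Metric.dist_le_diam_of_mem hCc.isBounded hz hw
  have hstrip : ∀ z ∈ C, p 0 ≤ z 0 ∧ z 0 ≤ q 0 := by
    intro z hz
    have h1 := dx_le_dist z q
    have h2 := dx_le_dist p z
    have h3 := hdle z hz q hq
    have h4 := hdle p hp z hz
    constructor <;> linarith
  have hstrict : ∀ z ∈ interior C, p 0 < z 0 ∧ z 0 < q 0 := by
    intro z hz
    obtain ⟨ε, hε, h1, h2⟩ := int_shift hz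
    have h3 := (hstrip _ h1).2
    have h4 := (hstrip _ h2).1
    simp at h3 h4
    constructor <;> linarith
  obtain ⟨z₀, hz₀⟩ := hCi
  have hS : ∀ i, ∃ S : Finset E2, K i ⊆ interior (convexHull ℝ (S : Set E2)) ∧ convexHull ℝ (S : Set E2) ⊆ interior (A i) :=
    fun i => (hKv i).exists_subset_interior_convexHull_finset_of_isCompact (hKc i) (isOpen_interior.mem_nhdsSet.2 (hKA i))
  choose S hS1 hS2 using hS
  have hS3 : ∀ i, ∀ s ∈ S i, s ∈ interior (A i) := fun i s hs => hS2 i (subset_convexHull ℝ _ hs)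
  have hS4 : ∀ i, ∀ s ∈ S i, p 0 < s 0 ∧ s 0 < q 0 := fun i s hs => hstrict s (hAC i (interior_subset (hS3 i s hs)))
  have hSne : ∀ i, (S i).Nonempty := by
    intro i
    obtain ⟨y, hy⟩ := hKi i
    have := interior_subset (hS1 i (interior_subset hy))
    have h2 : (convexHull ℝ (S i : Set E2)).Nonempty := ⟨y, this⟩
    rw [convexHull_nonempty_iff] at h2
    exact_mod_cast h2
  let X : Finset ℝ := insert (p 0) (insert (q 0) (insert (z₀ 0) (Finset.univ.biUnion fun i => (S i).image fun s => s 0)))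
  obtain ⟨M, x, hx, hxX, hXx⟩ := enum_real X ⟨p 0, by simp [X]⟩
  have hXb : ∀ u ∈ X, p 0 ≤ u ∧ u ≤ q 0 := by
    intro u hu
    have hz := hstrict z₀ hz₀
    simp only [X, Finset.mem_insert, Finset.mem_biUnion, Finset.mem_univ, true_and, Finset.mem_image] at hu
    rcases hu with rfl | rfl | rfl | ⟨i, s, hs, rfl⟩
    · constructor <;> linarith
    · constructor <;> linarith
    · constructor <;> linarith
    · have := hS4 i s hs
      constructor <;> linarith
  have hmono : ∀ i j, i ≤ j → j ≤ M → x i ≤ x j := by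
    intro i j hij hj
    induction j, hij using Nat.le_induction with
    | base => exact le_rfl
    | succ n hn ih => exact (ih (by omega)).trans (hx n (by omega)).le
  have hsm : ∀ i j, i < j → j ≤ M → x i < x j := by
    intro i j hij hj
    exact (hx i (by omega)).trans_le (hmono (i+1) j hij hj)
  have hinv : ∀ i j, i ≤ M → j ≤ M → x i ≤ x j → i ≤ j := by
    intro i j hi hj h
    by_contra hc
    exact absurd (hsm j i (by omega) hi) (by linarith)
  have hinv' : ∀ i j, i ≤ M → j ≤ M → x i < x j → i < j := by
    intro i j hi hj h
    by_contra hc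
    exact absurd (hmono j i (by omega) hi) (by linarith)
  have hx0 : x 0 = p 0 := by
    obtain ⟨j, hj, he⟩ := hXx (p 0) (by simp [X])
    have h1 := hmono 0 j (Nat.zero_le _) hj
    have h2 := (hXb _ (hxX 0 (Nat.zero_le _))).1
    linarith
  have hxM : x M = q 0 := by
    obtain ⟨j, hj, he⟩ := hXx (q 0) (by simp [X])
    have h1 := hmono j M hj le_rfl
    have h2 := (hXb _ (hxX M le_rfl)).2
    linarith
  have hM2 : 2 ≤ M := by
    obtain ⟨j, hj, he⟩ := hXx (z₀ 0) (by simp [X])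
    have hz := hstrict z₀ hz₀
    have h1 := hinv' 0 j (Nat.zero_le _) hj (by linarith)
    have h2 := hinv' j M hj le_rfl (by linarith)
    omega
  have hLR : ∀ i, ∃ l r, 1 ≤ l ∧ l < r ∧ r < M ∧ (∀ c, l ≤ c → c ≤ r → (sl (interior (A i)) (x c)).Nonempty) ∧
      (∀ s ∈ S i, ∃ c, l ≤ c ∧ c ≤ r ∧ s 0 = x c) := by
    intro i
    obtain ⟨s1, hs1, hm1⟩ := Finset.exists_min_image (S i) (fun s => s 0) (hSne i)
    obtain ⟨s2, hs2, hm2⟩ := Finset.exists_max_image (S i) (fun s => s 0) (hSne i)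
    have hex : ∀ s ∈ S i, ∃ j, j ≤ M ∧ x j = s 0 := fun s hs => hXx _ (by
      simp only [X, Finset.mem_insert, Finset.mem_biUnion, Finset.mem_univ, true_and, Finset.mem_image]
      exact Or.inr (Or.inr (Or.inr ⟨i, s, hs, rfl⟩)))
    obtain ⟨l, hl, hl'⟩ := hex s1 hs1
    obtain ⟨r, hr, hr'⟩ := hex s2 hs2
    have hlt : s1 0 < s2 0 := by
      obtain ⟨y, hy⟩ := hKi i
      have hsub : convexHull ℝ (S i : Set E2) ⊆ {z : E2 | s1 0 ≤ z 0} ∩ {z : E2 | z 0 ≤ s2 0} := by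
        refine convexHull_min (fun s hs => ⟨hm1 s hs, hm2 s hs⟩) ?_
        have hlin : IsLinearMap ℝ (fun z : E2 => z 0) := ⟨fun _ _ => rfl, fun _ _ => rfl⟩
        exact (convex_halfSpace_ge hlin _).inter (convex_halfSpace_le hlin _)
      obtain ⟨ε, hε, h1, h2⟩ := int_shift (hS1 i (interior_subset hy))
      have h3 := (hsub h1).2
      have h4 := (hsub h2).1
      simp at h3 h4
      linarith
    refine ⟨l, r, hinv' 0 l (Nat.zero_le _) hl ?_, hinv' l r hl hr (by linarith), hinv' r M hr le_rfl ?_, ?_, ?_⟩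
    · rw [hx0, hl']; exact (hS4 i s1 hs1).1
    · rw [hxM, hr']; exact (hS4 i s2 hs2).2
    · intro c h1 h2
      refine sl_between (hAv i).interior (hmono l c h1 (by omega)) (hmono c r h2 hr) ?_ ?_
      · rw [hl']; exact ⟨_, mem_sl (hS3 i s1 hs1)⟩
      · rw [hr']; exact ⟨_, mem_sl (hS3 i s2 hs2)⟩
    · intro s hs
      obtain ⟨c, hc, hc'⟩ := hex s hs
      have a1 := hm1 s hs
      have a2 := hm2 s hs
      exact ⟨c, hinv l c hl hc (by linarith), hinv c r hc hr (by linarith), hc'.symm⟩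
  choose l r hl1 hlr hrM hpr hSc using hLR
  have hprA : ∀ i c, l i ≤ c → c ≤ r i → (sl (A i) (x c)).Nonempty := fun i c h1 h2 => by
    obtain ⟨y, hy⟩ := hpr i c h1 h2
    exact ⟨y, interior_subset (s := A i) hy⟩
  have hprC : ∀ c, c ≤ M → (sl C (x c)).Nonempty := by
    intro c hc
    refine sl_between hCv (u := p 0) (w := q 0) ?_ ?_ ⟨_, mem_sl hp⟩ ⟨_, mem_sl hq⟩
    · rw [← hx0]; exact hmono 0 c (Nat.zero_le _) hc
    · rw [← hxM]; exact hmono c M hc le_rfl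
  have hstrC : ∀ c, 0 < c → c < M → bot C (x c) < top C (x c) := by
    intro c h1 h2
    have hz := hstrict z₀ hz₀
    have hzi : (!₂[z₀ 0, z₀ 1] : E2) ∈ interior C := by rw [pair_eta]; exact hz₀
    have hzt := (bot_lt hCc hzi).trans (lt_top hCc hzi)
    have hzs : (sl C (z₀ 0)).Nonempty := ⟨_, mem_sl (interior_subset hz₀)⟩
    have hps : (sl C (p 0)).Nonempty := ⟨_, mem_sl hp⟩
    have hqs : (sl C (q 0)).Nonempty := ⟨_, mem_sl hq⟩
    have hc0 : p 0 < x c := by rw [← hx0]; exact hsm 0 c h1 h2.le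
    have hcM : x c < q 0 := by rw [← hxM]; exact hsm c M h2 le_rfl
    rcases le_total (x c) (z₀ 0) with h | h
    · have a1 := top3 hCc hCv hc0.le h hps hzs
      have a2 := bot3 hCc hCv hc0.le h hps hzs
      have a3 := bot_le_top hCc hps
      by_contra hcon
      push Not at hcon
      nlinarith [mul_pos (sub_pos.2 hc0) (sub_pos.2 hzt), mul_nonneg (sub_nonneg.2 h) (sub_nonneg.2 a3)]
    · have a1 := top3 hCc hCv h hcM.le hzs hqs
      have a2 := bot3 hCc hCv h hcM.le hzs hqs
      have a3 := bot_le_top hCc hqs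
      by_contra hcon
      push Not at hcon
      nlinarith [mul_pos (sub_pos.2 hcM) (sub_pos.2 hzt), mul_nonneg (sub_nonneg.2 h) (sub_nonneg.2 a3)]
  have hC2 : ∀ i i' c, i ≠ i' → l i ≤ c → c ≤ r i → l i' ≤ c → c ≤ r i' →
      top (A i) (x c) < bot (A i') (x c) ∨ top (A i') (x c) < bot (A i) (x c) := by
    intro i i' c hne h1 h2 h3 h4
    by_contra hcon
    push Not at hcon
    obtain ⟨g1, g2⟩ := hcon
    have n1 := hprA i c h1 h2
    have n2 := hprA i' c h3 h4
    rcases le_total (top (A i) (x c)) (top (A i') (x c)) with h | h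
    · exact Set.disjoint_left.1 (hAd i i' hne) (top_mem (hAc i) n1)
        (sl_mem (hAv i') (bot_mem (hAc i') n2) (top_mem (hAc i') n2) g1 h)
    · exact Set.disjoint_left.1 (hAd i i' hne) (sl_mem (hAv i) (bot_mem (hAc i) n1) (top_mem (hAc i) n1) g2 h)
        (top_mem (hAc i') n2)
  have hOC : ∀ i i' c d, i ≠ i' → l i ≤ c → c ≤ r i → l i' ≤ c → c ≤ r i' →
      l i ≤ d → d ≤ r i → l i' ≤ d → d ≤ r i' → top (A i) (x c) < bot (A i') (x c) →
      top (A i) (x d) < bot (A i') (x d) := by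
    intro i i' c d hne h1 h2 h3 h4 h5 h6 h7 h8 hlt
    rcases hC2 i i' d hne h5 h6 h7 h8 with h | h
    · exact h
    · exfalso
      have nc := hprA i c h1 h2
      have nc' := hprA i' c h3 h4
      have nd := hprA i d h5 h6
      have nd' := hprA i' d h7 h8
      refine order_const (hAv i) (hAv i') (hAd i i' hne) (top_mem (hAc i) nc) (top_mem (hAc i) nd)
        (bot_mem (hAc i') nc') (bot_mem (hAc i') nd') hlt ?_
      have := bot_le_top (hAc i) nd
      have := bot_le_top (hAc i') nd'
      linarith
  let Q : Cols k M :=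
    { l := fun o => o.elim 0 l
      r := fun o => o.elim M r
      x := x
      t := fun o c => o.elim (bot C (x c)) fun i => top (A i) (x c)
      b := fun o c => o.elim (top C (x c)) fun i => bot (A i) (x c)
      M1 := by omega
      l0 := rfl
      r0 := rfl
      hl := hl1
      hlr := fun i => (hlr i).le
      hr := hrM
      hx := hx
      C1 := fun i c h1 h2 => by
        obtain ⟨y, hy⟩ := hpr i c h1 h2
        exact (bot_lt (hAc i) hy).trans (lt_top (hAc i) hy)
      C2 := hC2
      C3 := fun i c h1 h2 => bot_lt hCc (hAC i (bot_mem (hAc i) (hprA i c h1 h2)))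
      C4 := fun i c h1 h2 => lt_top hCc (hAC i (top_mem (hAc i) (hprA i c h1 h2)))
      C5 := fun c hc => bot_le_top hCc (hprC c hc)
      C6 := hstrC
      OC := fun i i' c hne h1 h2 h3 h4 =>
        ⟨hOC i i' c (c+1) hne h1 ((Nat.le_succ c).trans h2) h3 ((Nat.le_succ c).trans h4) (h1.trans (Nat.le_succ c)) h2
          (h3.trans (Nat.le_succ c)) h4,
         hOC i i' (c+1) c hne (h1.trans (Nat.le_succ c)) h2 (h3.trans (Nat.le_succ c)) h4 h1 ((Nat.le_succ c).trans h2) h3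
          ((Nat.le_succ c).trans h4)⟩
      conc := fun i c h1 h2 => by
        have h1' : l i < c := h1
        have h2' : c < r i := h2
        have := hrM i
        exact top3 (hAc i) (hAv i) (hmono (c-1) c (by omega) (by omega)) (hmono c (c+1) (by omega) (by omega))
          (hprA i _ (by omega) (by omega)) (hprA i _ (by omega) (by omega))
      conv := fun i c h1 h2 => by
        have h1' : l i < c := h1
        have h2' : c < r i := h2
        have := hrM i
        exact bot3 (hAc i) (hAv i) (hmono (c-1) c (by omega) (by omega)) (hmono c (c+1) (by omega) (by omega))
          (hprA i _ (by omega) (by omega)) (hprA i _ (by omega) (by omega)) }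
  have HC : PolyHyp x (fun j => top C (x j)) (fun j => bot C (x j)) 0 M :=
    polyHyp hCc hCv (by omega) (fun j _ h => hx j h) (fun j _ h => hprC j h)
  have hlenC : Q.len none = ∑ j ∈ Finset.Ico 0 M, (dist (!₂[x j, top C (x j)] : E2) !₂[x (j+1), top C (x (j+1))]
      + dist (!₂[x j, bot C (x j)] : E2) !₂[x (j+1), bot C (x (j+1))]) := by
    have hend : ∀ z w : E2, z ∈ C → w ∈ C → z 1 = w 1 → w 0 - z 0 = D → True := fun _ _ _ _ _ _ => trivial
    have e0 : ∀ y, (!₂[p 0, y] : E2) ∈ C → y = p 1 := by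
      intro y hy
      have h1 := dist_sq (!₂[p 0, y] : E2) q
      have h2 := hdle _ hy q hq
      have h3 : 0 ≤ dist (!₂[p 0, y] : E2) q := dist_nonneg
      simp at h1
      have h4 : (y - q 1) ^ 2 ≤ 0 := by nlinarith
      have h5 : y - q 1 = 0 := by nlinarith [sq_nonneg (y - q 1)]
      linarith
    have eM : ∀ y, (!₂[q 0, y] : E2) ∈ C → y = p 1 := by
      intro y hy
      have h1 := dist_sq p (!₂[q 0, y] : E2)
      have h2 := hdle p hp _ hy
      have h3 : 0 ≤ dist p (!₂[q 0, y] : E2) := dist_nonneg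
      simp at h1
      have h4 : (p 1 - y) ^ 2 ≤ 0 := by nlinarith
      have h5 : p 1 - y = 0 := by nlinarith [sq_nonneg (p 1 - y)]
      linarith
    have n0 := hprC 0 (Nat.zero_le _)
    have nM := hprC M le_rfl
    have f1 := e0 _ (hx0 ▸ top_mem hCc n0)
    have f2 := e0 _ (hx0 ▸ bot_mem hCc n0)
    have f3 := eM _ (hxM ▸ top_mem hCc nM)
    have f4 := eM _ (hxM ▸ bot_mem hCc nM)
    rw [Q.len_eq none (Nat.zero_le _)]
    show _ + (dist (!₂[x 0, top C (x 0)] : E2) !₂[x 0, bot C (x 0)] + dist (!₂[x M, top C (x M)] : E2) !₂[x M, bot C (x M)]) = _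
    rw [hx0, hxM, f1, f2, f3, f4, dist_self, dist_self, add_zero, add_zero]
    refine Finset.sum_congr rfl fun j _ => ?_
    rw [add_comm]
    rfl
  have hArc : 2 * D ≤ Q.len none := by
    rw [hlenC]
    have : ∀ j ∈ Finset.Ico 0 M, 2 * (x (j+1) - x j) ≤ (dist (!₂[x j, top C (x j)] : E2) !₂[x (j+1), top C (x (j+1))]
      + dist (!₂[x j, bot C (x j)] : E2) !₂[x (j+1), bot C (x (j+1))]) := by
      intro j _
      have a1 := dx_le_dist (!₂[x j, top C (x j)] : E2) !₂[x (j+1), top C (x (j+1))]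
      have a2 := dx_le_dist (!₂[x j, bot C (x j)] : E2) !₂[x (j+1), bot C (x (j+1))]
      simp only [PiLp.toLp_apply, Matrix.cons_val_zero] at a1 a2
      linarith
    refine le_trans (le_of_eq ?_) (Finset.sum_le_sum this)
    rw [← Finset.mul_sum, ← Finset.range_eq_Ico, Finset.sum_range_sub, hx0, hxM, hD]
  have hDpt : ∀ j j' s s', j ≤ M → j' ≤ M → ‖Q.pt (none, j, s) - Q.pt (none, j', s')‖ ≤ D := by
    have hmem : ∀ j s, j ≤ M → Q.pt (none, j, s) ∈ C := by
      intro j s hj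
      cases s
      · exact top_mem hCc (hprC j hj)
      · exact bot_mem hCc (hprC j hj)
    intro j j' s s' hj hj'
    rw [← dist_eq_norm]
    exact hdle _ (hmem j s hj) _ (hmem j' s' hj')
  have hbound := Q.bound D hDpt hArc
  have hCper : Q.len none ≤ (μH[1] (frontier C)).toReal := by
    rw [← ENNReal.ofReal_le_iff_le_toReal hfin, hlenC]
    refine (Poly_perim_ge HC ?_).trans ?_
    · intro j _ hj
      rcases Nat.eq_zero_or_pos j with h | h
      · right; exact hstrC (j+1) (by omega) (by omega)
      · left; exact hstrC j h hj
    · have hsubC := poly_sub hCc hCv (l := 0) (r := M) (x := x) (by omega) (fun j _ h => hx j h) (fun j _ h => hprC j h)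
      refine perim_mono (Poly_closed HC) (Poly_convex HC) ?_ hCc.isBounded hsubC
      refine ⟨(!₂[x 0, top C (x 0)] : E2), ?_⟩
      have := hull_sub hCc hCv (l := 0) (r := M) (x := x) (by omega) (fun j _ h => hx j h) (fun j _ h => hprC j h)
        (S := {(!₂[x 0, top C (x 0)] : E2)}) (by
          rw [singleton_subset_iff]; exact top_mem hCc (hprC 0 (Nat.zero_le _)))
        (fun s hs => ⟨0, le_rfl, Nat.zero_le _, by rw [mem_singleton_iff.1 hs]; simp⟩)
      exact this (subset_convexHull ℝ _ rfl)
  have hKper : ∀ i, (μH[1] (frontier (K i))).toReal ≤ Q.len (some i) := by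
    intro i
    have hxi : ∀ j, l i ≤ j → j < r i → x j < x (j+1) := fun j _ h => hx j (by have := hrM i; omega)
    have HK := polyHyp (hAc i) (hAv i) (hlr i) hxi (hprA i)
    have hnn : 0 ≤ Q.len (some i) := by unfold Cols.len; positivity
    refine ENNReal.toReal_le_of_le_ofReal hnn ?_
    have h1 : K i ⊆ _ := ((hS1 i).trans interior_subset).trans (hull_sub (hAc i) (hAv i) (hlr i) hxi (hprA i)
      (S := (S i : Set E2)) (fun s hs => interior_subset (hS3 i s hs)) (hSc i))
    refine (perim_mono (hKc i).isClosed (hKv i) ((hKi i).mono interior_subset) (Poly_bounded HK) h1).trans ?_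
    rw [Q.len_eq (some i) (hlr i).le]
    exact Poly_perim_le HK
  have := Finset.sum_le_sum (fun i (_ : i ∈ Finset.univ) => hKper i)
  linarith
end Forest

namespace Forest

theorem perim_fin {C : Set E2} (hc : IsCompact C) (hv : Convex ℝ C) (hn : C.Nonempty) : μH[1] (frontier C) ≠ ⊤ := by
  obtain ⟨R, hR⟩ := hc.isBounded.exists_norm_le
  have hR0 : 0 ≤ R := by
    obtain ⟨z, hz⟩ := hn
    exact (norm_nonneg z).trans (hR z hz)
  let x : ℕ → ℝ := fun j => if j = 0 then -(R+1) else R+1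
  have H : PolyHyp x (fun _ => R) (fun _ => -R) 0 1 := by
    refine ⟨one_pos, ?_, fun _ _ _ => by linarith, fun j m _ _ _ _ => ?_, fun j m _ _ _ _ => ?_⟩
    · intro j _ hj
      obtain rfl : j = 0 := by omega
      simp [x]; linarith
    · apply le_of_eq; ring
    · apply le_of_eq; ring
  have hsub : C ⊆ Poly x (fun _ => R) (fun _ => -R) 0 1 := by
    intro z hz
    have h0 := (PiLp.norm_apply_le z 0).trans (hR z hz)
    have h1 := (PiLp.norm_apply_le z 1).trans (hR z hz)
    rw [Real.norm_eq_abs, abs_le] at h0 h1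
    refine ⟨by simp [x]; linarith, by simp [x]; linarith, fun j _ hj => ?_⟩
    obtain rfl : j = 0 := by omega
    constructor
    · simp [GG, x]; nlinarith
    · simp [GG, x]; nlinarith
  exact ne_top_of_le_ne_top ENNReal.ofReal_ne_top
    ((perim_mono hc.isClosed hv hn (Poly_bounded H) hsub).trans (Poly_perim_le H))

theorem core' (k : ℕ) (C : Set E2) (A K : Fin k → Set E2) (hCc : IsCompact C) (hCv : Convex ℝ C)
    (hCi : (interior C).Nonempty)
    (hAc : ∀ i, IsCompact (A i)) (hAv : ∀ i, Convex ℝ (A i)) (hAC : ∀ i, A i ⊆ interior C)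
    (hAd : ∀ i j, i ≠ j → Disjoint (A i) (A j))
    (hKc : ∀ i, IsCompact (K i)) (hKv : ∀ i, Convex ℝ (K i)) (hKi : ∀ i, (interior (K i)).Nonempty)
    (hKA : ∀ i, K i ⊆ interior (A i)) :
    ∑ i, (μH[1] (frontier (K i))).toReal ≤ (μH[1] (frontier C)).toReal + 2 * ((k : ℝ) - 1) * Metric.diam C := by
  have hCn : C.Nonempty := hCi.mono interior_subset
  obtain ⟨⟨p, q⟩, ⟨hp, hq⟩, hmax⟩ := (hCc.prod hCc).exists_isMaxOn (hCn.prod hCn)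
    (f := fun z : E2 × E2 => dist z.1 z.2) (by fun_prop)
  have hD : dist p q = Metric.diam C := by
    refine le_antisymm (Metric.dist_le_diam_of_mem hCc.isBounded hp hq) ?_
    refine Metric.diam_le_of_forall_dist_le dist_nonneg fun z hz w hw => ?_
    have := isMaxOn_iff.1 hmax (z, w) (Set.mk_mem_prod hz hw)
    simpa only using this
  let w : E2 := !₂[Metric.diam C, 0]
  have hw : ‖q - p‖ = ‖w‖ := by
    rw [← dist_eq_norm, dist_comm, hD, EuclideanSpace.norm_eq]
    simp [w, Fin.sum_univ_two, Real.sqrt_sq Metric.diam_nonneg]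
  let T : E2 ≃ₗᵢ[ℝ] E2 := Submodule.reflection (ℝ ∙ ((q - p) - w))ᗮ
  have hT : T (q - p) = w := Submodule.reflection_sub hw
  have hTpq : T q - T p = w := by rw [← map_sub, hT]
  have hfr : ∀ s : Set E2, μH[1] (frontier (T '' s)) = μH[1] (frontier s) := by
    intro s
    have : frontier (T '' s) = T '' frontier s := (T.toHomeomorph.image_frontier s).symm
    rw [this]
    exact T.isometry.hausdorffMeasure_image (Or.inl zero_le_one) _
  have hIn : ∀ s : Set E2, interior (T '' s) = T '' interior s := fun s => (T.toHomeomorph.image_interior s).symm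
  have hcv : ∀ s : Set E2, Convex ℝ s → Convex ℝ (T '' s) := fun s hs => hs.is_linear_image ⟨map_add T, map_smul T⟩
  have hdm : Metric.diam (T '' C) = Metric.diam C := T.isometry.diam_image C
  have key := core k (T '' C) (fun i => T '' A i) (fun i => T '' K i) (hCc.image T.continuous) (hcv _ hCv)
    (by rw [hIn]; exact hCi.image _) (by rw [hfr]; exact perim_fin hCc hCv hCn) (T p) (T q)
    (mem_image_of_mem _ hp) (mem_image_of_mem _ hq)
    (by have := congrArg (fun z : E2 => z 1) hTpq
        simp [w] at this
        linarith)
    (by have := congrArg (fun z : E2 => z 0) hTpq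
        simp [w] at this
        rw [hdm]; linarith)
    (fun i => (hAc i).image T.continuous) (fun i => hcv _ (hAv i)) (fun i => by rw [hIn]; exact image_mono (hAC i))
    (fun i j h => (disjoint_image_iff T.injective).2 (hAd i j h))
    (fun i => (hKc i).image T.continuous) (fun i => hcv _ (hKv i)) (fun i => by rw [hIn]; exact (hKi i).image _)
    (fun i => by rw [hIn]; exact image_mono (hKA i))
  simp only [hfr, hdm] at key
  exact key

end Forest

theorem total_perimeter_bound (k : ℕ) (C : Set E2) (B : Fin k → Set E2)
    (hC : IsConvexBody C) (hB : ∀ i, IsConvexBody (B i))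
    (hsub : ∀ i, B i ⊆ C)
    (hdisj : ∀ i j, i ≠ j → interior (B i) ∩ interior (B j) = ∅) :
    ∑ i, per (B i) ≤ per C + 2 * ((k : ℝ) - 1) * Metric.diam C := by
  have hstep : ∀ a : ℝ, 0 < a → a < 1 → a * (a * ∑ i, per (B i)) ≤ per C + 2 * ((k : ℝ) - 1) * Metric.diam C := by
    intro a ha ha1
    choose A h1 h2 h3 h4 h5 using fun i => Forest.shrink (hB i).1 (hB i).2.1 (hB i).2.2 ha ha1
    choose K g1 g2 g3 g4 g5 using fun i => Forest.shrink (h1 i) (h2 i) (h3 i) ha ha1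
    have := Forest.core' k C A K hC.1 hC.2.1 hC.2.2 h1 h2 (fun i => (h4 i).trans (interior_mono (hsub i)))
      (fun i j hij => (Set.disjoint_iff_inter_eq_empty.2 (hdisj i j hij)).mono (h4 i) (h4 j)) g1 g2 g3 g4
    refine le_trans (le_of_eq ?_) this
    rw [Finset.mul_sum, Finset.mul_sum]
    refine Finset.sum_congr rfl fun i _ => ?_
    rw [g5, h5, ENNReal.toReal_mul, ENNReal.toReal_mul, ENNReal.toReal_ofReal ha.le]
    rfl
  have hlim : Filter.Tendsto (fun a : ℝ => a * (a * ∑ i, per (B i))) (nhdsWithin 1 (Iio 1)) (nhds (∑ i, per (B i))) := by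
    have hc : Continuous fun a : ℝ => a * (a * ∑ i, per (B i)) := by fun_prop
    have := (hc.tendsto 1).mono_left (nhdsWithin_le_nhds (s := Iio 1))
    simpa using this
  refine le_of_tendsto hlim ?_
  filter_upwards [Ioo_mem_nhdsLT (zero_lt_one (α := ℝ))] with a ha
  exact hstep a ha.1 ha.2

end
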